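/- Let a, b, c and (l_ij), (m_ij) and F be as in the generalized Monge–Ampère setup. For every positive integer k there exists a constant C > 0, depending only on k, F, a, b, c, (l_ij), (m_ij), such that for every t ∈ [0,1] and every twice continuously differentiable biperiodic function p satisfying the deformed equation (GMA_t) and the deformed ellipticity condition (E_t): p is smooth, and every partial derivative of order at most k of the function p − ∫_{𝕋²} p is bounded in absolute value by C on ℝ². -/

import Mathlib

open MeasureTheory

/-- Partial derivative in the first variable. -/
noncomputable def pdx (p : ℝ × ℝ → ℝ) (z : ℝ × ℝ) : ℝ := fderiv ℝ p z (1, 0)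

/-- Partial derivative in the second variable. -/
noncomputable def pdy (p : ℝ × ℝ → ℝ) (z : ℝ × ℝ) : ℝ := fderiv ℝ p z (0, 1)

/-- A function `ℝ² → ℝ` is biperiodic if it has period 1 in each variable. -/
def Biperiodic (p : ℝ × ℝ → ℝ) : Prop :=
  ∀ x y : ℝ, p (x + 1, y) = p (x, y) ∧ p (x, y + 1) = p (x, y)

/-- The integral over the torus `𝕋² = ℝ²/ℤ²` of (the descent of) a biperiodic function. -/
noncomputable def torusInt (f : ℝ × ℝ → ℝ) : ℝ := ∫ x in (0:ℝ)..1, ∫ y in (0:ℝ)..1, f (x, y)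

/-! ### Part A: integration on the torus -/

namespace GMA

/-- Lebesgue measure on the unit square. -/
noncomputable def sq : Measure (ℝ × ℝ) :=
  (volume.restrict (Set.Ioc (0:ℝ) 1)).prod (volume.restrict (Set.Ioc (0:ℝ) 1))

/-- Integral over the unit square. -/
noncomputable def TI (f : ℝ × ℝ → ℝ) : ℝ := ∫ z, f z ∂sq

instance : IsProbabilityMeasure (volume.restrict (Set.Ioc (0:ℝ) 1)) := ⟨by simp⟩

instance : IsProbabilityMeasure sq := by unfold sq; infer_instance

lemma sq_eq : sq = volume.restrict (Set.Ioc (0:ℝ) 1 ×ˢ Set.Ioc (0:ℝ) 1) := by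
  unfold sq
  rw [Measure.prod_restrict]; rfl

lemma integrable {f : ℝ × ℝ → ℝ} (hf : Continuous f) : Integrable f sq := by
  rw [sq_eq]
  have h : IntegrableOn f (Set.Icc (0:ℝ) 1 ×ˢ Set.Icc (0:ℝ) 1) :=
    hf.continuousOn.integrableOn_compact (isCompact_Icc.prod isCompact_Icc)
  exact h.mono_set (Set.prod_mono Set.Ioc_subset_Icc_self Set.Ioc_subset_Icc_self)

lemma TI_add {f g : ℝ × ℝ → ℝ} (hf : Continuous f) (hg : Continuous g) :
    TI (fun z => f z + g z) = TI f + TI g := integral_add (integrable hf) (integrable hg)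

lemma TI_sub {f g : ℝ × ℝ → ℝ} (hf : Continuous f) (hg : Continuous g) :
    TI (fun z => f z - g z) = TI f - TI g := integral_sub (integrable hf) (integrable hg)

lemma TI_mul (c : ℝ) (f : ℝ × ℝ → ℝ) : TI (fun z => c * f z) = c * TI f :=
  integral_const_mul c f

lemma TI_neg (f : ℝ × ℝ → ℝ) : TI (fun z => - f z) = - TI f := integral_neg f

lemma TI_const (c : ℝ) : TI (fun _ => c) = c := by simp [TI]

lemma TI_mono {f g : ℝ × ℝ → ℝ} (hf : Continuous f) (hg : Continuous g) (h : ∀ z, f z ≤ g z) :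
    TI f ≤ TI g := integral_mono (integrable hf) (integrable hg) h

lemma TI_nonneg {f : ℝ × ℝ → ℝ} (h : ∀ z, 0 ≤ f z) : 0 ≤ TI f := integral_nonneg h

lemma TI_sum {ι : Type*} (s : Finset ι) (f : ι → ℝ × ℝ → ℝ) (hf : ∀ i ∈ s, Continuous (f i)) :
    TI (fun z => ∑ i ∈ s, f i z) = ∑ i ∈ s, TI (f i) :=
  integral_finsetSum s fun i hi => integrable (hf i hi)

lemma TI_abs_le {f : ℝ × ℝ → ℝ} : |TI f| ≤ TI (fun z => |f z|) := abs_integral_le_integral_abs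

lemma TI_eq {f : ℝ × ℝ → ℝ} (hf : Continuous f) :
    TI f = ∫ x in (0:ℝ)..1, ∫ y in (0:ℝ)..1, f (x, y) := by
  unfold TI
  have := integral_prod f (integrable hf)
  rw [sq, this, intervalIntegral.integral_of_le zero_le_one]
  simp_rw [intervalIntegral.integral_of_le (zero_le_one (α := ℝ))]

lemma TI_eq' {f : ℝ × ℝ → ℝ} (hf : Continuous f) :
    TI f = ∫ y in (0:ℝ)..1, ∫ x in (0:ℝ)..1, f (x, y) := by
  unfold TI
  have := integral_prod_symm f (integrable hf)
  rw [sq, this, intervalIntegral.integral_of_le zero_le_one]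
  simp_rw [intervalIntegral.integral_of_le (zero_le_one (α := ℝ))]

lemma TI_torusInt {f : ℝ × ℝ → ℝ} (hf : Continuous f) : torusInt f = TI f := (TI_eq hf).symm

lemma TI_shift {f : ℝ × ℝ → ℝ} (hf : Continuous f) (hp : Biperiodic f) (w : ℝ × ℝ) :
    TI (fun z => f (z + w)) = TI f := by
  have hx : TI (fun z => f (z + (w.1, 0))) = TI f := by
    rw [TI_eq' (by fun_prop), TI_eq' hf]
    congr 1; ext y
    have hper : Function.Periodic (fun x => f (x, y)) 1 := fun x => (hp x y).1
    have := hper.intervalIntegral_add_eq w.1 0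
    simp only [Prod.mk_add_mk, add_zero]
    rw [intervalIntegral.integral_comp_add_right (fun x => f (x, y)), zero_add, add_comm 1]
    simpa using this
  have hy : TI (fun z => f (z + w)) = TI (fun z => f (z + (w.1, 0))) := by
    rw [TI_eq (by fun_prop), TI_eq (by fun_prop)]
    congr 1; ext x
    have hper : Function.Periodic (fun y => f (x + w.1, y)) 1 := fun y => (hp _ y).2
    have := hper.intervalIntegral_add_eq w.2 0
    have e : ∀ y, ((x, y) + w : ℝ × ℝ) = (x + w.1, y + w.2) := fun y => rfl
    simp only [Prod.mk_add_mk, add_zero, e]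
    rw [intervalIntegral.integral_comp_add_right (fun y => f (x + w.1, y)), zero_add, add_comm 1]
    simpa using this
  rw [hy, hx]

/-! #### Periodicity -/

lemma per_zadd {f : ℝ × ℝ → ℝ} (hp : Biperiodic f) (z : ℝ × ℝ) :
    f (z + (1, 0)) = f z ∧ f (z + (0, 1)) = f z := by
  obtain ⟨x, y⟩ := z
  simpa using hp x y

lemma per_of {f : ℝ × ℝ → ℝ} (h : ∀ z, f (z + (1, 0)) = f z ∧ f (z + (0, 1)) = f z) :
    Biperiodic f := fun x y => by simpa using h (x, y)

lemma per_comp {f : ℝ × ℝ → ℝ} (hf : Biperiodic f) (g : ℝ → ℝ) :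
    Biperiodic (fun z => g (f z)) := fun x y => by simp [(hf x y).1, (hf x y).2]

lemma per_comp2 {f f' : ℝ × ℝ → ℝ} (hf : Biperiodic f) (hf' : Biperiodic f') (g : ℝ → ℝ → ℝ) :
    Biperiodic (fun z => g (f z) (f' z)) := fun x y => by
  simp [(hf x y).1, (hf x y).2, (hf' x y).1, (hf' x y).2]

lemma per_add {f g : ℝ × ℝ → ℝ} (hf : Biperiodic f) (hg : Biperiodic g) :
    Biperiodic (fun z => f z + g z) := per_comp2 hf hg (· + ·)
lemma per_sub {f g : ℝ × ℝ → ℝ} (hf : Biperiodic f) (hg : Biperiodic g) :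
    Biperiodic (fun z => f z - g z) := per_comp2 hf hg (· - ·)
lemma per_mul {f g : ℝ × ℝ → ℝ} (hf : Biperiodic f) (hg : Biperiodic g) :
    Biperiodic (fun z => f z * g z) := per_comp2 hf hg (· * ·)
lemma per_const (c : ℝ) : Biperiodic (fun _ => c) := fun _ _ => ⟨rfl, rfl⟩
lemma per_cmul (c : ℝ) {f : ℝ × ℝ → ℝ} (hf : Biperiodic f) :
    Biperiodic (fun z => c * f z) := per_comp hf (c * ·)
lemma per_shift {f : ℝ × ℝ → ℝ} (hf : Biperiodic f) (w : ℝ × ℝ) :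
    Biperiodic (fun z => f (z + w)) := per_of fun z => by
  have := per_zadd hf (z + w)
  rw [add_right_comm, add_right_comm z (0,1)]; exact this

lemma per_fderiv {f : ℝ × ℝ → ℝ} (hf : Biperiodic f) (v : ℝ × ℝ) :
    Biperiodic (fun z => fderiv ℝ f z v) := per_of fun z => by
  have h1 : (fun z => f (z + (1, 0))) = f := funext fun z => (per_zadd hf z).1
  have h2 : (fun z => f (z + (0, 1))) = f := funext fun z => (per_zadd hf z).2
  constructor
  · conv_rhs => rw [← h1]
    rw [fderiv_comp_add_right]
  · conv_rhs => rw [← h2]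
    rw [fderiv_comp_add_right]

lemma per_pdx {f : ℝ × ℝ → ℝ} (hf : Biperiodic f) : Biperiodic (pdx f) := per_fderiv hf _
lemma per_pdy {f : ℝ × ℝ → ℝ} (hf : Biperiodic f) : Biperiodic (pdy f) := per_fderiv hf _

/-- Reduction of a point to the unit square. -/
lemma per_reduce {f : ℝ × ℝ → ℝ} (hf : Biperiodic f) (z : ℝ × ℝ) :
    ∃ w ∈ Set.Icc (0:ℝ) 1 ×ˢ Set.Icc (0:ℝ) 1, f z = f w := by
  refine ⟨(Int.fract z.1, Int.fract z.2), ⟨⟨Int.fract_nonneg _, (Int.fract_lt_one _).le⟩,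
    ⟨Int.fract_nonneg _, (Int.fract_lt_one _).le⟩⟩, ?_⟩
  have h1 : ∀ y, Function.Periodic (fun x => f (x, y)) 1 := fun y x => (hf x y).1
  have h2 : ∀ x, Function.Periodic (fun y => f (x, y)) 1 := fun x y => (hf x y).2
  have e1 := (h1 z.2).sub_int_mul_eq ⌊z.1⌋ (x := z.1)
  have e2 := (h2 (Int.fract z.1)).sub_int_mul_eq ⌊z.2⌋ (x := z.2)
  simp only [mul_one] at e1 e2
  rw [Int.self_sub_floor] at e1 e2
  rw [e2, e1]

/-- A continuous biperiodic function attains its maximum. -/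
lemma per_exists_max {f : ℝ × ℝ → ℝ} (hc : Continuous f) (hf : Biperiodic f) :
    ∃ w, ∀ z, f z ≤ f w := by
  obtain ⟨w, _, hw⟩ := (isCompact_Icc (a := (0:ℝ)) (b := 1)).prod
    (isCompact_Icc (a := (0:ℝ)) (b := 1)) |>.exists_isMaxOn ⟨(0, 0), by simp⟩ hc.continuousOn
  refine ⟨w, fun z => ?_⟩
  obtain ⟨z', hz', e⟩ := per_reduce hf z
  rw [e]; exact hw hz'

lemma per_bdd {f : ℝ × ℝ → ℝ} (hc : Continuous f) (hf : Biperiodic f) :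
    ∃ M, 0 ≤ M ∧ ∀ z, |f z| ≤ M := by
  obtain ⟨w, hw⟩ := per_exists_max hc.abs (per_comp hf (fun x => |x|))
  exact ⟨|f w|, abs_nonneg _, hw⟩

/-! #### Calculus of `pdx`, `pdy` -/

lemma cd_pdx {n m : WithTop ℕ∞} {f : ℝ × ℝ → ℝ} (hf : ContDiff ℝ n f) (h : m + 1 ≤ n) :
    ContDiff ℝ m (pdx f) := (hf.fderiv_right h).clm_apply contDiff_const
lemma cd_pdy {n m : WithTop ℕ∞} {f : ℝ × ℝ → ℝ} (hf : ContDiff ℝ n f) (h : m + 1 ≤ n) :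
    ContDiff ℝ m (pdy f) := (hf.fderiv_right h).clm_apply contDiff_const

lemma fderiv_eq (f : ℝ × ℝ → ℝ) (z v : ℝ × ℝ) :
    fderiv ℝ f z v = v.1 * pdx f z + v.2 * pdy f z := by
  have : v = v.1 • ((1, 0) : ℝ × ℝ) + v.2 • ((0, 1) : ℝ × ℝ) := by ext <;> simp
  conv_lhs => rw [this]
  rw [map_add, map_smul, map_smul]
  rfl

lemma hasDerivAt_line {f : ℝ × ℝ → ℝ} (hf : Differentiable ℝ f) (z v : ℝ × ℝ) (s : ℝ) :
    HasDerivAt (fun s : ℝ => f (z + s • v)) (v.1 * pdx f (z + s • v) + v.2 * pdy f (z + s • v)) s := by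
  rw [← fderiv_eq]
  have h1 : HasDerivAt (fun s : ℝ => z + s • v) v s := by
    simpa using ((hasDerivAt_id s).smul_const v).const_add z
  exact (hf _).hasFDerivAt.comp_hasDerivAt s h1

lemma hasDerivAt_x {f : ℝ × ℝ → ℝ} (hf : Differentiable ℝ f) (x y : ℝ) :
    HasDerivAt (fun s : ℝ => f (s, y)) (pdx f (x, y)) x := by
  have h1 : HasDerivAt (fun s : ℝ => (s, y)) ((1, 0) : ℝ × ℝ) x :=
    (hasDerivAt_id x).prodMk (hasDerivAt_const x y)
  exact (hf _).hasFDerivAt.comp_hasDerivAt x h1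

lemma hasDerivAt_y {f : ℝ × ℝ → ℝ} (hf : Differentiable ℝ f) (x y : ℝ) :
    HasDerivAt (fun s : ℝ => f (x, s)) (pdy f (x, y)) y := by
  have h1 : HasDerivAt (fun s : ℝ => (x, s)) ((0, 1) : ℝ × ℝ) y :=
    (hasDerivAt_const y x).prodMk (hasDerivAt_id y)
  exact (hf _).hasFDerivAt.comp_hasDerivAt y h1

lemma cont_pdx {f : ℝ × ℝ → ℝ} (hf : ContDiff ℝ 1 f) : Continuous (pdx f) :=
  (cd_pdx (m := 0) hf (by simp)).continuous
lemma cont_pdy {f : ℝ × ℝ → ℝ} (hf : ContDiff ℝ 1 f) : Continuous (pdy f) :=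
  (cd_pdy (m := 0) hf (by simp)).continuous

lemma TI_pdx {f : ℝ × ℝ → ℝ} (hf : ContDiff ℝ 1 f) (hp : Biperiodic f) : TI (pdx f) = 0 := by
  rw [TI_eq' (cont_pdx hf)]
  have : ∀ y, ∫ x in (0:ℝ)..1, pdx f (x, y) = 0 := fun y => by
    rw [intervalIntegral.integral_eq_sub_of_hasDerivAt (f := fun s => f (s, y))
      (fun x _ => hasDerivAt_x (hf.differentiable one_ne_zero) x y)]
    · have := (hp 0 y).1; simp at this; simp [this]
    · exact ((cont_pdx hf).comp (by fun_prop : Continuous fun x : ℝ => (x, y))).intervalIntegrable _ _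
  simp [this]

lemma TI_pdy {f : ℝ × ℝ → ℝ} (hf : ContDiff ℝ 1 f) (hp : Biperiodic f) : TI (pdy f) = 0 := by
  rw [TI_eq (cont_pdy hf)]
  have : ∀ x, ∫ y in (0:ℝ)..1, pdy f (x, y) = 0 := fun x => by
    rw [intervalIntegral.integral_eq_sub_of_hasDerivAt (f := fun s => f (x, s))
      (fun y _ => hasDerivAt_y (hf.differentiable one_ne_zero) x y)]
    · have := (hp x 0).2; simp at this; simp [this]
    · exact ((cont_pdy hf).comp (by fun_prop : Continuous fun y : ℝ => (x, y))).intervalIntegrable _ _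
  simp [this]

section algebra
variable {f g : ℝ × ℝ → ℝ} (hf : Differentiable ℝ f) (hg : Differentiable ℝ g)
lemma pdx_add (hf : Differentiable ℝ f) (hg : Differentiable ℝ g) :
    pdx (fun z => f z + g z) = fun z => pdx f z + pdx g z := by
  ext z; simp [pdx, fderiv_fun_add (hf z) (hg z)]
lemma pdy_add (hf : Differentiable ℝ f) (hg : Differentiable ℝ g) :
    pdy (fun z => f z + g z) = fun z => pdy f z + pdy g z := by
  ext z; simp [pdy, fderiv_fun_add (hf z) (hg z)]
lemma pdx_sub (hf : Differentiable ℝ f) (hg : Differentiable ℝ g) :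
    pdx (fun z => f z - g z) = fun z => pdx f z - pdx g z := by
  ext z; simp [pdx, fderiv_fun_sub (hf z) (hg z)]
lemma pdy_sub (hf : Differentiable ℝ f) (hg : Differentiable ℝ g) :
    pdy (fun z => f z - g z) = fun z => pdy f z - pdy g z := by
  ext z; simp [pdy, fderiv_fun_sub (hf z) (hg z)]
lemma pdx_mul (hf : Differentiable ℝ f) (hg : Differentiable ℝ g) :
    pdx (fun z => f z * g z) = fun z => f z * pdx g z + g z * pdx f z := by
  ext z; simp [pdx, fderiv_fun_mul (hf z) (hg z)]
lemma pdy_mul (hf : Differentiable ℝ f) (hg : Differentiable ℝ g) :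
    pdy (fun z => f z * g z) = fun z => f z * pdy g z + g z * pdy f z := by
  ext z; simp [pdy, fderiv_fun_mul (hf z) (hg z)]
lemma pdx_cmul (c : ℝ) (hf : Differentiable ℝ f) :
    pdx (fun z => c * f z) = fun z => c * pdx f z := by
  ext z; simp [pdx, fderiv_const_mul (hf z)]
lemma pdy_cmul (c : ℝ) (hf : Differentiable ℝ f) :
    pdy (fun z => c * f z) = fun z => c * pdy f z := by
  ext z; simp [pdy, fderiv_const_mul (hf z)]
lemma pdx_shift (f : ℝ × ℝ → ℝ) (w : ℝ × ℝ) :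
    pdx (fun z => f (z + w)) = fun z => pdx f (z + w) := by
  ext z; simp [pdx, fderiv_comp_add_right]
lemma pdy_shift (f : ℝ × ℝ → ℝ) (w : ℝ × ℝ) :
    pdy (fun z => f (z + w)) = fun z => pdy f (z + w) := by
  ext z; simp [pdy, fderiv_comp_add_right]
lemma pdx_const (c : ℝ) : pdx (fun _ => c) = fun _ => 0 := by ext z; simp [pdx]
lemma pdy_const (c : ℝ) : pdy (fun _ => c) = fun _ => 0 := by ext z; simp [pdy]
end algebra

lemma pd_comm {f : ℝ × ℝ → ℝ} (hf : ContDiff ℝ 2 f) : pdx (pdy f) = pdy (pdx f) := by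
  ext z
  have hd : DifferentiableAt ℝ (fderiv ℝ f) z :=
    (hf.fderiv_right (m := 1) (by norm_num)).differentiable one_ne_zero z
  have hs : IsSymmSndFDerivAt ℝ f z := hf.contDiffAt.isSymmSndFDerivAt (by simp)
  have e1 : ∀ v w : ℝ × ℝ, fderiv ℝ (fun z => fderiv ℝ f z v) z w = fderiv ℝ (fderiv ℝ f) z w v := by
    intro v w
    rw [fderiv_clm_apply hd (differentiableAt_const v)]
    simp
  change fderiv ℝ (fun z => fderiv ℝ f z (0, 1)) z (1, 0) = fderiv ℝ (fun z => fderiv ℝ f z (1, 0)) z (0, 1)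
  rw [e1, e1]
  exact hs.eq _ _

/-- Cauchy-Schwarz inequality. -/
lemma TI_cs {f g : ℝ × ℝ → ℝ} (hf : Continuous f) (hg : Continuous g) :
    TI (fun z => f z * g z) ^ 2 ≤ TI (fun z => f z ^ 2) * TI (fun z => g z ^ 2) := by
  have key : ∀ s : ℝ, 0 ≤ TI (fun z => f z ^ 2) * (s * s) + (2 * TI (fun z => f z * g z)) * s
      + TI (fun z => g z ^ 2) := by
    intro s
    have h0 : 0 ≤ TI (fun z => (s * f z + g z) ^ 2) := TI_nonneg fun z => sq_nonneg _
    have e : TI (fun z => (s * f z + g z) ^ 2) = TI (fun z => f z ^ 2) * (s * s)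
        + (2 * TI (fun z => f z * g z)) * s + TI (fun z => g z ^ 2) := by
      have : (fun z => (s * f z + g z) ^ 2) = fun z => (s * s * f z ^ 2 + 2 * s * (f z * g z)) + g z ^ 2 := by
        ext z; ring
      rw [this, TI_add (by fun_prop) (by fun_prop), TI_add (by fun_prop) (by fun_prop), TI_mul, TI_mul]
      ring
    rwa [e] at h0
  have := discrim_le_zero key
  unfold discrim at this
  nlinarith

end GMA

/-! ### Part B: finite differences and discrete Gagliardo-Nirenberg inequalities -/

namespace GMA

/-- Difference operator. -/
def dl (w : ℝ × ℝ) (f : ℝ × ℝ → ℝ) : ℝ × ℝ → ℝ := fun z => f (z + w) - f z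

/-- Iterated difference operator. -/
def dn (w : ℝ × ℝ) : ℕ → (ℝ × ℝ → ℝ) → ℝ × ℝ → ℝ
  | 0, f => f
  | k + 1, f => dl w (dn w k f)

lemma dl_cont {w : ℝ × ℝ} {f : ℝ × ℝ → ℝ} (hf : Continuous f) : Continuous (dl w f) := by
  unfold dl; fun_prop
lemma dn_cont {w : ℝ × ℝ} {f : ℝ × ℝ → ℝ} (hf : Continuous f) (k : ℕ) : Continuous (dn w k f) := by
  induction k with
  | zero => exact hf
  | succ k ih => exact dl_cont ih
lemma dl_per {w : ℝ × ℝ} {f : ℝ × ℝ → ℝ} (hf : Biperiodic f) : Biperiodic (dl w f) :=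
  per_sub (per_shift hf w) hf
lemma dn_per {w : ℝ × ℝ} {f : ℝ × ℝ → ℝ} (hf : Biperiodic f) (k : ℕ) : Biperiodic (dn w k f) := by
  induction k with
  | zero => exact hf
  | succ k ih => exact dl_per ih
lemma dn_cd {w : ℝ × ℝ} {f : ℝ × ℝ → ℝ} {m : WithTop ℕ∞} (hf : ContDiff ℝ m f) (k : ℕ) :
    ContDiff ℝ m (dn w k f) := by
  induction k with
  | zero => exact hf
  | succ k ih => exact (ih.comp (contDiff_id.add contDiff_const)).sub ih
lemma dn_pdx {w : ℝ × ℝ} {f : ℝ × ℝ → ℝ} (hf : ContDiff ℝ 1 f) (k : ℕ) :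
    pdx (dn w k f) = dn w k (pdx f) := by
  induction k with
  | zero => rfl
  | succ k ih =>
    have h := (dn_cd (w := w) hf k).differentiable one_ne_zero
    change pdx (fun z => dn w k f (z + w) - dn w k f z) = _
    have h' : Differentiable ℝ (fun z => dn w k f (z + w)) :=
      h.comp (differentiable_id.add_const w)
    rw [pdx_sub h' h, pdx_shift, ih]
    rfl
lemma dn_pdy {w : ℝ × ℝ} {f : ℝ × ℝ → ℝ} (hf : ContDiff ℝ 1 f) (k : ℕ) :
    pdy (dn w k f) = dn w k (pdy f) := by
  induction k with
  | zero => rfl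
  | succ k ih =>
    have h := (dn_cd (w := w) hf k).differentiable one_ne_zero
    change pdy (fun z => dn w k f (z + w) - dn w k f z) = _
    have h' : Differentiable ℝ (fun z => dn w k f (z + w)) :=
      h.comp (differentiable_id.add_const w)
    rw [pdy_sub h' h, pdy_shift, ih]
    rfl
lemma dn_add (w : ℝ × ℝ) (f g : ℝ × ℝ → ℝ) (k : ℕ) :
    dn w k (fun z => f z + g z) = fun z => dn w k f z + dn w k g z := by
  induction k with
  | zero => rfl
  | succ k ih => simp only [dn, ih]; ext z; simp only [dl]; ring
lemma dn_sub (w : ℝ × ℝ) (f g : ℝ × ℝ → ℝ) (k : ℕ) :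
    dn w k (fun z => f z - g z) = fun z => dn w k f z - dn w k g z := by
  induction k with
  | zero => rfl
  | succ k ih => simp only [dn, ih]; ext z; simp only [dl]; ring
lemma dn_cmul (w : ℝ × ℝ) (c : ℝ) (f : ℝ × ℝ → ℝ) (k : ℕ) :
    dn w k (fun z => c * f z) = fun z => c * dn w k f z := by
  induction k with
  | zero => rfl
  | succ k ih => simp only [dn, ih]; ext z; simp only [dl]; ring
lemma dn_const (w : ℝ × ℝ) (c : ℝ) (k : ℕ) (hk : 1 ≤ k) :
    dn w k (fun _ => c) = fun _ => 0 := by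
  induction k, hk using Nat.le_induction with
  | base => ext z; simp [dn, dl]
  | succ k _ ih => simp only [dn, ih]; ext z; simp [dl]

open Finset in
lemma dn_mul (w : ℝ × ℝ) (f g : ℝ × ℝ → ℝ) (n : ℕ) (z : ℝ × ℝ) :
    dn w n (fun z => f z * g z) z = ∑ ij ∈ antidiagonal n,
      (n.choose ij.1 : ℝ) * (dn w ij.1 f (z + (ij.2 : ℝ) • w) * dn w ij.2 g z) := by
  induction n generalizing z with
  | zero => simp [dn]
  | succ n ih =>
    have h := Finset.sum_antidiagonal_choose_succ_mul
      (fun i j => dn w i f (z + (j : ℝ) • w) * dn w j g z) n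
    rw [h]
    change dn w n (fun z => f z * g z) (z + w) - dn w n (fun z => f z * g z) z = _
    rw [ih, ih, ← Finset.sum_sub_distrib, ← Finset.sum_add_distrib]
    refine Finset.sum_congr rfl fun ij hij => ?_
    have e : n.choose ij.2 = n.choose ij.1 := by
      have := mem_antidiagonal.1 hij
      exact (Nat.choose_symm_of_eq_add this.symm).symm
    have e2 : z + w + (ij.2 : ℝ) • w = z + ((ij.2 + 1 : ℕ) : ℝ) • w := by
      push_cast; rw [add_smul, one_smul]; abel
    have e3 : z + (ij.2 : ℝ) • w + w = z + ((ij.2 + 1 : ℕ) : ℝ) • w := by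
      push_cast; rw [add_smul, one_smul]; abel
    rw [e, e2]
    simp only [dn, dl]
    rw [e3]
    ring

/-! #### Elementary inequalities -/

lemma phi_sub_aux {r a b : ℝ} (hr : 0 ≤ r) (hb : 0 ≤ b) (hab : b ≤ a) :
    a * a ^ r - b * b ^ r ≤ (r + 1) * (a - b) * a ^ r := by
  rcases hb.eq_or_lt with h | h
  · subst h
    have : 0 ≤ a * a ^ r := mul_nonneg hab (Real.rpow_nonneg hab r)
    nlinarith [mul_nonneg hr this]
  have ha : 0 < a := h.trans_le hab
  have hB := one_add_mul_self_le_rpow_one_add (s := b / a - 1) (by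
    have : 0 ≤ b / a := by positivity
    linarith) (p := r + 1) (by linarith)
  have e1 : (1 + (b / a - 1)) = b / a := by ring
  rw [e1, Real.div_rpow hb ha.le, Real.rpow_add_one ha.ne', Real.rpow_add_one h.ne'] at hB
  have hpos : 0 < a ^ r * a := by positivity
  rw [le_div_iff₀ hpos] at hB
  have e2 : (1 + (r + 1) * (b / a - 1)) * (a ^ r * a) = a * a ^ r + (r + 1) * (b - a) * a ^ r := by
    field_simp
  rw [e2] at hB
  nlinarith

lemma phi_sub' {r a b : ℝ} (hr : 0 ≤ r) (hab : |b| ≤ |a|) :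
    |a * |a| ^ r - b * |b| ^ r| ≤ (r + 1) * |a - b| * (|a| ^ r + |b| ^ r) := by
  have hA : 0 ≤ |a| ^ r := Real.rpow_nonneg (abs_nonneg _) _
  have hB : 0 ≤ |b| ^ r := Real.rpow_nonneg (abs_nonneg _) _
  have key := phi_sub_aux hr (abs_nonneg b) hab
  have hmono : |b| * |b| ^ r ≤ |a| * |a| ^ r :=
    mul_le_mul hab (Real.rpow_le_rpow (abs_nonneg _) hab hr) hB (abs_nonneg _)
  have hd : 0 ≤ |a - b| := abs_nonneg _
  have hx : 0 ≤ (r + 1) * |a - b| * |b| ^ r := by positivity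
  by_cases hs : 0 ≤ a * b
  · have h1 : |a - b| = |a| - |b| := by
      rcases le_total 0 a with ha | ha <;> rcases le_total 0 b with hb | hb
      · rw [abs_of_nonneg ha, abs_of_nonneg hb] at *
        rw [abs_of_nonneg]; linarith
      · have : b = 0 ∨ a = 0 := by
          by_contra hne; push Not at hne
          have := mul_neg_of_pos_of_neg (lt_of_le_of_ne ha hne.2.symm) (lt_of_le_of_ne hb hne.1)
          linarith
        rcases this with h | h
        · subst h; simp
        · subst h; simp at hab; subst hab; simp
      · have : b = 0 ∨ a = 0 := by
          by_contra hne; push Not at hne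
          have := mul_neg_of_neg_of_pos (lt_of_le_of_ne ha hne.2) (lt_of_le_of_ne hb hne.1.symm)
          linarith
        rcases this with h | h
        · subst h; simp
        · subst h; simp at hab; subst hab; simp
      · rw [abs_of_nonpos ha, abs_of_nonpos hb] at *
        rw [abs_of_nonpos] <;> linarith
    have h2 : |a * |a| ^ r - b * |b| ^ r| = |a| * |a| ^ r - |b| * |b| ^ r := by
      rcases le_total 0 a with ha | ha <;> rcases le_total 0 b with hb | hb
      · rw [abs_of_nonneg ha, abs_of_nonneg hb] at *
        rw [abs_of_nonneg]; linarith
      · rw [abs_of_nonneg ha, abs_of_nonpos hb] at *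
        have e : |a - b| = a - -b := h1
        rw [abs_of_nonneg (by linarith)] at e
        have : b = 0 := by linarith
        subst this
        simp only [zero_mul, neg_zero, sub_zero]
        exact abs_of_nonneg (mul_nonneg ha hA)
      · rw [abs_of_nonpos ha, abs_of_nonneg hb] at *
        have e : |a - b| = -a - b := h1
        rw [abs_of_nonpos (by linarith)] at e
        have : b = 0 := by linarith
        subst this
        simp only [zero_mul, sub_zero]
        rw [abs_of_nonpos (mul_nonpos_of_nonpos_of_nonneg ha hA)]
        ring
      · rw [abs_of_nonpos ha, abs_of_nonpos hb] at *
        rw [abs_of_nonpos] <;> linarith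
    rw [h2]
    rw [← h1] at key
    nlinarith
  · have h1 : |a - b| = |a| + |b| := by
      rcases le_total 0 a with ha | ha <;> rcases le_total 0 b with hb | hb
      · exact absurd (mul_nonneg ha hb) hs
      · rw [abs_of_nonneg ha, abs_of_nonpos hb, abs_of_nonneg (by linarith)]; ring
      · rw [abs_of_nonpos ha, abs_of_nonneg hb, abs_of_nonpos (by linarith)]; ring
      · exact absurd (mul_nonneg_of_nonpos_of_nonpos ha hb) hs
    have h2 : |a * |a| ^ r - b * |b| ^ r| ≤ |a| * |a| ^ r + |b| * |b| ^ r := by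
      refine (abs_sub _ _).trans ?_
      rw [abs_mul, abs_mul, abs_of_nonneg hA, abs_of_nonneg hB]
    refine h2.trans ?_
    rw [h1]
    have ha := abs_nonneg a
    have hb := abs_nonneg b
    have t1 := mul_nonneg ha hA
    have t2 := mul_nonneg ha hB
    have t3 := mul_nonneg hb hA
    have t4 := mul_nonneg hb hB
    nlinarith [mul_nonneg hr t1, mul_nonneg hr t2, mul_nonneg hr t3, mul_nonneg hr t4]

lemma phi_sub {r : ℝ} (hr : 0 ≤ r) (a b : ℝ) :
    |a * |a| ^ r - b * |b| ^ r| ≤ (r + 1) * |a - b| * (|a| ^ r + |b| ^ r) := by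
  rcases le_total |b| |a| with h | h
  · exact phi_sub' hr h
  · rw [abs_sub_comm, abs_sub_comm a b, add_comm (|a| ^ r)]
    exact phi_sub' hr h

lemma young3 {w1 w2 w3 K η : ℝ} (h1 : 0 < w1) (h2 : 0 ≤ w2) (h3 : 0 ≤ w3) (hs : w1 + w2 + w3 = 1)
    (hK : 0 ≤ K) (hη : 0 < η) :
    ∃ C, 0 ≤ C ∧ ∀ x y z : ℝ, 0 ≤ x → 0 ≤ y → 0 ≤ z →
      K * (x ^ w1 * y ^ w2 * z ^ w3) ≤ C * x + η * y + η * z := by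
  set C := (K * η ^ (-(w2 + w3))) ^ (1 / w1) with hC
  have hb : 0 ≤ K * η ^ (-(w2 + w3)) := by positivity
  have hC0 : 0 ≤ C := Real.rpow_nonneg hb _
  refine ⟨C, hC0, fun x y z hx hy hz => ?_⟩
  have key := Real.geom_mean_le_arith_mean3_weighted h1.le h2 h3 (mul_nonneg hC0 hx)
    (mul_nonneg hη.le hy) (mul_nonneg hη.le hz) hs
  rw [Real.mul_rpow hC0 hx, Real.mul_rpow hη.le hy, Real.mul_rpow hη.le hz] at key
  have e1 : C ^ w1 = K * η ^ (-(w2 + w3)) := by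
    rw [hC, ← Real.rpow_mul hb, one_div, inv_mul_cancel₀ h1.ne', Real.rpow_one]
  have e2 : η ^ (-(w2 + w3)) * η ^ w2 * η ^ w3 = 1 := by
    rw [← Real.rpow_add hη, ← Real.rpow_add hη]
    simp
  rw [e1] at key
  have e3 : K * η ^ (-(w2 + w3)) * x ^ w1 * (η ^ w2 * y ^ w2) * (η ^ w3 * z ^ w3)
      = K * (x ^ w1 * y ^ w2 * z ^ w3) * (η ^ (-(w2 + w3)) * η ^ w2 * η ^ w3) := by ring
  rw [e3, e2, mul_one] at key
  refine key.trans ?_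
  have b1 : w1 ≤ 1 := by linarith
  have b2 : w2 ≤ 1 := by linarith
  have b3 : w3 ≤ 1 := by linarith
  have c1 := mul_le_of_le_one_left (mul_nonneg hC0 hx) b1
  have c2 := mul_le_of_le_one_left (mul_nonneg hη.le hy) b2
  have c3 := mul_le_of_le_one_left (mul_nonneg hη.le hz) b3
  linarith

lemma young2 {w1 w2 K η : ℝ} (h1 : 0 < w1) (h2 : 0 ≤ w2) (hs : w1 + w2 = 1)
    (hK : 0 ≤ K) (hη : 0 < η) :
    ∃ C, 0 ≤ C ∧ ∀ x y : ℝ, 0 ≤ x → 0 ≤ y → K * (x ^ w1 * y ^ w2) ≤ C * x + η * y := by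
  obtain ⟨C, hC, h⟩ := young3 (w3 := 0) h1 h2 le_rfl (by linarith) hK hη
  refine ⟨C, hC, fun x y hx hy => ?_⟩
  have := h x y 0 hx hy le_rfl
  simpa using this

/-- Summation by parts combined with the mean value inequality. -/
lemma ibp {w : ℝ × ℝ} {F g : ℝ × ℝ → ℝ} (hF : Continuous F) (hFp : Biperiodic F)
    (hg : Continuous g) (hgp : Biperiodic g) {r : ℝ} (hr : 0 ≤ r) :
    TI (fun z => g z * |g z| ^ r * dl w F z) ≤
      TI (fun z => (r + 1) * (|F (z + w)| * |dl w g z| * (|g (z + w)| ^ r + |g z| ^ r))) := by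
  have hc : Continuous (fun z => g z * |g z| ^ r) := hg.mul (hg.abs.rpow_const fun _ => Or.inr hr)
  have hp : Biperiodic (fun z => g z * |g z| ^ r) := per_comp hgp (fun s => s * |s| ^ r)
  have e1 : TI (fun z => (g (z + w) * |g (z + w)| ^ r) * F (z + w)) = TI (fun z => g z * |g z| ^ r * F z) :=
    TI_shift (f := fun z => g z * |g z| ^ r * F z) (hc.mul hF) (per_mul hp hFp) w
  have hcs : Continuous (fun z => g (z + w) * |g (z + w)| ^ r) := hc.comp (continuous_add_const w)
  have hFs : Continuous (fun z => F (z + w)) := hF.comp (continuous_add_const w)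
  have e2 : TI (fun z => g z * |g z| ^ r * dl w F z) =
      TI (fun z => F (z + w) * (g z * |g z| ^ r - g (z + w) * |g (z + w)| ^ r)) := by
    have a1 : TI (fun z => g z * |g z| ^ r * dl w F z) =
        TI (fun z => g z * |g z| ^ r * F (z + w)) - TI (fun z => g z * |g z| ^ r * F z) := by
      rw [← TI_sub (f := fun z => g z * |g z| ^ r * F (z + w)) (g := fun z => g z * |g z| ^ r * F z)
        (hc.mul hFs) (hc.mul hF)]
      congr 1; ext z; simp only [dl]; ring
    rw [a1, ← e1, ← TI_sub (f := fun z => g z * |g z| ^ r * F (z + w))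
      (g := fun z => g (z + w) * |g (z + w)| ^ r * F (z + w)) (hc.mul hFs) (hcs.mul hFs)]
    congr 1; ext z; ring
  rw [e2]
  have hgr : Continuous (fun z => |g z| ^ r) := hg.abs.rpow_const fun _ => Or.inr hr
  have hgrs : Continuous (fun z => |g (z + w)| ^ r) := hgr.comp (continuous_add_const w)
  refine TI_mono (hFs.mul (hc.sub hcs)) ?_ fun z => ?_
  · exact continuous_const.mul ((hFs.abs.mul (dl_cont hg).abs).mul (hgrs.add hgr))
  · refine (le_abs_self _).trans ?_
    rw [abs_mul]
    have := phi_sub hr (g (z + w)) (g z)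
    rw [abs_sub_comm] at this
    have h2 := mul_le_mul_of_nonneg_left this (abs_nonneg (F (z + w)))
    refine h2.trans (le_of_eq ?_)
    simp only [dl]; ring

end GMA

/-! ### Part C: Gagliardo-Nirenberg chain for finite differences -/

namespace GMA

lemma chain_up {ι : Type*} {A : ι → ℕ → ℝ} {H : ι → ℝ} {n : ℕ} (hA : ∀ i k, 0 ≤ A i k)
    (hstep : ∀ k, 2 ≤ k → k < n → ∀ η : ℝ, 0 < η → ∃ C, 0 ≤ C ∧ ∀ i,
      A i k ≤ η * A i (k + 1) + C * A i (k - 1))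
    (hbase : ∀ η : ℝ, 0 < η → ∃ C, 0 ≤ C ∧ ∀ i, A i 1 ≤ η * A i 2 + C * H i)
    (k : ℕ) (hk : 1 ≤ k) : k < n → ∀ η : ℝ, 0 < η → ∃ C, 0 ≤ C ∧ ∀ i,
      A i k ≤ η * A i (k + 1) + C * H i := by
  induction k, hk using Nat.le_induction with
  | base => intro _ η hη; exact hbase η hη
  | succ k hk ih =>
    intro hkn η hη
    obtain ⟨C1, hC1, h1⟩ := hstep (k + 1) (by omega) hkn (η / 2) (by positivity)
    obtain ⟨C2, hC2, h2⟩ := ih (by omega) (1 / (2 * (C1 + 1))) (by positivity)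
    refine ⟨2 * (C1 * C2), by positivity, fun i => ?_⟩
    have a1 := h1 i
    have a2 := mul_le_mul_of_nonneg_left (h2 i) hC1
    rw [Nat.add_sub_cancel] at a1
    have a3 : C1 * (1 / (2 * (C1 + 1)) * A i (k + 1)) ≤ 1 / 2 * A i (k + 1) := by
      rw [← mul_assoc]
      refine mul_le_mul_of_nonneg_right ?_ (hA i _)
      rw [mul_one_div, div_le_div_iff₀ (by positivity) (by norm_num)]
      linarith
    nlinarith

lemma chain {ι : Type*} {A : ι → ℕ → ℝ} {H : ι → ℝ} {n : ℕ} (hA : ∀ i k, 0 ≤ A i k)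
    (hstep : ∀ k, 2 ≤ k → k < n → ∀ η : ℝ, 0 < η → ∃ C, 0 ≤ C ∧ ∀ i,
      A i k ≤ η * A i (k + 1) + C * A i (k - 1))
    (hbase : ∀ η : ℝ, 0 < η → ∃ C, 0 ≤ C ∧ ∀ i, A i 1 ≤ η * A i 2 + C * H i)
    (d : ℕ) : ∀ k, 1 ≤ k → k + 1 + d = n → ∀ η : ℝ, 0 < η → ∃ C, 0 ≤ C ∧ ∀ i,
      A i k ≤ η * A i n + C * H i := by
  induction d with
  | zero =>
    intro k hk hkn η hη
    obtain ⟨C, hC, h⟩ := chain_up hA hstep hbase k hk (by omega) η hη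
    have : k + 1 = n := by omega
    rw [this] at h
    exact ⟨C, hC, h⟩
  | succ d ih =>
    intro k hk hkn η hη
    obtain ⟨C, hC, h⟩ := chain_up hA hstep hbase k hk (by omega) 1 one_pos
    obtain ⟨C', hC', h'⟩ := ih (k + 1) (by omega) (by omega) η hη
    refine ⟨C + C', by positivity, fun i => ?_⟩
    have := h i
    have := h' i
    linarith

/-- The quantities `A_k` in the Gagliardo-Nirenberg chain. -/
noncomputable def GN (n : ℕ) (w : ℝ × ℝ) (f : ℝ × ℝ → ℝ) (k : ℕ) : ℝ :=
  TI (fun z => |dn w k f z| ^ (2 * n / k : ℝ))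

lemma GN_nonneg (n : ℕ) (w : ℝ × ℝ) (f : ℝ × ℝ → ℝ) (k : ℕ) : 0 ≤ GN n w f k :=
  TI_nonneg fun _ => Real.rpow_nonneg (abs_nonneg _) _

lemma cont_rpow {g : ℝ × ℝ → ℝ} (hg : Continuous g) {s : ℝ} (hs : 0 ≤ s) :
    Continuous (fun z => |g z| ^ s) := hg.abs.rpow_const fun _ => Or.inr hs

lemma abs_rpow_split {r x : ℝ} (hr : 0 ≤ r) : |x| ^ (r + 2) = x * |x| ^ r * x := by
  rw [Real.rpow_add_of_nonneg (abs_nonneg _) hr (by norm_num)]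
  rw [show ((2 : ℝ)) = ((2 : ℕ) : ℝ) by norm_num, Real.rpow_natCast, sq_abs]
  ring

lemma gn_step (n k : ℕ) (hk : 2 ≤ k) (hkn : k < n) (η : ℝ) (hη : 0 < η) :
    ∃ C, 0 ≤ C ∧ ∀ (f : ℝ × ℝ → ℝ) (w : ℝ × ℝ), Continuous f → Biperiodic f →
      GN n w f k ≤ η * GN n w f (k + 1) + C * GN n w f (k - 1) := by
  obtain ⟨j, rfl⟩ : ∃ j, k = j + 1 := ⟨k - 1, by omega⟩
  rw [Nat.add_sub_cancel]
  have hj : (0 : ℝ) < j := by exact_mod_cast (by omega : 0 < j)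
  have hjn : (j : ℝ) + 1 < n := by exact_mod_cast hkn
  have hn : (0 : ℝ) < n := by linarith
  set r : ℝ := 2 * n / (j + 1 : ℝ) - 2 with hr
  have hr0 : 0 ≤ r := by
    rw [hr, sub_nonneg, le_div_iff₀ (by positivity)]; linarith
  set η' := min (η / 4) (1 / 4) with hη'
  have hη'0 : 0 < η' := lt_min (by positivity) (by norm_num)
  obtain ⟨C, hC, hY⟩ := young3 (w1 := j / (2 * n)) (w2 := (j + 2) / (2 * n))
    (w3 := (n - (j + 1)) / n) (K := r + 1) (η := η') (by positivity) (by positivity)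
    (by apply div_nonneg <;> linarith) (by field_simp; ring) (by linarith) hη'0
  refine ⟨4 * C, by positivity, fun f w hf hp => ?_⟩
  have hFc := dn_cont (w := w) hf j
  have hFp := dn_per (w := w) hp j
  have hgc := dn_cont (w := w) hf (j + 1)
  have hgp := dn_per (w := w) hp (j + 1)
  have hyc := dn_cont (w := w) hf (j + 1 + 1)
  set F := dn w j f with hF
  set g := dn w (j + 1) f with hg
  set y := dn w (j + 1 + 1) f with hy
  have eg : g = dl w F := rfl
  have ey : y = dl w g := rfl
  have h1 := ibp hFc hFp hgc hgp hr0 (w := w)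
  have ex1 : (0 : ℝ) ≤ 2 * n / j := by positivity
  have ex2 : (0 : ℝ) ≤ 2 * n / (j + 1) := by positivity
  have ex3 : (0 : ℝ) ≤ 2 * n / (j + 2) := by positivity
  have e1 : GN n w f (j + 1) = TI (fun z => g z * |g z| ^ r * dl w F z) := by
    unfold GN
    congr 1; ext z
    rw [← hg, ← eg, ← abs_rpow_split hr0, hr]
    congr 1; push_cast; ring
  have hpt : ∀ a b c : ℝ, (r + 1) * (|a| * |b| * |c| ^ r) ≤
      C * |a| ^ (2 * n / j : ℝ) + η' * |b| ^ (2 * n / (j + 2) : ℝ)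
        + η' * |c| ^ (2 * n / (j + 1) : ℝ) := by
    intro a b c
    have := hY (|a| ^ (2 * n / j : ℝ)) (|b| ^ (2 * n / (j + 2) : ℝ)) (|c| ^ (2 * n / (j + 1) : ℝ))
      (by positivity) (by positivity) (by positivity)
    rw [← Real.rpow_mul (abs_nonneg _), ← Real.rpow_mul (abs_nonneg _),
      ← Real.rpow_mul (abs_nonneg _)] at this
    have i1 : (2 * n / j : ℝ) * (j / (2 * n)) = 1 := by field_simp
    have i2 : (2 * n / (j + 2) : ℝ) * ((j + 2) / (2 * n)) = 1 := by field_simp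
    have i3 : (2 * n / (j + 1) : ℝ) * ((n - (j + 1)) / n) = r := by rw [hr]; field_simp
    rw [i1, i2, i3, Real.rpow_one, Real.rpow_one] at this
    exact this
  have cF := cont_rpow hFc ex1
  have cg := cont_rpow hgc ex2
  have cy := cont_rpow hyc ex3
  have cFs : Continuous (fun z => |F (z + w)| ^ (2 * n / j : ℝ)) :=
    cF.comp (continuous_add_const w)
  have cgs : Continuous (fun z => |g (z + w)| ^ (2 * n / (j + 1) : ℝ)) :=
    cg.comp (continuous_add_const w)
  have h2 : TI (fun z => (r + 1) * (|F (z + w)| * |dl w g z| * (|g (z + w)| ^ r + |g z| ^ r))) ≤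
      TI (fun z => ((2 * C) * |F (z + w)| ^ (2 * n / j : ℝ) + (2 * η') * |y z| ^ (2 * n / (j + 2) : ℝ))
        + (η' * |g (z + w)| ^ (2 * n / (j + 1) : ℝ) + η' * |g z| ^ (2 * n / (j + 1) : ℝ))) := by
    refine TI_mono ?_ (by fun_prop) fun z => ?_
    · have := cont_rpow hgc hr0
      have t1 : Continuous (fun z => |g (z + w)| ^ r) := this.comp (continuous_add_const w)
      have t2 : Continuous (fun z => F (z + w)) := hFc.comp (continuous_add_const w)
      have t3 := dl_cont (w := w) hgc
      fun_prop
    · have a1 := hpt (F (z + w)) (dl w g z) (g (z + w))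
      have a2 := hpt (F (z + w)) (dl w g z) (g z)
      rw [ey]
      linarith
  rw [← e1] at h1
  replace h2 := h1.trans h2
  rw [TI_add (by fun_prop) (by fun_prop), TI_add (by fun_prop) (by fun_prop),
    TI_add (by fun_prop) (by fun_prop), TI_mul, TI_mul, TI_mul, TI_mul,
    TI_shift cF (per_comp hFp (fun s => |s| ^ (2 * n / j : ℝ))) w,
    TI_shift cg (per_comp hgp (fun s => |s| ^ (2 * n / (j + 1) : ℝ))) w] at h2
  have q1 : TI (fun z => |F z| ^ (2 * n / j : ℝ)) = GN n w f j := rfl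
  have q2 : TI (fun z => |g z| ^ (2 * n / (j + 1) : ℝ)) = GN n w f (j + 1) := by
    unfold GN; push_cast; rfl
  have q3 : TI (fun z => |y z| ^ (2 * n / (j + 2) : ℝ)) = GN n w f (j + 1 + 1) := by
    unfold GN; push_cast; rw [show (j : ℝ) + 1 + 1 = j + 2 by ring]
  rw [q1, q2, q3] at h2
  have p1 := GN_nonneg n w f (j + 1)
  have p2 := GN_nonneg n w f (j + 1 + 1)
  have k1 : η' ≤ η / 4 := min_le_left _ _
  have k2 : η' ≤ 1 / 4 := min_le_right _ _
  have k3 := mul_le_mul_of_nonneg_right k1 p2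
  have k4 := mul_le_mul_of_nonneg_right k2 p1
  linarith

/-- `σ` is a modulus of continuity for `f`. -/
def HasMod (σ : ℝ → ℝ) (f : ℝ × ℝ → ℝ) : Prop :=
  ∀ ε : ℝ, 0 < ε → ∀ z v : ℝ × ℝ, ‖v‖ ≤ σ ε → |f (z + v) - f z| ≤ ε

lemma smooth_split {M ε s : ℝ} (hM : 0 ≤ M) (hs : 0 < s) {f : ℝ × ℝ → ℝ} {w : ℝ × ℝ}
    (hf : Continuous f) (hp : Biperiodic f) (hb : ∀ z, |f z| ≤ M)
    (hm : ∀ z v : ℝ × ℝ, ‖v‖ ≤ s → |f (z + v) - f z| ≤ ε) (hw : 0 < ‖w‖) :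
    ∃ fs : ℝ × ℝ → ℝ, Continuous fs ∧ Biperiodic fs ∧ (∀ z, |f z - fs z| ≤ ε) ∧
      ∀ z, |dl w fs z| ≤ 2 * M / s * ‖w‖ := by
  set N := ⌈s / ‖w‖⌉₊ with hN
  have hN0 : 0 < N := Nat.ceil_pos.2 (by positivity)
  have hNr : (0 : ℝ) < N := by exact_mod_cast hN0
  have hN1 : s / ‖w‖ ≤ N := Nat.le_ceil _
  have hN2 : (N : ℝ) < s / ‖w‖ + 1 := Nat.ceil_lt_add_one (by positivity)
  refine ⟨fun z => (1 / N : ℝ) * ∑ j ∈ Finset.range N, f (z + (j : ℝ) • w), by fun_prop, ?_, ?_, ?_⟩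
  · refine per_of fun z => ?_
    constructor
    · congr 1
      refine Finset.sum_congr rfl fun j _ => ?_
      rw [add_right_comm]
      exact (per_zadd hp _).1
    · congr 1
      refine Finset.sum_congr rfl fun j _ => ?_
      rw [add_right_comm]
      exact (per_zadd hp _).2
  · intro z
    have e : f z - (1 / N : ℝ) * ∑ j ∈ Finset.range N, f (z + (j : ℝ) • w) =
        (1 / N : ℝ) * ∑ j ∈ Finset.range N, (f z - f (z + (j : ℝ) • w)) := by
      rw [Finset.sum_sub_distrib, Finset.sum_const, Finset.card_range, nsmul_eq_mul]
      field_simp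
    rw [e, abs_mul, abs_of_nonneg (by positivity), one_div, inv_mul_le_iff₀ hNr]
    refine (Finset.abs_sum_le_sum_abs _ _).trans ?_
    refine (Finset.sum_le_card_nsmul _ _ ε fun j hj => ?_).trans ?_
    · rw [abs_sub_comm]
      refine hm _ _ ?_
      rw [norm_smul, Real.norm_of_nonneg (by positivity)]
      have hj' : (j : ℝ) + 1 ≤ N := by exact_mod_cast Finset.mem_range.1 hj
      have : (j : ℝ) ≤ s / ‖w‖ := by linarith
      rwa [le_div_iff₀ hw] at this
    · simp
  · intro z
    have e : dl w (fun z => (1 / N : ℝ) * ∑ j ∈ Finset.range N, f (z + (j : ℝ) • w)) z =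
        (1 / N : ℝ) * (f (z + (N : ℝ) • w) - f z) := by
      simp only [dl]
      rw [← mul_sub, ← Finset.sum_sub_distrib]
      congr 1
      have := Finset.sum_range_sub (fun j : ℕ => f (z + (j : ℝ) • w)) N
      simp only [Nat.cast_zero, zero_smul, add_zero] at this
      rw [← this]
      refine Finset.sum_congr rfl fun j _ => ?_
      push_cast
      rw [add_smul, one_smul, add_assoc, add_comm w]
    rw [e, abs_mul, abs_of_nonneg (by positivity)]
    have b1 : |f (z + (N : ℝ) • w) - f z| ≤ 2 * M := by
      refine (abs_sub _ _).trans ?_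
      have := hb (z + (N : ℝ) • w)
      have := hb z
      linarith
    have b2 : (1 / N : ℝ) ≤ ‖w‖ / s := by
      rw [div_le_div_iff₀ hNr hs]
      rw [div_le_iff₀ hw] at hN1
      linarith
    calc _ ≤ ‖w‖ / s * (2 * M) := mul_le_mul b2 b1 (abs_nonneg _) (by positivity)
      _ = _ := by ring

lemma gn_base (n : ℕ) (hn : 2 ≤ n) (M : ℝ) (hM : 0 ≤ M) (σ : ℝ → ℝ) (hσ : ∀ ε, 0 < ε → 0 < σ ε)
    (η : ℝ) (hη : 0 < η) :
    ∃ C, 0 ≤ C ∧ ∀ (f : ℝ × ℝ → ℝ) (w : ℝ × ℝ), Continuous f → Biperiodic f →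
      (∀ z, |f z| ≤ M) → HasMod σ f → 0 < ‖w‖ →
      GN n w f 1 ≤ η * GN n w f 2 + C * ‖w‖ ^ (2 * n) := by
  have hn' : (2 : ℝ) ≤ n := by exact_mod_cast hn
  set r : ℝ := 2 * n - 2 with hr
  have hr0 : 0 ≤ r := by rw [hr]; linarith
  set ε : ℝ := min (η / (4 * (r + 1))) (1 / (8 * (r + 1))) with hε
  have hε0 : 0 < ε := lt_min (by positivity) (by positivity)
  obtain ⟨C, hC, hY⟩ := young2 (w1 := 1 / (2 * n)) (w2 := (2 * n - 1) / (2 * n))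
    (K := 2 * M / σ ε) (η := 1 / 4) (by positivity) (by apply div_nonneg <;> linarith)
    (by field_simp; ring) (div_nonneg (by linarith) (hσ ε hε0).le) (by norm_num)
  refine ⟨2 * C, by positivity, fun f w hf hp hb hm hw => ?_⟩
  obtain ⟨fs, hfsc, hfsp, hd, hdl⟩ := smooth_split hM (hσ ε hε0) hf hp hb (hm ε hε0) hw
  set F : ℝ × ℝ → ℝ := fun z => f z - fs z with hF
  have hFc : Continuous F := hf.sub hfsc
  have hFp : Biperiodic F := per_sub hp hfsp
  have hgc := dn_cont (w := w) hf 1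
  have hgp := dn_per (w := w) hp 1
  have hyc := dn_cont (w := w) hf 2
  set g := dn w 1 f with hg
  set y := dn w 2 f with hy
  have ey : y = dl w g := rfl
  have eg : g = dl w f := rfl
  have h1 := ibp hFc hFp hgc hgp hr0 (w := w)
  have cgr := cont_rpow hgc hr0
  have cgrs : Continuous (fun z => |g (z + w)| ^ r) := cgr.comp (continuous_add_const w)
  have cdF := dl_cont (w := w) hFc
  have cdfs := dl_cont (w := w) hfsc
  have cF : Continuous (fun z => F (z + w)) := hFc.comp (continuous_add_const w)
  have cg := cont_rpow hgc (show (0 : ℝ) ≤ 2 * n by positivity)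
  have cgs : Continuous (fun z => |g (z + w)| ^ (2 * n : ℝ)) := cg.comp (continuous_add_const w)
  have cy := cont_rpow hyc (show (0 : ℝ) ≤ n by positivity)
  have e1 : GN n w f 1 = TI (fun z => g z * |g z| ^ r * dl w F z)
      + TI (fun z => g z * |g z| ^ r * dl w fs z) := by
    rw [← TI_add (by fun_prop) (by fun_prop)]
    unfold GN
    congr 1; ext z
    rw [← hg, show (2 * n / (1 : ℕ) : ℝ) = r + 2 by rw [hr]; push_cast; ring, abs_rpow_split hr0]
    have : g z = dl w F z + dl w fs z := by rw [eg, hF]; simp only [dl]; ring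
    rw [← mul_add, ← this]
  have hpt1 : ∀ b c : ℝ, |b| * |c| ^ r ≤ |b| ^ (n : ℝ) + |c| ^ (2 * n : ℝ) := by
    intro b c
    have := Real.geom_mean_le_arith_mean2_weighted (w₁ := 1 / n) (w₂ := 1 - 1 / n)
      (p₁ := |b| ^ (n : ℝ)) (p₂ := |c| ^ (2 * n : ℝ)) (by positivity)
      (by rw [sub_nonneg, div_le_one (by positivity)]; linarith) (by positivity) (by positivity)
      (by ring)
    rw [← Real.rpow_mul (abs_nonneg _), ← Real.rpow_mul (abs_nonneg _),
      mul_one_div_cancel (by positivity), Real.rpow_one,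
      show (2 * n : ℝ) * (1 - 1 / n) = r by rw [hr]; field_simp] at this
    refine this.trans ?_
    have i0 : (1 / n : ℝ) ≤ 1 := by rw [div_le_one (by positivity)]; linarith
    have i1 : (1 - 1 / n : ℝ) ≤ 1 := by
      have : (0 : ℝ) ≤ 1 / n := by positivity
      linarith
    exact add_le_add (mul_le_of_le_one_left (by positivity) i0)
      (mul_le_of_le_one_left (by positivity) i1)
  have h2 : TI (fun z => (r + 1) * (|F (z + w)| * |dl w g z| * (|g (z + w)| ^ r + |g z| ^ r))) ≤
      TI (fun z => ((r + 1) * ε) * ((2 * |y z| ^ (n : ℝ)) + (|g (z + w)| ^ (2 * n : ℝ) + |g z| ^ (2 * n : ℝ)))) := by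
    have := dl_cont (w := w) hgc
    refine TI_mono (by fun_prop) (by fun_prop) fun z => ?_
    have a1 := hpt1 (dl w g z) (g (z + w))
    have a2 := hpt1 (dl w g z) (g z)
    rw [mul_assoc (r + 1) ε]
    refine mul_le_mul_of_nonneg_left ?_ (by linarith)
    rw [mul_assoc |F (z + w)|]
    refine mul_le_mul (hd _) ?_ (by positivity) hε0.le
    rw [ey]; linarith
  have e6 : TI (fun z => g z * |g z| ^ r * dl w F z) =
    GN n w f 1 - TI (fun z => g z * |g z| ^ r * dl w fs z) := by rw [e1]; ring
  generalize TI (fun z => g z * |g z| ^ r * dl w F z) = T1 at *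
  replace h2 := h1.trans h2
  rw [TI_mul, TI_add (by fun_prop) (by fun_prop), TI_add (by fun_prop) (by fun_prop), TI_mul,
    TI_shift cg (per_comp hgp (fun s => |s| ^ (2 * n : ℝ))) w] at h2
  have h3 : TI (fun z => g z * |g z| ^ r * dl w fs z) ≤
      TI (fun z => C * ‖w‖ ^ (2 * n) + 1 / 4 * |g z| ^ (2 * n : ℝ)) := by
    refine TI_mono (by fun_prop) (by fun_prop) fun z => ?_
    refine (le_abs_self _).trans ?_
    rw [abs_mul, abs_mul, abs_of_nonneg (by positivity : 0 ≤ |g z| ^ r)]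
    have a1 : |g z| * |g z| ^ r = |g z| ^ (2 * n - 1 : ℝ) := by
      rw [mul_comm, ← Real.rpow_add_one' (abs_nonneg _) (by linarith), hr]; congr 1; ring
    rw [a1]
    have := hY (‖w‖ ^ (2 * n : ℝ)) (|g z| ^ (2 * n : ℝ)) (by positivity) (by positivity)
    rw [← Real.rpow_mul (norm_nonneg _), ← Real.rpow_mul (abs_nonneg _),
      mul_one_div_cancel (by positivity), Real.rpow_one,
      mul_div_cancel₀ _ (by positivity : (2 * n : ℝ) ≠ 0)] at this
    have e5 : ‖w‖ ^ (2 * n : ℝ) = ‖w‖ ^ (2 * n) := by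
      rw [← Real.rpow_natCast]; push_cast; rfl
    rw [e5] at this
    refine le_trans ?_ this
    calc _ ≤ |g z| ^ (2 * n - 1 : ℝ) * (2 * M / σ ε * ‖w‖) :=
          mul_le_mul_of_nonneg_left (hdl z) (by positivity)
      _ = _ := by ring
  rw [TI_add (by fun_prop) (by fun_prop), TI_const, TI_mul] at h3
  have q1 : TI (fun z => |g z| ^ (2 * n : ℝ)) = GN n w f 1 := by
    unfold GN; push_cast; rw [div_one]
  have q2 : TI (fun z => |y z| ^ (n : ℝ)) = GN n w f 2 := by
    unfold GN; push_cast; rw [mul_div_cancel_left₀ _ (by norm_num : (2 : ℝ) ≠ 0)]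
  rw [q1] at h3
  rw [q1, q2] at h2
  have p1 := GN_nonneg n w f 1
  have p2 := GN_nonneg n w f 2
  have k1 : (r + 1) * ε ≤ η / 4 := by
    have : ε ≤ η / (4 * (r + 1)) := min_le_left _ _
    calc _ ≤ (r + 1) * (η / (4 * (r + 1))) := mul_le_mul_of_nonneg_left this (by linarith)
      _ = η / 4 := by field_simp
  have k2 : (r + 1) * ε ≤ 1 / 8 := by
    have : ε ≤ 1 / (8 * (r + 1)) := min_le_right _ _
    calc _ ≤ (r + 1) * (1 / (8 * (r + 1))) := mul_le_mul_of_nonneg_left this (by linarith)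
      _ = 1 / 8 := by field_simp
  have k3 := mul_le_mul_of_nonneg_right k1 p2
  have k4 := mul_le_mul_of_nonneg_right k2 p1
  linarith

/-- The Gagliardo-Nirenberg chain. -/
lemma gn (n : ℕ) (M : ℝ) (hM : 0 ≤ M) (σ : ℝ → ℝ) (hσ : ∀ ε, 0 < ε → 0 < σ ε)
    (η : ℝ) (hη : 0 < η) :
    ∃ C, 0 ≤ C ∧ ∀ (f : ℝ × ℝ → ℝ) (w : ℝ × ℝ), Continuous f → Biperiodic f →
      (∀ z, |f z| ≤ M) → HasMod σ f → 0 < ‖w‖ → ∀ k, 1 ≤ k → k < n →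
      GN n w f k ≤ η * TI (fun z => (dn w n f z) ^ 2) + C * ‖w‖ ^ (2 * n) := by
  by_cases hn : n < 2
  · exact ⟨0, le_rfl, fun f w _ _ _ _ _ k h1 h2 => by omega⟩
  push Not at hn
  let ι := {q : (ℝ × ℝ → ℝ) × (ℝ × ℝ) // Continuous q.1 ∧ Biperiodic q.1 ∧ (∀ z, |q.1 z| ≤ M) ∧
    HasMod σ q.1 ∧ 0 < ‖q.2‖}
  have key : ∀ k, 1 ≤ k → k < n → ∃ C, 0 ≤ C ∧ ∀ i : ι,
      GN n i.1.2 i.1.1 k ≤ η * GN n i.1.2 i.1.1 n + C * ‖i.1.2‖ ^ (2 * n) := by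
    intro k hk hkn
    refine chain (ι := ι) (A := fun i k => GN n i.1.2 i.1.1 k) (H := fun i => ‖i.1.2‖ ^ (2 * n))
      (n := n) (fun i k => GN_nonneg _ _ _ _) ?_ ?_ (n - 1 - k) k hk (by omega) η hη
    · intro k h1 h2 η hη
      obtain ⟨C, hC, h⟩ := gn_step n k h1 h2 η hη
      exact ⟨C, hC, fun i => h _ _ i.2.1 i.2.2.1⟩
    · intro η hη
      obtain ⟨C, hC, h⟩ := gn_base n hn M hM σ hσ η hη
      exact ⟨C, hC, fun i => h _ _ i.2.1 i.2.2.1 i.2.2.2.1 i.2.2.2.2.1 i.2.2.2.2.2⟩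
  choose! C hC h using key
  refine ⟨∑ k ∈ Finset.Ico 1 n, C k, Finset.sum_nonneg fun k hk => ?_, ?_⟩
  · rw [Finset.mem_Ico] at hk; exact hC k hk.1 hk.2
  intro f w h1 h2 h3 h4 h5 k hk hkn
  have := h k hk hkn ⟨(f, w), h1, h2, h3, h4, h5⟩
  have e : GN n w f n = TI (fun z => (dn w n f z) ^ 2) := by
    unfold GN
    congr 1; ext z
    rw [mul_div_cancel_right₀ _ (by positivity : (n : ℝ) ≠ 0), ← sq_abs]
    exact_mod_cast Real.rpow_natCast |dn w n f z| 2
  simp only [e] at this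
  refine this.trans ?_
  have : C k ≤ ∑ k ∈ Finset.Ico 1 n, C k :=
    Finset.single_le_sum (f := C) (fun j hj => by
      rw [Finset.mem_Ico] at hj; exact hC j hj.1 hj.2) (Finset.mem_Ico.2 ⟨hk, hkn⟩)
  gcongr

end GMA

/-! ### Part D: difference quotients, null Lagrangian, pointwise algebra -/

namespace GMA
open Filter Topology

lemma lip_of_bdd {g : ℝ × ℝ → ℝ} (hg : Differentiable ℝ g) {K1 K2 : ℝ}
    (h1 : ∀ z, |pdx g z| ≤ K1) (h2 : ∀ z, |pdy g z| ≤ K2) (z w : ℝ × ℝ) :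
    |g (z + w) - g z| ≤ (K1 + K2) * ‖w‖ := by
  have hK1 : 0 ≤ K1 := (abs_nonneg _).trans (h1 z)
  have hK2 : 0 ≤ K2 := (abs_nonneg _).trans (h2 z)
  have hb : ∀ x : ℝ × ℝ, ‖fderiv ℝ g x‖ ≤ K1 + K2 := by
    intro x
    refine ContinuousLinearMap.opNorm_le_bound _ (by positivity) fun v => ?_
    rw [fderiv_eq, Real.norm_eq_abs]
    have a1 : |v.1| ≤ ‖v‖ := norm_fst_le v
    have a2 : |v.2| ≤ ‖v‖ := norm_snd_le v
    refine (abs_add_le _ _).trans ?_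
    rw [abs_mul, abs_mul, add_mul, mul_comm K1, mul_comm K2]
    exact add_le_add (mul_le_mul a1 (h1 x) (abs_nonneg _) (norm_nonneg _))
      (mul_le_mul a2 (h2 x) (abs_nonneg _) (norm_nonneg _))
  have := Convex.norm_image_sub_le_of_norm_fderiv_le (𝕜 := ℝ) (f := g) (s := Set.univ)
    (fun x _ => hg x) (fun x _ => hb x) convex_univ (Set.mem_univ z) (Set.mem_univ (z + w))
  simpa using this

lemma lip_per {g : ℝ × ℝ → ℝ} (hg : ContDiff ℝ 1 g) (hp : Biperiodic g) :
    ∃ K, 0 ≤ K ∧ ∀ z w : ℝ × ℝ, |g (z + w) - g z| ≤ K * ‖w‖ := by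
  obtain ⟨K1, -, h1⟩ := per_bdd (cont_pdx hg) (per_pdx hp)
  obtain ⟨K2, -, h2⟩ := per_bdd (cont_pdy hg) (per_pdy hp)
  exact ⟨K1 + K2, add_nonneg ((abs_nonneg _).trans (h1 0)) ((abs_nonneg _).trans (h2 0)),
    lip_of_bdd (hg.differentiable one_ne_zero) h1 h2⟩

lemma dn_bound (n : ℕ) : ∀ f : ℝ × ℝ → ℝ, ContDiff ℝ (⊤ : ℕ∞) f → Biperiodic f →
    ∃ C, 0 ≤ C ∧ ∀ w z : ℝ × ℝ, |dn w n f z| ≤ C * ‖w‖ ^ n := by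
  induction n with
  | zero =>
    intro f hf hp
    obtain ⟨K, -, hK⟩ := per_bdd hf.continuous hp
    exact ⟨K, (abs_nonneg _).trans (hK 0), fun w z => by simpa [dn] using hK z⟩
  | succ n ih =>
    intro f hf hp
    have hf1 : ContDiff ℝ 1 f := hf.of_le (by exact_mod_cast le_top)
    obtain ⟨C1, hC1, h1⟩ := ih (pdx f) (cd_pdx hf (by simp)) (per_pdx hp)
    obtain ⟨C2, hC2, h2⟩ := ih (pdy f) (cd_pdy hf (by simp)) (per_pdy hp)
    refine ⟨C1 + C2, by positivity, fun w z => ?_⟩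
    have := lip_of_bdd ((dn_cd (w := w) hf1 n).differentiable one_ne_zero)
      (K1 := C1 * ‖w‖ ^ n) (K2 := C2 * ‖w‖ ^ n)
      (fun z => by rw [dn_pdx hf1]; exact h1 w z) (fun z => by rw [dn_pdy hf1]; exact h2 w z) z w
    calc _ ≤ _ := this
      _ = _ := by ring

/-- Difference quotient. -/
noncomputable def dq (g : ℝ × ℝ → ℝ) (w : ℝ × ℝ) (s : ℝ) (z : ℝ × ℝ) : ℝ :=
  s⁻¹ * (g (z + s • w) - g z)

lemma dq_cont {g : ℝ × ℝ → ℝ} (hg : Continuous g) (w : ℝ × ℝ) (s : ℝ) : Continuous (dq g w s) := by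
  unfold dq; fun_prop

lemma dq_tendsto {g : ℝ × ℝ → ℝ} (hg : Differentiable ℝ g) (w z : ℝ × ℝ) :
    Tendsto (fun s => dq g w s z) (𝓝[≠] 0) (𝓝 (fderiv ℝ g z w)) := by
  have h : HasLineDerivAt ℝ g (fderiv ℝ g z w) z w := (hg z).hasFDerivAt.hasLineDerivAt w
  have := hasDerivAt_iff_tendsto_slope_zero.1 h
  simpa [dq] using this

lemma dq_bdd {g : ℝ × ℝ → ℝ} (hg : ContDiff ℝ 1 g) (hp : Biperiodic g) (w : ℝ × ℝ) :
    ∃ K, 0 ≤ K ∧ ∀ s z, |dq g w s z| ≤ K := by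
  obtain ⟨K, hK, h⟩ := lip_per hg hp
  refine ⟨K * ‖w‖, by positivity, fun s z => ?_⟩
  unfold dq
  rcases eq_or_ne s 0 with hs | hs
  · subst hs; simp; positivity
  rw [abs_mul, abs_inv, inv_mul_le_iff₀ (abs_pos.2 hs)]
  refine (h z (s • w)).trans (le_of_eq ?_)
  rw [norm_smul, Real.norm_eq_abs]; ring

lemma TI_tendsto {F : ℝ → ℝ × ℝ → ℝ} {f : ℝ × ℝ → ℝ} {K : ℝ} (hF : ∀ s, Continuous (F s))
    (hb : ∀ s z, |F s z| ≤ K) (h : ∀ z, Tendsto (fun s => F s z) (𝓝[≠] 0) (𝓝 (f z))) :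
    Tendsto (fun s => TI (F s)) (𝓝[≠] 0) (𝓝 (TI f)) := by
  unfold TI
  refine MeasureTheory.tendsto_integral_filter_of_dominated_convergence (fun _ => K) ?_ ?_ ?_ ?_
  · exact Eventually.of_forall fun s => (hF s).aestronglyMeasurable
  · exact Eventually.of_forall fun s => Eventually.of_forall fun z => hb s z
  · exact integrable continuous_const
  · exact Eventually.of_forall h

/-- `∫ A_x B_y = ∫ A_y B_x`. -/
lemma TI_jac {A B : ℝ × ℝ → ℝ} (hA : ContDiff ℝ 1 A) (hAp : Biperiodic A)
    (hB : ContDiff ℝ 1 B) (hBp : Biperiodic B) :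
    TI (fun z => pdx A z * pdy B z) = TI (fun z => pdy A z * pdx B z) := by
  obtain ⟨K1, hK1, b1⟩ := dq_bdd hA hAp (0, 1)
  obtain ⟨K2, hK2, b2⟩ := dq_bdd hB hBp (0, 1)
  obtain ⟨K3, -, b3⟩ := per_bdd (cont_pdx hA) (per_pdx hAp)
  obtain ⟨K4, -, b4⟩ := per_bdd (cont_pdx hB) (per_pdx hBp)
  have hAd := hA.differentiable one_ne_zero
  have hBd := hB.differentiable one_ne_zero
  have cA := cont_pdx hA
  have cB := cont_pdx hB
  have t1 : Tendsto (fun s => TI (fun z => pdx A z * dq B (0, 1) s z)) (𝓝[≠] 0)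
      (𝓝 (TI (fun z => pdx A z * pdy B z))) := by
    refine TI_tendsto (K := K3 * K2) (fun s => cA.mul (dq_cont hB.continuous _ _)) ?_ ?_
    · intro s z
      rw [abs_mul]
      exact mul_le_mul (b3 z) (b2 s z) (abs_nonneg _) ((abs_nonneg _).trans (b3 z))
    · exact fun z => (dq_tendsto hBd _ z).const_mul _
  have t2 : Tendsto (fun s => TI (fun z => dq A (0, 1) s z * pdx B z)) (𝓝[≠] 0)
      (𝓝 (TI (fun z => pdy A z * pdx B z))) := by
    refine TI_tendsto (K := K1 * K4) (fun s => (dq_cont hA.continuous _ _).mul cB) ?_ ?_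
    · intro s z
      rw [abs_mul]
      exact mul_le_mul (b1 s z) (b4 z) (abs_nonneg _) hK1
    · exact fun z => (dq_tendsto hAd _ z).mul_const _
  have hneg : Tendsto (fun s : ℝ => -s) (𝓝[≠] 0) (𝓝[≠] 0) := by
    refine tendsto_nhdsWithin_iff.2 ⟨?_, ?_⟩
    · have : Tendsto (fun s : ℝ => -s) (𝓝 0) (𝓝 (-0)) := (continuous_neg).tendsto 0
      rw [neg_zero] at this
      exact this.mono_left nhdsWithin_le_nhds
    · filter_upwards [self_mem_nhdsWithin] with s hs
      simpa using hs
  have t3 := t2.comp hneg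
  refine tendsto_nhds_unique t1 (t3.congr fun s => ?_)
  simp only [Function.comp]
  set e : ℝ × ℝ := s • (0, 1) with he
  have hBs : ContDiff ℝ 1 (fun z => B (z + e)) := hB.comp (contDiff_id.add contDiff_const)
  have hBps : Biperiodic (fun z => B (z + e)) := per_shift hBp e
  -- integrate by parts
  have ip : ∀ f : ℝ × ℝ → ℝ, ContDiff ℝ 1 f → Biperiodic f →
      TI (fun z => pdx A z * f z) = - TI (fun z => A z * pdx f z) := by
    intro f hf hfp
    have h := TI_pdx (hA.mul hf) (per_mul hAp hfp)
    have e1 : pdx (fun z => A z * f z) = fun z => pdx A z * f z + A z * pdx f z := by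
      rw [pdx_mul hAd (hf.differentiable one_ne_zero)]; ext z; ring
    have hcA := hA.continuous
    have hcf := hf.continuous
    have hcfx := cont_pdx hf
    change TI (pdx (fun z => A z * f z)) = 0 at h
    rw [e1, TI_add (by fun_prop) (by fun_prop)] at h
    linarith
  have cAc := hA.continuous
  have cBc := hB.continuous
  have a1 : TI (fun z => pdx A z * dq B (0, 1) s z) =
      s⁻¹ * (TI (fun z => pdx A z * B (z + e)) - TI (fun z => pdx A z * B z)) := by
    rw [← TI_sub (by fun_prop) (by fun_prop), ← TI_mul]
    congr 1; ext z; simp only [dq]; ring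
  have a2 : TI (fun z => dq A (0, 1) (-s) z * pdx B z) =
      s⁻¹ * (TI (fun z => A z * pdx B z) - TI (fun z => A (z + -e) * pdx B z)) := by
    rw [← TI_sub (by fun_prop) (by fun_prop), ← TI_mul]
    congr 1; ext z; simp only [dq, neg_smul, inv_neg]; ring
  rw [a1, a2, ip _ hB hBp, ip _ hBs hBps]
  have a3 : TI (fun z => A (z + -e) * pdx B z) = TI (fun z => A z * pdx (fun z => B (z + e)) z) := by
    rw [← TI_shift (f := fun z => A (z + -e) * pdx B z) (by fun_prop)
      (per_mul (per_shift hAp _) (per_pdx hBp)) e]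
    congr 1; ext z
    rw [pdx_shift, add_assoc, add_neg_cancel, add_zero]
  rw [a3]; ring

/-- The Hessian determinant has zero integral. -/
lemma TI_det {v : ℝ × ℝ → ℝ} (hv : ContDiff ℝ 2 v) (hp : Biperiodic v) :
    TI (fun z => pdx (pdx v) z * pdy (pdy v) z - pdy (pdx v) z ^ 2) = 0 := by
  have h1 : ContDiff ℝ 1 (pdx v) := cd_pdx hv (by norm_num)
  have h2 : ContDiff ℝ 1 (pdy v) := cd_pdy hv (by norm_num)
  have := TI_jac h1 (per_pdx hp) h2 (per_pdy hp)
  rw [pd_comm hv] at this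
  have c1 := cont_pdx h1
  have c2 := cont_pdy h1
  have c3 := cont_pdy h2
  rw [TI_sub (by fun_prop) (by fun_prop), this, sub_eq_zero]
  congr 1; ext z; ring

/-- Squares of differences are controlled by the gradient. -/
lemma TI_dl_sq {g : ℝ × ℝ → ℝ} (hg : ContDiff ℝ 1 g) (hp : Biperiodic g) (w : ℝ × ℝ) :
    TI (fun z => (dl w g z) ^ 2) ≤
      2 * ‖w‖ ^ 2 * (TI (fun z => pdx g z ^ 2) + TI (fun z => pdy g z ^ 2)) := by
  obtain ⟨K, hK, hb⟩ := dq_bdd hg hp w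
  have hgd := hg.differentiable one_ne_zero
  have hgc := hg.continuous
  have t1 : Tendsto (fun s => TI (fun z => dq g w s z ^ 2)) (𝓝[≠] 0)
      (𝓝 (TI (fun z => (fderiv ℝ g z w) ^ 2))) := by
    refine TI_tendsto (K := K ^ 2) (fun s => (dq_cont hgc w s).pow 2) ?_ ?_
    · intro s z
      rw [abs_pow]
      exact pow_le_pow_left₀ (abs_nonneg _) (hb s z) 2
    · exact fun z => (dq_tendsto hgd w z).pow 2
  have t0 : Tendsto (fun N : ℕ => 1 / ((N : ℝ) + 1)) atTop (𝓝[≠] 0) := by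
    refine tendsto_nhdsWithin_iff.2 ⟨tendsto_one_div_add_atTop_nhds_zero_nat, ?_⟩
    refine Eventually.of_forall fun N => ?_
    have : (0 : ℝ) < 1 / ((N : ℝ) + 1) := by positivity
    exact this.ne'
  have t2 := t1.comp t0
  have h1 : TI (fun z => (dl w g z) ^ 2) ≤ TI (fun z => (fderiv ℝ g z w) ^ 2) := by
    refine ge_of_tendsto t2 (Eventually.of_forall fun N => ?_)
    simp only [Function.comp]
    set s : ℝ := 1 / ((N : ℝ) + 1) with hs
    have hs0 : 0 < s := by positivity
    have hsN : ((N : ℝ) + 1) * s = 1 := by rw [hs]; field_simp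
    have hsi : s⁻¹ = N + 1 := by rw [hs]; simp
    have e : ∀ z, dl w g z = s * ∑ j ∈ Finset.range (N + 1), dq g w s (z + (j : ℝ) • (s • w)) := by
      intro z
      have := Finset.sum_range_sub (fun j : ℕ => g (z + (j : ℝ) • (s • w))) (N + 1)
      simp only [Nat.cast_zero, zero_smul, add_zero] at this
      rw [smul_smul] at this
      push_cast at this
      rw [hsN, one_smul] at this
      simp only [dl]
      rw [← this, Finset.mul_sum]
      refine Finset.sum_congr rfl fun j _ => ?_
      simp only [dq]
      rw [← mul_assoc, mul_inv_cancel₀ hs0.ne', one_mul, add_smul, one_smul, add_assoc]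
    have e2 : ∀ z, (dl w g z) ^ 2 ≤
        ∑ j ∈ Finset.range (N + 1), s * dq g w s (z + (j : ℝ) • (s • w)) ^ 2 := by
      intro z
      rw [e z, mul_pow]
      have := sq_sum_le_card_mul_sum_sq (s := Finset.range (N + 1))
        (f := fun j : ℕ => dq g w s (z + (j : ℝ) • (s • w)))
      rw [Finset.card_range] at this
      push_cast at this
      calc _ ≤ s ^ 2 * (((N : ℝ) + 1) * ∑ j ∈ Finset.range (N + 1),
            dq g w s (z + (j : ℝ) • (s • w)) ^ 2) := by gcongr
        _ = (((N : ℝ) + 1) * s) * (s * ∑ j ∈ Finset.range (N + 1),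
            dq g w s (z + (j : ℝ) • (s • w)) ^ 2) := by ring
        _ = _ := by rw [hsN, one_mul, Finset.mul_sum]
    have hdq := dq_cont hgc w s
    have hdqp : Biperiodic (fun z => dq g w s z ^ 2) :=
      per_comp2 (per_shift hp (s • w)) hp (fun a b => (s⁻¹ * (a - b)) ^ 2)
    have hdlc := dl_cont (w := w) hgc
    refine (TI_mono (by fun_prop) (by fun_prop) e2).trans (le_of_eq ?_)
    rw [TI_sum _ _ (fun j _ => by fun_prop)]
    have e3 : ∀ j ∈ Finset.range (N + 1), TI (fun z => s * dq g w s (z + (j : ℝ) • (s • w)) ^ 2)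
        = s * TI (fun z => dq g w s z ^ 2) := by
      intro j _
      rw [TI_mul, TI_shift (f := fun z => dq g w s z ^ 2) (by fun_prop) hdqp]
    rw [Finset.sum_congr rfl e3, Finset.sum_const, Finset.card_range, nsmul_eq_mul]
    push_cast
    rw [← mul_assoc, hsN, one_mul]
  refine h1.trans ?_
  have c1 := cont_pdx hg
  have c2 := cont_pdy hg
  rw [← TI_add (by fun_prop) (by fun_prop), ← TI_mul]
  refine TI_mono ?_ (by fun_prop) fun z => ?_
  · simp only [fderiv_eq]; fun_prop
  · rw [fderiv_eq]
    have a1 : |w.1| ≤ ‖w‖ := norm_fst_le w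
    have a2 : |w.2| ≤ ‖w‖ := norm_snd_le w
    have a3 : w.1 ^ 2 ≤ ‖w‖ ^ 2 := by rw [← sq_abs]; gcongr
    have a4 : w.2 ^ 2 ≤ ‖w‖ ^ 2 := by rw [← sq_abs w.2]; gcongr
    have a5 := mul_le_mul_of_nonneg_right a3 (sq_nonneg (pdx g z))
    have a6 := mul_le_mul_of_nonneg_right a4 (sq_nonneg (pdy g z))
    nlinarith [sq_nonneg (w.1 * pdx g z - w.2 * pdy g z)]

/-! #### Pointwise algebra -/

lemma alg_energy {w11 w12 w22 x11 x12 x22 g0 K : ℝ} (hg : 0 < g0) (hK : 0 < K)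
    (hD : g0 ≤ w11 * w22 - w12 ^ 2) (hT : (w11 + w22) ^ 2 ≤ 4 * K ^ 2) :
    g0 / (8 * K ^ 2) * (x11 ^ 2 + 2 * x12 ^ 2 + x22 ^ 2) ≤ -(x11 * x22 - x12 ^ 2) +
      1 / g0 * (x11 * w22 + x22 * w11 - 2 * x12 * w12) ^ 2 := by
  set D := w11 * w22 - w12 ^ 2 with hDd
  set T := w11 + w22 with hTd
  set b := x11 * w22 + x22 * w11 - 2 * x12 * w12 with hb
  set N := x11 ^ 2 + 2 * x12 ^ 2 + x22 ^ 2 with hN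
  have hN0 : 0 ≤ N := by positivity
  have hD0 : 0 < D := hg.trans_le hD
  have hT2 : 4 * D ≤ T ^ 2 := by rw [hDd, hTd]; nlinarith [sq_nonneg (w11 - w22), sq_nonneg w12]
  have hT0 : 0 < T ^ 2 := by linarith
  have key : D / 2 * N - T ^ 2 * (b ^ 2 / D) ≤ T ^ 2 * (-(x11 * x22 - x12 ^ 2)) := by
    have i1 : T ^ 2 * (-(x11 * x22 - x12 ^ 2)) = D * N
        + (w22 * x11 - w12 * x12) ^ 2 + (w11 * x12 - w12 * x11) ^ 2
        + (w11 * x22 - w12 * x12) ^ 2 + (w22 * x12 - w12 * x22) ^ 2 - b * T * (x11 + x22) := by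
      rw [hDd, hTd, hN, hb]; ring
    have i2 : b * T * (x11 + x22) ≤ D / 2 * (x11 ^ 2 + x22 ^ 2) + T ^ 2 * (b ^ 2 / D) := by
      have : T ^ 2 * (b ^ 2 / D) = (T * b) ^ 2 / D := by field_simp
      rw [this]
      have h3 : ∀ x : ℝ, b * T * x ≤ D / 2 * x ^ 2 + (T * b) ^ 2 / D / 2 := by
        intro x
        have : 0 ≤ (D * x - T * b) ^ 2 / D / 2 := by positivity
        have e : (D * x - T * b) ^ 2 / D / 2 = D / 2 * x ^ 2 + (T * b) ^ 2 / D / 2 - b * T * x := by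
          field_simp; ring
        linarith
      have := h3 x11
      have := h3 x22
      linarith
    have : D / 2 * (x11 ^ 2 + x22 ^ 2) ≤ D / 2 * N := by
      apply mul_le_mul_of_nonneg_left _ (by positivity)
      rw [hN]; nlinarith [sq_nonneg x12]
    rw [i1]
    nlinarith [sq_nonneg (w22 * x11 - w12 * x12), sq_nonneg (w11 * x12 - w12 * x11),
      sq_nonneg (w11 * x22 - w12 * x12), sq_nonneg (w22 * x12 - w12 * x22)]
  have k1 : b ^ 2 / D ≤ 1 / g0 * b ^ 2 := by
    rw [div_eq_mul_one_div, mul_comm]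
    exact mul_le_mul_of_nonneg_right (one_div_le_one_div_of_le hg hD) (sq_nonneg _)
  have k2 : g0 / (8 * K ^ 2) * N * T ^ 2 ≤ D / 2 * N := by
    have : g0 / (8 * K ^ 2) * T ^ 2 ≤ D / 2 := by
      rw [div_mul_eq_mul_div, div_le_iff₀ (by positivity)]
      nlinarith
    nlinarith
  have k3 := mul_le_mul_of_nonneg_left k1 hT0.le
  have k4 : T ^ 2 * (g0 / (8 * K ^ 2) * N) ≤ T ^ 2 * (-(x11 * x22 - x12 ^ 2) + 1 / g0 * b ^ 2) := by
    nlinarith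
  exact le_of_mul_le_mul_left k4 hT0

lemma mixed_nonneg {u11 u12 u22 v11 v12 v22 : ℝ} (h1 : 0 < u11) (h2 : 0 < u22) (h3 : 0 < v11)
    (h4 : 0 < v22) (hu : u12 ^ 2 ≤ u11 * u22) (hv : v12 ^ 2 ≤ v11 * v22) :
    0 ≤ u11 * v22 + u22 * v11 - 2 * u12 * v12 := by
  have h : (2 * u12 * v12) ^ 2 ≤ (u11 * v22 + u22 * v11) ^ 2 := by
    have := mul_le_mul hu hv (sq_nonneg _) (by positivity)
    nlinarith [sq_nonneg (u11 * v22 - u22 * v11)]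
  have := abs_le_of_sq_le_sq h (by positivity)
  linarith [le_abs_self (2 * u12 * v12)]

lemma det_avg {u11 u12 u22 v11 v12 v22 g0 : ℝ} (h1 : 0 < u11) (h2 : 0 < u22) (h3 : 0 < v11)
    (h4 : 0 < v22) (hg : 0 < g0) (hu : g0 ≤ u11 * u22 - u12 ^ 2) (hv : g0 ≤ v11 * v22 - v12 ^ 2) :
    g0 / 2 ≤ ((u11 + v11) / 2) * ((u22 + v22) / 2) - ((u12 + v12) / 2) ^ 2 := by
  have := mixed_nonneg h1 h2 h3 h4 (by linarith) (by linarith) (u12 := u12) (v12 := v12)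
  nlinarith

end GMA

/-! ### Part E: higher order difference estimates -/

namespace GMA

open Finset in
lemma mid_bound (n : ℕ) (hn : 1 ≤ n) (M : ℝ) (hM : 0 ≤ M) (σ : ℝ → ℝ) (hσ : ∀ ε, 0 < ε → 0 < σ ε)
    (η : ℝ) (hη : 0 < η) :
    ∃ C, 0 ≤ C ∧ ∀ (f g : ℝ × ℝ → ℝ) (w : ℝ × ℝ), Continuous f → Biperiodic f →
      (∀ z, |f z| ≤ M) → HasMod σ f → Continuous g → Biperiodic g →
      (∀ z, |g z| ≤ M) → HasMod σ g → 0 < ‖w‖ →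
      TI (fun z => (dn w n (fun z => f z * g z) z - f (z + (n : ℝ) • w) * dn w n g z
        - dn w n f z * g z) ^ 2) ≤
      η * (TI (fun z => dn w n f z ^ 2) + TI (fun z => dn w n g z ^ 2)) + C * ‖w‖ ^ (2 * n) := by
  set S := (antidiagonal n).filter (fun ij => 1 ≤ ij.1 ∧ 1 ≤ ij.2) with hS
  set P : ℝ := #S * (∑ ij ∈ S, (n.choose ij.1 : ℝ) ^ 2) with hP
  have hP0 : 0 ≤ P := by positivity
  obtain ⟨C, hC, hgn⟩ := gn n M hM σ hσ (η / (P + 1)) (by positivity)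
  refine ⟨2 * P * C, by positivity, fun f g w hf hfp hfM hfσ hg hgp hgM hgσ hw => ?_⟩
  have hcf := fun k => dn_cont (w := w) hf k
  have hcg := fun k => dn_cont (w := w) hg k
  -- the middle sum
  have e1 : ∀ z, dn w n (fun z => f z * g z) z - f (z + (n : ℝ) • w) * dn w n g z
        - dn w n f z * g z = ∑ ij ∈ S, (n.choose ij.1 : ℝ) *
        (dn w ij.1 f (z + (ij.2 : ℝ) • w) * dn w ij.2 g z) := by
    intro z
    rw [dn_mul, hS, ← Finset.sum_filter_add_sum_filter_not (antidiagonal n)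
      (fun ij => 1 ≤ ij.1 ∧ 1 ≤ ij.2)]
    have : (antidiagonal n).filter (fun ij => ¬ (1 ≤ ij.1 ∧ 1 ≤ ij.2)) = {(0, n), (n, 0)} := by
      ext ⟨i, j⟩
      simp only [mem_filter, HasAntidiagonal.mem_antidiagonal, mem_insert, mem_singleton, Prod.mk.injEq]
      omega
    rw [this, Finset.sum_pair (by simp; omega)]
    simp [dn]
    ring
  have hpt : ∀ ij ∈ S, ∀ z, (dn w ij.1 f (z + (ij.2 : ℝ) • w) * dn w ij.2 g z) ^ 2 ≤
      |dn w ij.1 f (z + (ij.2 : ℝ) • w)| ^ (2 * n / ij.1 : ℝ)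
        + |dn w ij.2 g z| ^ (2 * n / ij.2 : ℝ) := by
    rintro ⟨i, j⟩ hij z
    simp only [hS, mem_filter, HasAntidiagonal.mem_antidiagonal] at hij
    obtain ⟨h1, h2, h3⟩ := hij
    simp only
    generalize dn w i f (z + (j : ℝ) • w) = a
    generalize dn w j g z = b
    have hi : (0 : ℝ) < i := by exact_mod_cast h2
    have hj : (0 : ℝ) < j := by exact_mod_cast h3
    have hn' : (0 : ℝ) < n := by exact_mod_cast hn
    have hijn : (i : ℝ) + j = n := by exact_mod_cast h1
    have := Real.geom_mean_le_arith_mean2_weighted (w₁ := i / n) (w₂ := j / n)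
      (p₁ := |a| ^ (2 * n / i : ℝ)) (p₂ := |b| ^ (2 * n / j : ℝ)) (by positivity)
      (by positivity) (by positivity) (by positivity) (by field_simp; exact hijn)
    rw [← Real.rpow_mul (abs_nonneg _), ← Real.rpow_mul (abs_nonneg _),
      show (2 * n / i : ℝ) * (i / n) = (2 : ℕ) by field_simp; norm_num,
      show (2 * n / j : ℝ) * (j / n) = (2 : ℕ) by field_simp; norm_num,
      Real.rpow_natCast, Real.rpow_natCast, sq_abs, sq_abs, ← mul_pow] at this
    refine this.trans (add_le_add (mul_le_of_le_one_left (by positivity) ?_)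
      (mul_le_of_le_one_left (by positivity) ?_))
    · rw [div_le_one hn']; linarith
    · rw [div_le_one hn']; linarith
  have hsq : ∀ z, (∑ ij ∈ S, (n.choose ij.1 : ℝ) *
        (dn w ij.1 f (z + (ij.2 : ℝ) • w) * dn w ij.2 g z)) ^ 2 ≤
      ∑ ij ∈ S, (#S * (n.choose ij.1 : ℝ) ^ 2) * (|dn w ij.1 f (z + (ij.2 : ℝ) • w)| ^ (2 * n / ij.1 : ℝ)
        + |dn w ij.2 g z| ^ (2 * n / ij.2 : ℝ)) := by
    intro z
    refine sq_sum_le_card_mul_sum_sq.trans ?_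
    rw [Finset.mul_sum]
    refine Finset.sum_le_sum fun ij hij => ?_
    rw [mul_pow, ← mul_assoc]
    exact mul_le_mul_of_nonneg_left (hpt ij hij z) (by positivity)
  have hc1 : ∀ k j : ℕ, Continuous (fun z => |dn w k f (z + (j : ℝ) • w)| ^ (2 * n / k : ℝ)) :=
    fun k j => (cont_rpow (hcf k) (by positivity)).comp (continuous_add_const _)
  have hc2 : ∀ k : ℕ, Continuous (fun z => |dn w k g z| ^ (2 * n / k : ℝ)) :=
    fun k => (cont_rpow (hcg k) (by positivity))
  simp only [e1]
  refine (TI_mono ?_ ?_ hsq).trans ?_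
  · refine (continuous_finset_sum _ fun ij _ => ?_).pow 2
    have := hcf ij.1
    have := hcg ij.2
    fun_prop
  · refine continuous_finset_sum _ fun ij _ => ?_
    exact continuous_const.mul ((hc1 _ _).add (hc2 _))
  have hc3 : ∀ ij ∈ S, Continuous (fun z => (#S * (n.choose ij.1 : ℝ) ^ 2) *
      (|dn w ij.1 f (z + (ij.2 : ℝ) • w)| ^ (2 * n / ij.1 : ℝ)
        + |dn w ij.2 g z| ^ (2 * n / ij.2 : ℝ))) :=
    fun ij _ => continuous_const.mul ((hc1 _ _).add (hc2 _))
  rw [TI_sum _ _ hc3]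
  set Q : ℝ := η / (P + 1) * (TI (fun z => dn w n f z ^ 2) + TI (fun z => dn w n g z ^ 2))
    + 2 * C * ‖w‖ ^ (2 * n) with hQ
  have hterm : ∀ ij ∈ S, TI (fun z => (#S * (n.choose ij.1 : ℝ) ^ 2) *
      (|dn w ij.1 f (z + (ij.2 : ℝ) • w)| ^ (2 * n / ij.1 : ℝ)
        + |dn w ij.2 g z| ^ (2 * n / ij.2 : ℝ))) ≤ (#S * (n.choose ij.1 : ℝ) ^ 2) * Q := by
    intro ij hij
    rw [TI_mul, TI_add (hc1 _ _) (hc2 _),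
      TI_shift (f := fun z => |dn w ij.1 f z| ^ (2 * n / ij.1 : ℝ))
        (cont_rpow (hcf _) (by positivity))
        (per_comp (dn_per hfp _) (fun s => |s| ^ (2 * n / ij.1 : ℝ)))]
    refine mul_le_mul_of_nonneg_left ?_ (by positivity)
    simp only [hS, mem_filter, HasAntidiagonal.mem_antidiagonal] at hij
    have a1 := hgn f w hf hfp hfM hfσ hw ij.1 (by omega) (by omega)
    have a2 := hgn g w hg hgp hgM hgσ hw ij.2 (by omega) (by omega)
    unfold GN at a1 a2
    rw [hQ]
    linarith
  refine (Finset.sum_le_sum hterm).trans ?_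
  rw [← Finset.sum_mul, ← Finset.mul_sum, ← hP, hQ]
  have hA : 0 ≤ TI (fun z => dn w n f z ^ 2) + TI (fun z => dn w n g z ^ 2) :=
    add_nonneg (TI_nonneg fun _ => sq_nonneg _) (TI_nonneg fun _ => sq_nonneg _)
  generalize TI (fun z => dn w n f z ^ 2) + TI (fun z => dn w n g z ^ 2) = A at hA ⊢
  have : P * (η / (P + 1) * A) ≤ η * A := by
    rw [← mul_assoc]
    refine mul_le_mul_of_nonneg_right ?_ hA
    rw [← mul_div_assoc, div_le_iff₀ (by positivity)]
    nlinarith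
  nlinarith

/-- Coefficients of the equation. -/
structure Cf where
  a : ℝ
  b : ℝ
  c : ℝ
  l11 : ℝ
  l12 : ℝ
  l22 : ℝ
  m11 : ℝ
  m12 : ℝ
  m22 : ℝ

/-- First entry of the matrix. -/
noncomputable def u11 (q : Cf) (p : ℝ × ℝ → ℝ) (z : ℝ × ℝ) : ℝ :=
  q.a + pdx (pdx p) z - q.l11 * pdx p z - q.m11 * pdy p z
/-- Mixed entry of the matrix. -/
noncomputable def u12 (q : Cf) (p : ℝ × ℝ → ℝ) (z : ℝ × ℝ) : ℝ :=
  q.c + pdy (pdx p) z - q.l12 * pdx p z - q.m12 * pdy p z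
/-- Last entry of the matrix. -/
noncomputable def u22 (q : Cf) (p : ℝ × ℝ → ℝ) (z : ℝ × ℝ) : ℝ :=
  q.b + pdy (pdy p) z - q.l22 * pdx p z - q.m22 * pdy p z

/-- Solutions of the equation with given right hand side. -/
structure Sol (q : Cf) (G p : ℝ × ℝ → ℝ) : Prop where
  cd : ContDiff ℝ 2 p
  per : Biperiodic p
  eq : ∀ z, u11 q p z * u22 q p z - u12 q p z ^ 2 = G z
  pos1 : ∀ z, 0 < u11 q p z
  pos2 : ∀ z, 0 < u22 q p z

/-- Bounds for the coefficients. -/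
structure CfB (q : Cf) (Λ : ℝ) : Prop where
  a : |q.a| ≤ Λ
  b : |q.b| ≤ Λ
  c : |q.c| ≤ Λ
  l11 : |q.l11| ≤ Λ
  l12 : |q.l12| ≤ Λ
  l22 : |q.l22| ≤ Λ
  m11 : |q.m11| ≤ Λ
  m12 : |q.m12| ≤ Λ
  m22 : |q.m22| ≤ Λ

/-- Bounds for the right hand side. -/
structure GB (G : ℝ × ℝ → ℝ) (g0 : ℝ) (Γ : ℕ → ℝ) : Prop where
  cd : ContDiff ℝ (⊤ : ℕ∞) G
  per : Biperiodic G
  pos : ∀ z, g0 ≤ G z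
  dn : ∀ n w z, |dn w n G z| ≤ Γ n * ‖w‖ ^ n

/-- Bounds for the Hessian. -/
structure HB (q : Cf) (p : ℝ × ℝ → ℝ) (M : ℝ) (σ : ℝ → ℝ) : Prop where
  px : ∀ z, |pdx p z| ≤ M
  py : ∀ z, |pdy p z| ≤ M
  pxx : ∀ z, |pdx (pdx p) z| ≤ M
  pxy : ∀ z, |pdy (pdx p) z| ≤ M
  pyy : ∀ z, |pdy (pdy p) z| ≤ M
  b11 : ∀ z, |u11 q p z| ≤ M
  b12 : ∀ z, |u12 q p z| ≤ M
  b22 : ∀ z, |u22 q p z| ≤ M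
  s11 : HasMod σ (u11 q p)
  s12 : HasMod σ (u12 q p)
  s22 : HasMod σ (u22 q p)

section
variable {p : ℝ × ℝ → ℝ}
lemma cpx (hp : ContDiff ℝ 2 p) : ContDiff ℝ 1 (pdx p) := cd_pdx hp (by norm_num)
lemma cpy (hp : ContDiff ℝ 2 p) : ContDiff ℝ 1 (pdy p) := cd_pdy hp (by norm_num)
lemma ctx (hp : ContDiff ℝ 2 p) : Continuous (pdx p) := (cpx hp).continuous
lemma cty (hp : ContDiff ℝ 2 p) : Continuous (pdy p) := (cpy hp).continuous
lemma ctxx (hp : ContDiff ℝ 2 p) : Continuous (pdx (pdx p)) := cont_pdx (cpx hp)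
lemma ctxy (hp : ContDiff ℝ 2 p) : Continuous (pdy (pdx p)) := cont_pdy (cpx hp)
lemma ctyy (hp : ContDiff ℝ 2 p) : Continuous (pdy (pdy p)) := cont_pdy (cpy hp)
lemma cu11 (q : Cf) (hp : ContDiff ℝ 2 p) : Continuous (u11 q p) := by
  have := ctx hp; have := cty hp; have := ctxx hp; unfold u11; fun_prop
lemma cu12 (q : Cf) (hp : ContDiff ℝ 2 p) : Continuous (u12 q p) := by
  have := ctx hp; have := cty hp; have := ctxy hp; unfold u12; fun_prop
lemma cu22 (q : Cf) (hp : ContDiff ℝ 2 p) : Continuous (u22 q p) := by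
  have := ctx hp; have := cty hp; have := ctyy hp; unfold u22; fun_prop
lemma pu11 (q : Cf) (hp : Biperiodic p) : Biperiodic (u11 q p) :=
  per_sub (per_sub (per_add (per_const _) (per_pdx (per_pdx hp))) (per_cmul _ (per_pdx hp)))
    (per_cmul _ (per_pdy hp))
lemma pu12 (q : Cf) (hp : Biperiodic p) : Biperiodic (u12 q p) :=
  per_sub (per_sub (per_add (per_const _) (per_pdy (per_pdx hp))) (per_cmul _ (per_pdx hp)))
    (per_cmul _ (per_pdy hp))
lemma pu22 (q : Cf) (hp : Biperiodic p) : Biperiodic (u22 q p) :=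
  per_sub (per_sub (per_add (per_const _) (per_pdy (per_pdy hp))) (per_cmul _ (per_pdx hp)))
    (per_cmul _ (per_pdy hp))

lemma dn_lin (w : ℝ × ℝ) (n : ℕ) (hn : 1 ≤ n) (A l m : ℝ) (f g h : ℝ × ℝ → ℝ) :
    dn w n (fun z => A + f z - l * g z - m * h z) =
      fun z => dn w n f z - l * dn w n g z - m * dn w n h z := by
  rw [dn_sub w (fun z => A + f z - l * g z) (fun z => m * h z),
    dn_sub w (fun z => A + f z) (fun z => l * g z), dn_add w (fun _ => A) f, dn_const w A n hn,
    dn_cmul, dn_cmul]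
  ext z; ring

end

/-- The energy of order `n`. -/
noncomputable def VV (w : ℝ × ℝ) (n : ℕ) (p : ℝ × ℝ → ℝ) : ℝ :=
  TI (fun z => dn w n (pdx (pdx p)) z ^ 2 + 2 * dn w n (pdy (pdx p)) z ^ 2
    + dn w n (pdy (pdy p)) z ^ 2)

lemma TI_le_VV {p : ℝ × ℝ → ℝ} (hp : ContDiff ℝ 2 p) (w : ℝ × ℝ) (n : ℕ) :
    TI (fun z => dn w n (pdx (pdx p)) z ^ 2) ≤ VV w n p ∧
    TI (fun z => dn w n (pdy (pdx p)) z ^ 2) ≤ VV w n p ∧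
    TI (fun z => dn w n (pdy (pdy p)) z ^ 2) ≤ VV w n p := by
  have h1 := dn_cont (w := w) (ctxx hp) n
  have h2 := dn_cont (w := w) (ctxy hp) n
  have h3 := dn_cont (w := w) (ctyy hp) n
  refine ⟨TI_mono (by fun_prop) (by fun_prop) fun z => ?_,
    TI_mono (by fun_prop) (by fun_prop) fun z => ?_,
    TI_mono (by fun_prop) (by fun_prop) fun z => ?_⟩
  · nlinarith [sq_nonneg (dn w n (pdy (pdx p)) z), sq_nonneg (dn w n (pdy (pdy p)) z)]
  · nlinarith [sq_nonneg (dn w n (pdx (pdx p)) z), sq_nonneg (dn w n (pdy (pdx p)) z),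
      sq_nonneg (dn w n (pdy (pdy p)) z)]
  · nlinarith [sq_nonneg (dn w n (pdx (pdx p)) z), sq_nonneg (dn w n (pdy (pdx p)) z)]

lemma low_order {p : ℝ × ℝ → ℝ} (hp : ContDiff ℝ 2 p) (hper : Biperiodic p) (w : ℝ × ℝ) (n : ℕ)
    {C : ℝ} (h : VV w n p ≤ C * ‖w‖ ^ (2 * n)) :
    TI (fun z => dn w (n + 1) (pdx p) z ^ 2) ≤ 4 * C * ‖w‖ ^ (2 * (n + 1)) ∧
    TI (fun z => dn w (n + 1) (pdy p) z ^ 2) ≤ 4 * C * ‖w‖ ^ (2 * (n + 1)) := by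
  obtain ⟨v1, v2, v3⟩ := TI_le_VV hp w n
  have hw : 0 ≤ 2 * ‖w‖ ^ 2 := by positivity
  have h1 := TI_dl_sq (dn_cd (w := w) (cpx hp) n) (dn_per (per_pdx hper) n) w
  have h2 := TI_dl_sq (dn_cd (w := w) (cpy hp) n) (dn_per (per_pdy hper) n) w
  rw [dn_pdx (cpx hp), dn_pdy (cpx hp)] at h1
  rw [dn_pdx (cpy hp), dn_pdy (cpy hp), pd_comm hp] at h2
  constructor
  · refine h1.trans ?_
    have := mul_le_mul_of_nonneg_left
      (show _ ≤ 2 * (C * ‖w‖ ^ (2 * n)) from (add_le_add v1 v2).trans (by linarith)) hw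
    refine this.trans (le_of_eq (by ring))
  · refine h2.trans ?_
    have := mul_le_mul_of_nonneg_left
      (show _ ≤ 2 * (C * ‖w‖ ^ (2 * n)) from (add_le_add v2 v3).trans (by linarith)) hw
    refine this.trans (le_of_eq (by ring))

end GMA

/-! ### Part F: the inductive step of the difference estimates -/

namespace GMA

lemma sq3 (x y z : ℝ) : (x + y + z) ^ 2 ≤ 3 * (x ^ 2 + y ^ 2 + z ^ 2) := by
  nlinarith [sq_nonneg (x - y), sq_nonneg (x - z), sq_nonneg (y - z)]

/-- integrated bound for the differences of the matrix entries -/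
lemma TI_y_le {w : ℝ × ℝ} {n : ℕ} {f g h : ℝ × ℝ → ℝ} {A l m Λ V L : ℝ} (hn : 1 ≤ n)
    (hf : Continuous f) (hg : Continuous g) (hh : Continuous h) (hl : |l| ≤ Λ) (hm : |m| ≤ Λ)
    (hV : TI (fun z => dn w n f z ^ 2) ≤ V) (hg2 : TI (fun z => dn w n g z ^ 2) ≤ L)
    (hh2 : TI (fun z => dn w n h z ^ 2) ≤ L) :
    TI (fun z => dn w n (fun z => A + f z - l * g z - m * h z) z ^ 2) ≤
      3 * V + 6 * Λ ^ 2 * L := by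
  rw [dn_lin w n hn]
  have c1 := dn_cont (w := w) hf n
  have c2 := dn_cont (w := w) hg n
  have c3 := dn_cont (w := w) hh n
  have h1 : l ^ 2 ≤ Λ ^ 2 := by rw [← sq_abs l]; gcongr
  have h2 : m ^ 2 ≤ Λ ^ 2 := by rw [← sq_abs m]; gcongr
  have : TI (fun z => (dn w n f z - l * dn w n g z - m * dn w n h z) ^ 2) ≤
      TI (fun z => (3 * dn w n f z ^ 2 + (3 * Λ ^ 2) * dn w n g z ^ 2)
        + (3 * Λ ^ 2) * dn w n h z ^ 2) := by
    refine TI_mono (by fun_prop) (by fun_prop) fun z => ?_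
    have := sq3 (dn w n f z) (- (l * dn w n g z)) (-(m * dn w n h z))
    have := mul_le_mul_of_nonneg_right h1 (sq_nonneg (dn w n g z))
    have := mul_le_mul_of_nonneg_right h2 (sq_nonneg (dn w n h z))
    nlinarith
  refine this.trans ?_
  rw [TI_add (by fun_prop) (by fun_prop), TI_add (by fun_prop) (by fun_prop), TI_mul, TI_mul,
    TI_mul]
  have := mul_le_mul_of_nonneg_left hg2 (by positivity : 0 ≤ 3 * Λ ^ 2)
  have := mul_le_mul_of_nonneg_left hh2 (by positivity : 0 ≤ 3 * Λ ^ 2)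
  linarith

lemma bL_bound {l11 l12 l22 m11 m12 m22 Λ M w11 w12 w22 gx gy : ℝ} (hΛ : 0 ≤ Λ) (hM : 0 ≤ M)
    (h1 : |l11| ≤ Λ) (h2 : |l12| ≤ Λ) (h3 : |l22| ≤ Λ) (h4 : |m11| ≤ Λ) (h5 : |m12| ≤ Λ)
    (h6 : |m22| ≤ Λ) (k1 : |w11| ≤ M) (k2 : |w12| ≤ M) (k3 : |w22| ≤ M) :
    ((l11 * gx + m11 * gy) * w22 + (l22 * gx + m22 * gy) * w11
      - 2 * (l12 * gx + m12 * gy) * w12) ^ 2 ≤ 32 * M ^ 2 * Λ ^ 2 * (gx ^ 2 + gy ^ 2) := by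
  have a : ∀ l m w : ℝ, |l| ≤ Λ → |m| ≤ Λ → |w| ≤ M →
      |(l * gx + m * gy) * w| ≤ Λ * M * (|gx| + |gy|) := by
    intro l m w hl hm hw
    rw [abs_mul]
    have : |l * gx + m * gy| ≤ Λ * (|gx| + |gy|) := by
      refine (abs_add_le _ _).trans ?_
      rw [abs_mul, abs_mul, mul_add]
      gcongr
    calc _ ≤ (Λ * (|gx| + |gy|)) * M := mul_le_mul this hw (abs_nonneg _) (by positivity)
      _ = _ := by ring
  have a1 := abs_le.1 (a l11 m11 w22 h1 h4 k3)
  have a2 := abs_le.1 (a l22 m22 w11 h3 h6 k1)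
  have a3 := abs_le.1 (a l12 m12 w12 h2 h5 k2)
  have h : |(l11 * gx + m11 * gy) * w22 + (l22 * gx + m22 * gy) * w11
      - 2 * (l12 * gx + m12 * gy) * w12| ≤ 4 * (Λ * M * (|gx| + |gy|)) := by
    rw [abs_le]; constructor <;> nlinarith
  rw [← sq_abs]
  calc _ ≤ (4 * (Λ * M * (|gx| + |gy|))) ^ 2 := by gcongr
    _ = 16 * (Λ * M) ^ 2 * (|gx| + |gy|) ^ 2 := by ring
    _ ≤ 16 * (Λ * M) ^ 2 * (2 * (gx ^ 2 + gy ^ 2)) := by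
      refine mul_le_mul_of_nonneg_left ?_ (by positivity)
      rw [← sq_abs gx, ← sq_abs gy]
      nlinarith [sq_nonneg (|gx| - |gy|)]
    _ = _ := by ring

/-- middle terms of the Leibniz formula -/
noncomputable def mid (w : ℝ × ℝ) (n : ℕ) (f g : ℝ × ℝ → ℝ) (z : ℝ × ℝ) : ℝ :=
  dn w n (fun z => f z * g z) z - f (z + (n : ℝ) • w) * dn w n g z - dn w n f z * g z

lemma mid_cont {w : ℝ × ℝ} {n : ℕ} {f g : ℝ × ℝ → ℝ} (hf : Continuous f) (hg : Continuous g) :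
    Continuous (mid w n f g) := by
  have h1 := dn_cont (w := w) (hf.mul hg) n
  have h2 := dn_cont (w := w) hf n
  have h3 := dn_cont (w := w) hg n
  have h1' : Continuous (dn w n (fun z => f z * g z)) := h1
  unfold mid
  fun_prop

lemma four_sq {a b c d R : ℝ} (h : a ^ 2 ≤ R) :
    (a - b / 2 - c / 2 + d) ^ 2 ≤ 4 * (R + (b ^ 2 + (c ^ 2 + d ^ 2))) := by
  have : (a - b / 2 - c / 2 + d) ^ 2 ≤ 4 * (a ^ 2 + ((b / 2) ^ 2 + ((c / 2) ^ 2 + d ^ 2))) := by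
    nlinarith [sq_nonneg (a + b / 2), sq_nonneg (a + c / 2), sq_nonneg (a - d),
      sq_nonneg (b / 2 - c / 2), sq_nonneg (b / 2 + d), sq_nonneg (c / 2 + d)]
  nlinarith [sq_nonneg b, sq_nonneg c]

lemma fin_alg {g0 x11 x12 x22 gx gy w11 w12 w22 l11 l12 l22 m11 m12 m22 R N c0 D : ℝ}
    (hg0 : 0 < g0)
    (hE : c0 ≤ D + 1 / (g0 / 2) * (x11 * w22 + x22 * w11 - 2 * x12 * w12) ^ 2)
    (bY : ((x11 - l11 * gx - m11 * gy) * w22 + (x22 - l22 * gx - m22 * gy) * w11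
          - 2 * (x12 - l12 * gx - m12 * gy) * w12) ^ 2 ≤ 4 * R)
    (hL : ((l11 * gx + m11 * gy) * w22 + (l22 * gx + m22 * gy) * w11
          - 2 * (l12 * gx + m12 * gy) * w12) ^ 2 ≤ 32 * N) :
    c0 ≤ D + 2 / g0 * (8 * R + 64 * N) := by
  have hsum : (x11 * w22 + x22 * w11 - 2 * x12 * w12) ^ 2 ≤
        2 * ((x11 - l11 * gx - m11 * gy) * w22 + (x22 - l22 * gx - m22 * gy) * w11
          - 2 * (x12 - l12 * gx - m12 * gy) * w12) ^ 2
        + 2 * ((l11 * gx + m11 * gy) * w22 + (l22 * gx + m22 * gy) * w11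
          - 2 * (l12 * gx + m12 * gy) * w12) ^ 2 := by
    have : ∀ a b c : ℝ, a = b + c → a ^ 2 ≤ 2 * b ^ 2 + 2 * c ^ 2 := by
      intro a b c h; subst h; nlinarith [sq_nonneg (b - c)]
    exact this _ _ _ (by ring)
  have e3 : 1 / (g0 / 2) = 2 / g0 := by field_simp
  rw [e3] at hE
  have h4 : (x11 * w22 + x22 * w11 - 2 * x12 * w12) ^ 2 ≤ 8 * R + 64 * N := by linarith
  have h5 := mul_le_mul_of_nonneg_left h4 (by positivity : 0 ≤ 2 / g0)
  linarith

set_option maxHeartbeats 1000000 in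
lemma energy_step (n : ℕ) (hn : 1 ≤ n) {M Λ g0 : ℝ} (hM : 0 ≤ M) (hΛ : 0 ≤ Λ) (hg0 : 0 < g0)
    {σ : ℝ → ℝ} (hσ : ∀ ε, 0 < ε → 0 < σ ε) {Γ : ℕ → ℝ} {C0 : ℝ} (hC0 : 0 ≤ C0) :
    ∃ C, 0 ≤ C ∧ ∀ q G p, CfB q Λ → GB G g0 Γ → Sol q G p → HB q p M σ → ∀ w : ℝ × ℝ, 0 < ‖w‖ →
      TI (fun z => dn w n (pdx p) z ^ 2) ≤ C0 * ‖w‖ ^ (2 * n) →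
      TI (fun z => dn w n (pdy p) z ^ 2) ≤ C0 * ‖w‖ ^ (2 * n) →
      VV w n p ≤ C * ‖w‖ ^ (2 * n) := by
  set K := M + 1 with hK
  have hK0 : 0 < K := by positivity
  set c0 := g0 / 2 / (8 * K ^ 2) with hc0
  have hc00 : 0 < c0 := by positivity
  set η := c0 * g0 / 576 with hη
  obtain ⟨C1, hC1, hmid⟩ := mid_bound n hn M hM σ hσ η (by positivity)
  set C2 := 2 / g0 * (8 * (Γ n ^ 2 + 3 * (η * (12 * Λ ^ 2 * C0) + C1)) + 64 * M ^ 2 * Λ ^ 2 * (2 * C0)) with hC2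
  refine ⟨2 / c0 * C2, by positivity, fun q G p hq hG hs hb w hw hx hy => ?_⟩
  set H := ‖w‖ ^ (2 * n) with hH
  have hH0 : 0 ≤ H := by positivity
  have hp := hs.cd
  set V := VV w n p with hVd
  have cx := dn_cont (w := w) (ctx hp) n
  have cy := dn_cont (w := w) (cty hp) n
  have cxx := dn_cont (w := w) (ctxx hp) n
  have cxy := dn_cont (w := w) (ctxy hp) n
  have cyy := dn_cont (w := w) (ctyy hp) n
  have d11 := cu11 q hp
  have d12 := cu12 q hp
  have d22 := cu22 q hp
  obtain ⟨v1, v2, v3⟩ := TI_le_VV hp w n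
  have y1 : TI (fun z => dn w n (u11 q p) z ^ 2) ≤ 3 * V + 6 * Λ ^ 2 * (C0 * H) :=
    TI_y_le (A := q.a) hn (ctxx hp) (ctx hp) (cty hp) hq.l11 hq.m11 v1 hx hy
  have y2 : TI (fun z => dn w n (u12 q p) z ^ 2) ≤ 3 * V + 6 * Λ ^ 2 * (C0 * H) :=
    TI_y_le (A := q.c) hn (ctxy hp) (ctx hp) (cty hp) hq.l12 hq.m12 v2 hx hy
  have y3 : TI (fun z => dn w n (u22 q p) z ^ 2) ≤ 3 * V + 6 * Λ ^ 2 * (C0 * H) :=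
    TI_y_le (A := q.b) hn (ctyy hp) (ctx hp) (cty hp) hq.l22 hq.m22 v3 hx hy
  have m1 := hmid (u11 q p) (u22 q p) w d11 (pu11 q hs.per) hb.b11 hb.s11 d22 (pu22 q hs.per)
    hb.b22 hb.s22 hw
  have m2 := hmid (u22 q p) (u11 q p) w d22 (pu22 q hs.per) hb.b22 hb.s22 d11 (pu11 q hs.per)
    hb.b11 hb.s11 hw
  have m3 := hmid (u12 q p) (u12 q p) w d12 (pu12 q hs.per) hb.b12 hb.s12 d12 (pu12 q hs.per)
    hb.b12 hb.s12 hw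
  change TI (fun z => mid w n (u11 q p) (u22 q p) z ^ 2) ≤ _ at m1
  change TI (fun z => mid w n (u22 q p) (u11 q p) z ^ 2) ≤ _ at m2
  change TI (fun z => mid w n (u12 q p) (u12 q p) z ^ 2) ≤ _ at m3
  have c1 := mid_cont (w := w) (n := n) d11 d22
  have c2 := mid_cont (w := w) (n := n) d22 d11
  have c3 := mid_cont (w := w) (n := n) d12 d12
  set f1 := mid w n (u11 q p) (u22 q p) with hf1
  set f2 := mid w n (u22 q p) (u11 q p) with hf2
  set f3 := mid w n (u12 q p) (u12 q p) with hf3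
  -- pointwise inequality
  have hpt : ∀ z, c0 * (dn w n (pdx (pdx p)) z ^ 2 + 2 * dn w n (pdy (pdx p)) z ^ 2
      + dn w n (pdy (pdy p)) z ^ 2) ≤
      (-1) * (dn w n (pdx (pdx p)) z * dn w n (pdy (pdy p)) z - dn w n (pdy (pdx p)) z ^ 2)
      + (2 / g0) * (8 * (Γ n ^ 2 * H + (f1 z ^ 2 + (f2 z ^ 2 + f3 z ^ 2)))
        + 64 * M ^ 2 * Λ ^ 2 * (dn w n (pdx p) z ^ 2 + dn w n (pdy p) z ^ 2)) := by
    intro z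
    set z' := z + (n : ℝ) • w with hz'
    have hpos := hG.pos
    have hdet := det_avg (hs.pos1 z) (hs.pos2 z) (hs.pos1 z') (hs.pos2 z') hg0
      (u12 := u12 q p z) (v12 := u12 q p z')
      ((hpos z).trans (hs.eq z).ge) ((hpos z').trans (hs.eq z').ge)
    have bav : ∀ u : ℝ × ℝ → ℝ, (∀ z, |u z| ≤ M) → |(u z + u z') / 2| ≤ M := by
      intro u hu
      have h1 := abs_le.1 (hu z)
      have h2 := abs_le.1 (hu z')
      rw [abs_le]; constructor <;> linarith
    have w11b := bav _ hb.b11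
    have w12b := bav _ hb.b12
    have w22b := bav _ hb.b22
    set w11 := (u11 q p z + u11 q p z') / 2 with hw11
    set w12 := (u12 q p z + u12 q p z') / 2 with hw12
    set w22 := (u22 q p z + u22 q p z') / 2 with hw22
    have hT : (w11 + w22) ^ 2 ≤ 4 * K ^ 2 := by
      have : |w11 + w22| ≤ 2 * K := by
        refine (abs_add_le _ _).trans ?_
        rw [hK]; linarith
      rw [← sq_abs]
      calc _ ≤ (2 * K) ^ 2 := by gcongr
        _ = _ := by ring
    have hE := alg_energy (x11 := dn w n (pdx (pdx p)) z) (x12 := dn w n (pdy (pdx p)) z)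
      (x22 := dn w n (pdy (pdy p)) z) (half_pos hg0) hK0 hdet hT
    have hL := bL_bound (gx := dn w n (pdx p) z) (gy := dn w n (pdy p) z) hΛ hM hq.l11 hq.l12
      hq.l22 hq.m11 hq.m12 hq.m22 w11b w12b w22b
    -- linear part
    have e11 : dn w n (u11 q p) z = dn w n (pdx (pdx p)) z - q.l11 * dn w n (pdx p) z
        - q.m11 * dn w n (pdy p) z := congrFun (dn_lin w n hn q.a q.l11 q.m11 _ _ _) z
    have e12 : dn w n (u12 q p) z = dn w n (pdy (pdx p)) z - q.l12 * dn w n (pdx p) z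
        - q.m12 * dn w n (pdy p) z := congrFun (dn_lin w n hn q.c q.l12 q.m12 _ _ _) z
    have e22 : dn w n (u22 q p) z = dn w n (pdy (pdy p)) z - q.l22 * dn w n (pdx p) z
        - q.m22 * dn w n (pdy p) z := congrFun (dn_lin w n hn q.b q.l22 q.m22 _ _ _) z
    have eG : dn w n G z = dn w n (fun z => u11 q p z * u22 q p z) z
        - dn w n (fun z => u12 q p z * u12 q p z) z := by
      have : G = fun z => u11 q p z * u22 q p z - u12 q p z * u12 q p z := by
        ext z; rw [← hs.eq z]; ring
      rw [this, dn_sub w (fun z => u11 q p z * u22 q p z) (fun z => u12 q p z * u12 q p z)]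
    have ecomm : dn w n (fun z => u22 q p z * u11 q p z) z =
        dn w n (fun z => u11 q p z * u22 q p z) z := by
      congr 1; ext z; ring
    have g1 : f1 z = dn w n (fun z => u11 q p z * u22 q p z) z - u11 q p z' * dn w n (u22 q p) z
      - dn w n (u11 q p) z * u22 q p z := rfl
    have g2 : f2 z = dn w n (fun z => u11 q p z * u22 q p z) z - u22 q p z' * dn w n (u11 q p) z
      - dn w n (u22 q p) z * u11 q p z := by rw [← ecomm]; rfl
    have g3 : f3 z = dn w n (fun z => u12 q p z * u12 q p z) z - u12 q p z' * dn w n (u12 q p) z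
      - dn w n (u12 q p) z * u12 q p z := rfl
    have bY : dn w n (u11 q p) z * w22 + dn w n (u22 q p) z * w11 - 2 * dn w n (u12 q p) z * w12
        = dn w n G z - f1 z / 2 - f2 z / 2 + f3 z := by
      rw [g1, g2, g3, eG, hw11, hw12, hw22]; ring
    have hGn : dn w n G z ^ 2 ≤ Γ n ^ 2 * H := by
      have := hG.dn n w z
      rw [← sq_abs]
      calc _ ≤ (Γ n * ‖w‖ ^ n) ^ 2 := by gcongr
        _ = _ := by rw [hH]; ring
    have bY2 : (dn w n G z - f1 z / 2 - f2 z / 2 + f3 z) ^ 2 ≤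
        4 * (Γ n ^ 2 * H + (f1 z ^ 2 + (f2 z ^ 2 + f3 z ^ 2))) := by
      exact four_sq hGn
    rw [← bY, e11, e12, e22] at bY2
    have hL' := hL.trans (le_of_eq (by ring : _ = 32 * (M ^ 2 * Λ ^ 2 *
      (dn w n (pdx p) z ^ 2 + dn w n (pdy p) z ^ 2))))
    refine (fin_alg hg0 (by rwa [neg_eq_neg_one_mul] at hE) bY2 hL').trans (le_of_eq ?_)
    ring
  have hI := TI_mono (by fun_prop) (by fun_prop) hpt
  have hdet0 : TI (fun z => dn w n (pdx (pdx p)) z * dn w n (pdy (pdy p)) z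
      - dn w n (pdy (pdx p)) z ^ 2) = 0 := by
    have h1 : ContDiff ℝ 1 p := hp.of_le (by norm_num)
    have := TI_det (dn_cd (w := w) hp n) (dn_per hs.per n)
    rwa [dn_pdx h1, dn_pdy h1, dn_pdx (cpx hp), dn_pdy (cpx hp), dn_pdy (cpy hp)] at this
  rw [TI_mul] at hI
  change c0 * V ≤ _ at hI
  rw [TI_add (by fun_prop) (by fun_prop), TI_mul, hdet0, TI_mul,
    TI_add (by fun_prop) (by fun_prop), TI_mul, TI_add (by fun_prop) (by fun_prop), TI_const,
    TI_add (by fun_prop) (by fun_prop), TI_add (by fun_prop) (by fun_prop), TI_mul,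
    TI_add (by fun_prop) (by fun_prop)] at hI
  have n1 : TI (fun z => f1 z ^ 2) ≤ η * (6 * V + 12 * Λ ^ 2 * (C0 * H)) + C1 * H := by
    refine m1.trans (add_le_add (mul_le_mul_of_nonneg_left ?_ (by positivity)) le_rfl); linarith
  have n2 : TI (fun z => f2 z ^ 2) ≤ η * (6 * V + 12 * Λ ^ 2 * (C0 * H)) + C1 * H := by
    refine m2.trans (add_le_add (mul_le_mul_of_nonneg_left ?_ (by positivity)) le_rfl); linarith
  have n3 : TI (fun z => f3 z ^ 2) ≤ η * (6 * V + 12 * Λ ^ 2 * (C0 * H)) + C1 * H := by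
    refine m3.trans (add_le_add (mul_le_mul_of_nonneg_left ?_ (by positivity)) le_rfl); linarith
  have n4 : 64 * M ^ 2 * Λ ^ 2 * (TI (fun z => dn w n (pdx p) z ^ 2)
      + TI (fun z => dn w n (pdy p) z ^ 2)) ≤ 64 * M ^ 2 * Λ ^ 2 * (2 * C0 * H) :=
    mul_le_mul_of_nonneg_left (by linarith) (by positivity)
  have n5 : c0 * V ≤ 2 / g0 * (144 * η * V) + C2 * H := by
    have : 8 * (Γ n ^ 2 * H + (TI (fun z => f1 z ^ 2) + (TI (fun z => f2 z ^ 2)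
      + TI (fun z => f3 z ^ 2)))) + 64 * M ^ 2 * Λ ^ 2 * (TI (fun z => dn w n (pdx p) z ^ 2)
      + TI (fun z => dn w n (pdy p) z ^ 2)) ≤ 144 * η * V +
      (8 * (Γ n ^ 2 + 3 * (η * (12 * Λ ^ 2 * C0) + C1)) + 64 * M ^ 2 * Λ ^ 2 * (2 * C0)) * H := by
      nlinarith
    have := mul_le_mul_of_nonneg_left this (by positivity : 0 ≤ 2 / g0)
    rw [hC2]
    linarith
  have n6 : 2 / g0 * (144 * η * V) = c0 / 2 * V := by rw [hη]; field_simp; ring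
  rw [n6] at n5
  have n7 : c0 / 2 * V ≤ C2 * H := by linarith
  calc V = 2 / c0 * (c0 / 2 * V) := by field_simp
    _ ≤ 2 / c0 * (C2 * H) := mul_le_mul_of_nonneg_left n7 (by positivity)
    _ = _ := by ring

lemma energy_all {M Λ g0 : ℝ} (hM : 0 ≤ M) (hΛ : 0 ≤ Λ) (hg0 : 0 < g0)
    {σ : ℝ → ℝ} (hσ : ∀ ε, 0 < ε → 0 < σ ε) (Γ : ℕ → ℝ) (n : ℕ) :
    ∃ C, 0 ≤ C ∧ ∀ q G p, CfB q Λ → GB G g0 Γ → Sol q G p → HB q p M σ → ∀ w : ℝ × ℝ, 0 < ‖w‖ →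
      VV w n p ≤ C * ‖w‖ ^ (2 * n) := by
  induction n with
  | zero =>
    refine ⟨4 * M ^ 2, by positivity, fun q G p hq hG hs hb w hw => ?_⟩
    have hp := hs.cd
    have c1 := ctxx hp
    have c2 := ctxy hp
    have c3 := ctyy hp
    simp only [VV, dn, mul_zero, pow_zero, mul_one]
    rw [← TI_const (4 * M ^ 2)]
    refine TI_mono (by fun_prop) (by fun_prop) fun z => ?_
    have h1 : pdx (pdx p) z ^ 2 ≤ M ^ 2 := by
      rw [← sq_abs]; have := hb.pxx z; gcongr
    have h2 : pdy (pdx p) z ^ 2 ≤ M ^ 2 := by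
      rw [← sq_abs]; have := hb.pxy z; gcongr
    have h3 : pdy (pdy p) z ^ 2 ≤ M ^ 2 := by
      rw [← sq_abs]; have := hb.pyy z; gcongr
    linarith
  | succ n ih =>
    obtain ⟨C, hC, h⟩ := ih
    obtain ⟨C', hC', h'⟩ := energy_step (n + 1) (by omega) hM hΛ hg0 hσ (Γ := Γ)
      (C0 := 4 * C) (by positivity)
    refine ⟨C', hC', fun q G p hq hG hs hb w hw => ?_⟩
    obtain ⟨l1, l2⟩ := low_order hs.cd hs.per w n (h q G p hq hG hs hb w hw)
    exact h' q G p hq hG hs hb w hw l1 l2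

/-- Difference estimates for the solution itself. -/
lemma diff_est {M Λ g0 : ℝ} (hM : 0 ≤ M) (hΛ : 0 ≤ Λ) (hg0 : 0 < g0)
    {σ : ℝ → ℝ} (hσ : ∀ ε, 0 < ε → 0 < σ ε) (Γ : ℕ → ℝ) (n : ℕ) :
    ∃ C, 0 ≤ C ∧ ∀ q G p, CfB q Λ → GB G g0 Γ → Sol q G p → HB q p M σ → ∀ w : ℝ × ℝ, 0 < ‖w‖ →
      TI (fun z => |dn w (n + 2) p z|) ≤ C * ‖w‖ ^ (n + 2) := by
  obtain ⟨C, hC, h⟩ := energy_all hM hΛ hg0 hσ Γ n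
  refine ⟨4 * C + 1, by positivity, fun q G p hq hG hs hb w hw => ?_⟩
  have hp := hs.cd
  obtain ⟨l1, l2⟩ := low_order hs.cd hs.per w n (h q G p hq hG hs hb w hw)
  have hp1 : ContDiff ℝ 1 p := hp.of_le (by norm_num)
  have h1 := TI_dl_sq (dn_cd (w := w) hp1 (n + 1)) (dn_per hs.per (n + 1)) w
  rw [dn_pdx hp1, dn_pdy hp1] at h1
  change TI (fun z => dn w (n + 2) p z ^ 2) ≤ _ at h1
  have h2 := TI_cs (dn_cont (w := w) hp.continuous (n + 2)).abs (continuous_const (y := (1 : ℝ)))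
  simp only [mul_one, sq_abs, one_pow, TI_const] at h2
  have h3 : TI (fun z => dn w (n + 2) p z ^ 2) ≤ 16 * C * (‖w‖ ^ (n + 2)) ^ 2 := by
    refine h1.trans ?_
    have := mul_le_mul_of_nonneg_left (add_le_add l1 l2) (by positivity : 0 ≤ 2 * ‖w‖ ^ 2)
    refine this.trans (le_of_eq (by ring))
  refine abs_le_of_sq_le_sq ?_ (by positivity) |>.trans' (le_abs_self _)
  refine h2.trans (h3.trans ?_)
  rw [mul_pow]
  gcongr
  nlinarith [sq_nonneg (4 * C - 1)]

end GMA

/-! ### Part G: from difference estimates to smoothness, via Fourier series -/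

namespace GMA

open UnitAddTorus MeasureTheory

/-- Phase functional. -/
noncomputable def ph (ξ : Fin 2 → ℤ) : ℝ × ℝ →L[ℝ] ℝ :=
  (2 * Real.pi * ξ 0) • ContinuousLinearMap.fst ℝ ℝ ℝ
    + (2 * Real.pi * ξ 1) • ContinuousLinearMap.snd ℝ ℝ ℝ

lemma ph_apply (ξ : Fin 2 → ℤ) (z : ℝ × ℝ) :
    ph ξ z = 2 * Real.pi * (ξ 0 * z.1 + ξ 1 * z.2) := by
  simp [ph]; ring

/-- Projection to the torus. -/
noncomputable def tor (x : Fin 2 → ℝ) : UnitAddTorus (Fin 2) := fun i => ((x i : ℝ) : UnitAddCircle)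

lemma mF_tor (ξ : Fin 2 → ℤ) (x : Fin 2 → ℝ) :
    mFourier ξ (tor x) = Complex.exp (ph ξ (x 0, x 1) * Complex.I) := by
  simp only [mFourier, tor, ContinuousMap.coe_mk, Fin.prod_univ_two, fourier_coe_apply,
    ← Complex.exp_add, ph_apply]
  congr 1
  push_cast
  ring

lemma exists_lift {p : ℝ × ℝ → ℝ} (hp : Continuous p) (hper : Biperiodic p) :
    ∃ P : C(UnitAddTorus (Fin 2), ℂ), ∀ x, P (tor x) = p (x 0, x 1) := by
  set e : UnitAddCircle → ℝ := fun s => (AddCircle.equivIco 1 0 s : ℝ) with he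
  set Q : UnitAddCircle × UnitAddCircle → ℝ := fun s => p (e s.1, e s.2) with hQ
  have hx : ∀ y, Function.Periodic (fun x => p (x, y)) 1 := fun y x => (hper x y).1
  have hy : ∀ x, Function.Periodic (fun y => p (x, y)) 1 := fun x y => (hper x y).2
  have e1 : ∀ x : ℝ, ∃ m : ℤ, e (x : UnitAddCircle) = x + m := by
    intro x
    have h : ((e (x : UnitAddCircle) : ℝ) : UnitAddCircle) = x := AddCircle.coe_equivIco
    rw [← sub_eq_zero, ← AddCircle.coe_sub, AddCircle.coe_eq_zero_iff] at h
    obtain ⟨m, hm⟩ := h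
    refine ⟨m, ?_⟩
    simp at hm
    linarith
  have e2 : ∀ x y : ℝ, Q ((x : UnitAddCircle), (y : UnitAddCircle)) = p (x, y) := by
    intro x y
    obtain ⟨m, hm⟩ := e1 x
    obtain ⟨k, hk⟩ := e1 y
    simp only [hQ, hm, hk]
    have h1 := (hx (y + k)).int_mul m x
    have h2 := (hy x).int_mul k y
    simp only [mul_one] at h1 h2
    rw [h1, h2]
  have hq : IsOpenQuotientMap (Prod.map ((↑) : ℝ → UnitAddCircle) ((↑) : ℝ → UnitAddCircle)) :=
    IsOpenQuotientMap.prodMap QuotientAddGroup.isOpenQuotientMap_mk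
      QuotientAddGroup.isOpenQuotientMap_mk
  have hQc : Continuous Q := by
    rw [← hq.continuous_comp_iff]
    convert hp using 1
    ext ⟨x, y⟩
    exact e2 x y
  refine ⟨⟨fun s => (Q (s 0, s 1) : ℂ), by fun_prop⟩, fun x => ?_⟩
  simp only [ContinuousMap.coe_mk, tor, e2]

lemma coeff_eq {p : ℝ × ℝ → ℝ} (hp : Continuous p) {P : C(UnitAddTorus (Fin 2), ℂ)}
    (hP : ∀ x, P (tor x) = p (x 0, x 1)) (ξ : Fin 2 → ℤ) :
    mFourierCoeff P ξ = ⟨TI (fun z => Real.cos (ph ξ z) * p z),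
      - TI (fun z => Real.sin (ph ξ z) * p z)⟩ := by
  set g : ℝ × ℝ → ℂ := fun z => Complex.exp (-(ph ξ z * Complex.I)) * p z with hg
  have h1 : mFourierCoeff P ξ = ∫ z, g z ∂sq := by
    rw [mFourierCoeff_eq_integral P ξ 0, sq_eq]
    have hv := volume_preserving_finTwoArrow ℝ
    have := hv.setIntegral_preimage_emb (MeasurableEquiv.measurableEmbedding _) g
      (Set.Ioc (0:ℝ) 1 ×ˢ Set.Ioc (0:ℝ) 1)
    rw [← this]
    have hs : {x : Fin 2 → ℝ | ∀ i, x i ∈ Set.Ioc ((0 : Fin 2 → ℝ) i) ((0 : Fin 2 → ℝ) i + 1)} =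
        (MeasurableEquiv.finTwoArrow : (Fin 2 → ℝ) ≃ᵐ ℝ × ℝ) ⁻¹'
          (Set.Ioc (0:ℝ) 1 ×ˢ Set.Ioc (0:ℝ) 1) := by
      ext x
      simp [Fin.forall_fin_two, MeasurableEquiv.finTwoArrow]
    rw [hs]
    congr 1
    ext x
    change mFourier (-ξ) (tor x) • P (tor x) = g (x 0, x 1)
    rw [mF_tor, hP, smul_eq_mul, hg]
    simp only [ph_apply]
    congr 2
    simp
    ring
  have hgc : Continuous g := by
    have := (ph ξ).continuous
    fun_prop
  have hgi : Integrable g sq := by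
    rw [sq_eq]
    have h : IntegrableOn g (Set.Icc (0:ℝ) 1 ×ˢ Set.Icc (0:ℝ) 1) :=
      hgc.continuousOn.integrableOn_compact (isCompact_Icc.prod isCompact_Icc)
    exact h.mono_set (Set.prod_mono Set.Ioc_subset_Icc_self Set.Ioc_subset_Icc_self)
  have hre : ∀ z, g z = ⟨Real.cos (ph ξ z) * p z, -(Real.sin (ph ξ z) * p z)⟩ := by
    intro z
    have : -((ph ξ z : ℂ) * Complex.I) = ((-(ph ξ z) : ℝ) : ℂ) * Complex.I := by
      push_cast; ring
    apply Complex.ext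
    · simp only [hg, this]
      rw [Complex.re_mul_ofReal, Complex.exp_ofReal_mul_I_re, Real.cos_neg]
    · simp only [hg, this]
      rw [Complex.im_mul_ofReal, Complex.exp_ofReal_mul_I_im, Real.sin_neg]; ring
  rw [h1]
  apply Complex.ext
  · have := integral_re hgi
    simp only [RCLike.re_to_complex] at this
    rw [← this]
    simp only [hre, TI]
  · have := integral_im hgi
    simp only [RCLike.im_to_complex] at this
    rw [← this, ← TI_neg]
    simp only [hre, TI]

/-- Fourier coefficients are controlled by differences. -/
lemma char_diff {χ f : ℝ × ℝ → ℝ} {w : ℝ × ℝ} (hχ : Continuous χ) (hχp : Biperiodic χ)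
    (h1 : ∀ z, |χ z| ≤ 1) (hw : ∀ z, χ (z + w) = - χ z) (hf : Continuous f) (hfp : Biperiodic f)
    (n : ℕ) : 2 ^ n * |TI (fun z => χ z * f z)| ≤ TI (fun z => |dn w n f z|) := by
  have key : ∀ n, TI (fun z => χ z * dn w n f z) = (-2) ^ n * TI (fun z => χ z * f z) := by
    intro n
    induction n with
    | zero => simp [dn]
    | succ n ih =>
      have hc := dn_cont (w := w) hf n
      have hper := dn_per (w := w) hfp n
      have e : (fun z => χ z * dn w (n + 1) f z) = fun z =>
          (-1) * (χ (z + w) * dn w n f (z + w)) - χ z * dn w n f z := by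
        ext z; simp only [dn, dl, hw]; ring
      have hs := TI_shift (f := fun z => χ z * dn w n f z) (by fun_prop) (per_mul hχp hper) w
      rw [e, TI_sub (by fun_prop) (by fun_prop), TI_mul, hs, ih]
      ring
  have h2 := key n
  have : |TI (fun z => χ z * dn w n f z)| = 2 ^ n * |TI (fun z => χ z * f z)| := by
    rw [h2, abs_mul, abs_pow]; norm_num
  rw [← this]
  refine TI_abs_le.trans ?_
  have hc := dn_cont (w := w) hf n
  refine TI_mono (by fun_prop) (by fun_prop) fun z => ?_
  rw [abs_mul]
  exact mul_le_of_le_one_left (abs_nonneg _) (h1 z)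

lemma per_trig (g : ℝ → ℝ) (hg : Function.Periodic g (2 * Real.pi)) (ξ : Fin 2 → ℤ) :
    Biperiodic (fun z => g (ph ξ z)) := by
  intro x y
  have h1 := hg.int_mul (ξ 0) (ph ξ (x, y))
  have h2 := hg.int_mul (ξ 1) (ph ξ (x, y))
  constructor
  · change g (ph ξ (x + 1, y)) = g (ph ξ (x, y))
    rw [← h1]; congr 1; simp only [ph_apply]; ring
  · change g (ph ξ (x, y + 1)) = g (ph ξ (x, y))
    rw [← h2]; congr 1; simp only [ph_apply]; ring

lemma shift_vec {ξ : Fin 2 → ℤ} (hξ : ξ ≠ 0) :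
    ∃ w : ℝ × ℝ, ph ξ w = Real.pi ∧ ‖w‖ = (2 * ‖ξ‖)⁻¹ ∧ 1 ≤ ‖ξ‖ := by
  obtain ⟨i, hi⟩ : ∃ i, ‖ξ‖ = ‖ξ i‖ := by
    obtain ⟨i, hi⟩ := Finset.exists_max_image Finset.univ (fun i => ‖ξ i‖) ⟨0, Finset.mem_univ _⟩
    refine ⟨i, le_antisymm ?_ (norm_le_pi_norm _ _)⟩
    exact (pi_norm_le_iff_of_nonneg (norm_nonneg _)).2 fun j => hi.2 j (Finset.mem_univ _)
  have hi0 : ξ i ≠ 0 := by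
    intro h
    rw [h, norm_zero, norm_eq_zero] at hi
    exact hξ hi
  have hi1 : (ξ i : ℝ) ≠ 0 := by exact_mod_cast hi0
  have hn : ‖ξ‖ = |(ξ i : ℝ)| := by rw [hi, Int.norm_eq_abs]
  have h1 : 1 ≤ ‖ξ‖ := by
    rw [hn]
    exact_mod_cast Int.one_le_abs hi0
  have hnw : ‖(2 * (ξ i : ℝ))⁻¹‖ = (2 * ‖ξ‖)⁻¹ := by
    rw [hn, norm_inv, norm_mul, Real.norm_eq_abs, Real.norm_eq_abs, abs_two]
  fin_cases i
  · refine ⟨((2 * (ξ 0 : ℝ))⁻¹, 0), ?_, ?_, h1⟩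
    · simp only [ph_apply]
      simp only [Fin.zero_eta] at hi1
      field_simp
      simp
    · rw [Prod.norm_mk, norm_zero, max_eq_left (norm_nonneg _)]; exact hnw
  · refine ⟨(0, (2 * (ξ 1 : ℝ))⁻¹), ?_, ?_, h1⟩
    · simp only [ph_apply]
      simp only [Fin.mk_one] at hi1
      field_simp
      simp
    · rw [Prod.norm_mk, norm_zero, max_eq_right (norm_nonneg _)]; exact hnw

lemma ph_norm (ξ : Fin 2 → ℤ) : ‖ph ξ‖ ≤ 16 * ‖ξ‖ := by
  refine ContinuousLinearMap.opNorm_le_bound _ (by positivity) fun z => ?_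
  rw [ph_apply, Real.norm_eq_abs, abs_mul, abs_of_pos Real.two_pi_pos]
  have h0 : |(ξ 0 : ℝ)| ≤ ‖ξ‖ := by rw [← Int.norm_eq_abs]; exact norm_le_pi_norm _ _
  have h1 : |(ξ 1 : ℝ)| ≤ ‖ξ‖ := by rw [← Int.norm_eq_abs]; exact norm_le_pi_norm _ _
  have z0 : |z.1| ≤ ‖z‖ := norm_fst_le z
  have z1 : |z.2| ≤ ‖z‖ := norm_snd_le z
  have : |(ξ 0 : ℝ) * z.1 + ξ 1 * z.2| ≤ 2 * (‖ξ‖ * ‖z‖) := by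
    refine (abs_add_le _ _).trans ?_
    rw [abs_mul, abs_mul, two_mul]
    gcongr
  have hpi := Real.pi_le_four
  calc _ ≤ (2 * 4) * (2 * (‖ξ‖ * ‖z‖)) := by gcongr
    _ = _ := by ring

lemma trig_iter {g : ℝ → ℝ} (hg : ContDiff ℝ (⊤ : ℕ∞) g) (hb : ∀ n x, |iteratedDeriv n g x| ≤ 1)
    (ξ : Fin 2 → ℤ) (c : ℝ) (j : ℕ) (z : ℝ × ℝ) :
    ‖iteratedFDeriv ℝ j (fun z => c * g (ph ξ z)) z‖ ≤ |c| * (16 * ‖ξ‖) ^ j := by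
  have hgj : ContDiff ℝ j g := hg.of_le (by exact_mod_cast le_top)
  have h1 : ContDiff ℝ j (g ∘ ph ξ) := hgj.comp (ph ξ).contDiff
  have e : (fun z => c * g (ph ξ z)) = c • (g ∘ ph ξ) := by ext z; simp
  rw [e, iteratedFDeriv_const_smul_apply h1.contDiffAt, norm_smul, Real.norm_eq_abs]
  refine mul_le_mul_of_nonneg_left ?_ (abs_nonneg _)
  rw [(ph ξ).iteratedFDeriv_comp_right hgj z le_rfl]
  refine (ContinuousMultilinearMap.norm_compContinuousLinearMap_le _ _).trans ?_
  rw [norm_iteratedFDeriv_eq_norm_iteratedDeriv, Finset.prod_const, Finset.card_univ,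
    Fintype.card_fin, Real.norm_eq_abs]
  calc _ ≤ 1 * (16 * ‖ξ‖) ^ j := by gcongr; exacts [hb _ _, ph_norm ξ]
    _ = _ := one_mul _

/-- Majorant. -/
noncomputable def maj (D : ℕ → ℝ) (j : ℕ) (ξ : Fin 2 → ℤ) : ℝ :=
  2 * (D (j + 1)) * 16 ^ j * ‖ξ‖ ^ (-3 : ℝ)

lemma maj_summable (D : ℕ → ℝ) (j : ℕ) : Summable (maj D j) :=
  (EisensteinSeries.summable_one_div_norm_rpow (by norm_num)).mul_left _

lemma fourier_zero_mean {D : ℕ → ℝ} {p : ℝ × ℝ → ℝ} (hp : Continuous p) (hper : Biperiodic p)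
    (h0 : TI p = 0)
    (hd : ∀ n, ∀ w : ℝ × ℝ, 0 < ‖w‖ → TI (fun z => |dn w (n + 2) p z|) ≤ D n * ‖w‖ ^ (n + 2)) :
    ContDiff ℝ (⊤ : ℕ∞) p ∧ ∀ j : ℕ, ∀ z, ‖iteratedFDeriv ℝ j p z‖ ≤ ∑' ξ, maj D j ξ := by
  obtain ⟨P, hP⟩ := exists_lift hp hper
  have hD : ∀ n, 0 ≤ D n := by
    intro n
    have := (TI_nonneg fun z => abs_nonneg _).trans (hd n (1, 0) (by simp))
    simpa using this
  set A : (Fin 2 → ℤ) → ℝ := fun ξ => TI (fun z => Real.cos (ph ξ z) * p z) with hA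
  set B : (Fin 2 → ℤ) → ℝ := fun ξ => TI (fun z => Real.sin (ph ξ z) * p z) with hB
  have hc : ∀ ξ, mFourierCoeff P ξ = ⟨A ξ, - B ξ⟩ := coeff_eq hp hP
  -- decay
  have dec : ∀ (g : ℝ → ℝ), Continuous g → Function.Periodic g (2 * Real.pi) → (∀ x, |g x| ≤ 1) →
      (∀ x, g (x + Real.pi) = - g x) → ∀ ξ : Fin 2 → ℤ, ξ ≠ 0 → ∀ j,
      |TI (fun z => g (ph ξ z) * p z)| * (16 * ‖ξ‖) ^ j ≤ D (j + 1) * 16 ^ j * ‖ξ‖ ^ (-3 : ℝ) := by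
    intro g hgc hgp hg1 hga ξ hξ j
    obtain ⟨w, hw1, hw2, hw3⟩ := shift_vec hξ
    have hξ0 : 0 < ‖ξ‖ := by linarith
    have hgc' : Continuous (fun z => g (ph ξ z)) := hgc.comp (ph ξ).continuous
    have c1 := char_diff (χ := fun z => g (ph ξ z)) (w := w) hgc' (per_trig g hgp ξ)
      (fun z => hg1 _) (fun z => by simp only [map_add, hw1, hga]) hp hper (j + 1 + 2)
    have c2 := hd (j + 1) w (by rw [hw2]; positivity)
    have c3 := c1.trans c2
    have hDj := hD (j + 1)
    set T := |TI (fun z => g (ph ξ z) * p z)|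
    have hT : T ≤ D (j + 1) * (‖ξ‖ ^ (j + 3))⁻¹ := by
      have k1 : T ≤ 2 ^ (j + 1 + 2) * T := le_mul_of_one_le_left (abs_nonneg _)
        (one_le_pow₀ (by norm_num))
      refine k1.trans (c3.trans ?_)
      rw [hw2, inv_pow]
      refine mul_le_mul_of_nonneg_left ?_ hDj
      gcongr
      linarith
    have e3 : ‖ξ‖ ^ (-3 : ℝ) = (‖ξ‖ ^ 3)⁻¹ := by
      rw [Real.rpow_neg hξ0.le]; norm_cast
    rw [e3]
    calc _ ≤ D (j + 1) * (‖ξ‖ ^ (j + 3))⁻¹ * (16 * ‖ξ‖) ^ j := by gcongr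
      _ = _ := by rw [mul_pow, pow_add]; field_simp
  have decA : ∀ ξ j, |A ξ| * (16 * ‖ξ‖) ^ j ≤ D (j + 1) * 16 ^ j * ‖ξ‖ ^ (-3 : ℝ) := by
    intro ξ j
    by_cases hξ : ξ = 0
    · have : A ξ = 0 := by simp only [hA, ph_apply, hξ]; simpa using h0
      rw [this]; have := hD (j + 1); simp only [abs_zero, zero_mul]; positivity
    · exact dec Real.cos Real.continuous_cos Real.cos_periodic Real.abs_cos_le_one
        Real.cos_add_pi ξ hξ j
  have decB : ∀ ξ j, |B ξ| * (16 * ‖ξ‖) ^ j ≤ D (j + 1) * 16 ^ j * ‖ξ‖ ^ (-3 : ℝ) := by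
    intro ξ j
    by_cases hξ : ξ = 0
    · have : B ξ = 0 := by simp [hB, ph_apply, hξ, TI]
      rw [this]; have := hD (j + 1); simp only [abs_zero, zero_mul]; positivity
    · exact dec Real.sin Real.continuous_sin Real.sin_periodic Real.abs_sin_le_one
        Real.sin_add_pi ξ hξ j
  have hsum : Summable (mFourierCoeff P) := by
    refine Summable.of_norm_bounded (maj_summable D 0) fun ξ => ?_
    rw [hc]
    refine (Complex.norm_le_abs_re_add_abs_im _).trans ?_
    have a1 := decA ξ 0
    have b1 := decB ξ 0
    simp only [pow_zero, mul_one, zero_add, abs_neg, maj] at a1 b1 ⊢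
    linarith
  set f : (Fin 2 → ℤ) → ℝ × ℝ → ℝ :=
    fun ξ z => A ξ * Real.cos (ph ξ z) + B ξ * Real.sin (ph ξ z) with hf
  have hps : ∀ z, HasSum (fun ξ => f ξ z) (p z) := by
    intro z
    have h := hasSum_mFourier_series_apply_of_summable hsum (tor ![z.1, z.2])
    have h2 := Complex.hasSum_re h
    rw [hP] at h2
    simp only [mF_tor, hc, smul_eq_mul] at h2
    convert h2 using 1
    swap
    · simp
    ext ξ
    simp only [Complex.mul_re, Complex.exp_ofReal_mul_I_re, Complex.exp_ofReal_mul_I_im, hf]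
    simp
  have hpe : p = fun z => ∑' ξ, f ξ z := by ext z; exact ((hps z).tsum_eq).symm
  have cdc : ∀ ξ c, ContDiff ℝ (⊤ : ℕ∞) (fun z => c * Real.cos (ph ξ z)) := fun ξ c =>
    contDiff_const.mul (Real.contDiff_cos.comp (ph ξ).contDiff)
  have cds : ∀ ξ c, ContDiff ℝ (⊤ : ℕ∞) (fun z => c * Real.sin (ph ξ z)) := fun ξ c =>
    contDiff_const.mul (Real.contDiff_sin.comp (ph ξ).contDiff)
  have hfc : ∀ ξ, ContDiff ℝ (⊤ : ℕ∞) (f ξ) := fun ξ => (cdc ξ _).add (cds ξ _)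
  have hfb : ∀ (j : ℕ) (ξ : Fin 2 → ℤ) (z : ℝ × ℝ), (j : ℕ∞) ≤ ⊤ →
      ‖iteratedFDeriv ℝ j (f ξ) z‖ ≤ maj D j ξ := by
    intro j ξ z _
    have k1 : ContDiff ℝ j (fun z => A ξ * Real.cos (ph ξ z)) :=
      (cdc ξ _).of_le (by exact_mod_cast le_top)
    have k2 : ContDiff ℝ j (fun z => B ξ * Real.sin (ph ξ z)) :=
      (cds ξ _).of_le (by exact_mod_cast le_top)
    have e : f ξ = (fun z => A ξ * Real.cos (ph ξ z)) + (fun z => B ξ * Real.sin (ph ξ z)) := rfl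
    rw [e, iteratedFDeriv_add_apply k1.contDiffAt k2.contDiffAt]
    refine (norm_add_le _ _).trans ?_
    have a1 := (trig_iter Real.contDiff_cos Real.abs_iteratedDeriv_cos_le_one ξ (A ξ) j z).trans
      (decA ξ j)
    have b1 := (trig_iter Real.contDiff_sin Real.abs_iteratedDeriv_sin_le_one ξ (B ξ) j z).trans
      (decB ξ j)
    unfold maj
    linarith
  constructor
  · rw [hpe]
    exact contDiff_tsum (N := ⊤) hfc (fun k _ => maj_summable D k) hfb
  · intro j z
    rw [hpe, iteratedFDeriv_tsum_apply (N := ⊤) hfc (fun k _ => maj_summable D k) hfb le_top]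
    have hs : Summable fun ξ => ‖iteratedFDeriv ℝ j (f ξ) z‖ :=
      Summable.of_nonneg_of_le (fun _ => norm_nonneg _) (fun ξ => hfb j ξ z le_top)
        (maj_summable D j)
    refine (norm_tsum_le_tsum_norm hs).trans ?_
    exact hs.tsum_le_tsum (fun ξ => hfb j ξ z le_top) (maj_summable D j)

lemma fourier_reg {D : ℕ → ℝ} {p : ℝ × ℝ → ℝ} (hp : Continuous p) (hper : Biperiodic p)
    (hd : ∀ n, ∀ w : ℝ × ℝ, 0 < ‖w‖ → TI (fun z => |dn w (n + 2) p z|) ≤ D n * ‖w‖ ^ (n + 2)) :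
    ContDiff ℝ (⊤ : ℕ∞) p ∧ ∀ j : ℕ, ∀ z, ‖iteratedFDeriv ℝ j (fun w => p w - torusInt p) z‖ ≤
      ∑' ξ, maj D j ξ := by
  set q : ℝ × ℝ → ℝ := fun z => p z - torusInt p with hq
  have hqc : Continuous q := by fun_prop
  have hqp : Biperiodic q := per_sub hper (per_const _)
  have h0 : TI q = 0 := by
    rw [hq, TI_sub hp continuous_const, TI_const, TI_torusInt hp, sub_self]
  have hdq : ∀ w n, dn w (n + 2) q = dn w (n + 2) p := by
    intro w n
    have := dn_const w (torusInt p) (n + 2) (by omega)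
    ext z
    rw [hq, dn_sub, this]
    simp
  obtain ⟨h1, h2⟩ := fourier_zero_mean (D := D) hqc hqp h0 (by simpa only [hdq] using hd)
  refine ⟨?_, h2⟩
  have : p = fun z => q z + torusInt p := by ext z; simp [hq]
  rw [this]
  exact h1.add contDiff_const

end GMA

/-! ### Part H: gradient bound, qualitative smoothness -/

namespace GMA

lemma oned_half {g h : ℝ → ℝ} {κ κ0 K : ℝ} (hK : 0 ≤ K)
    (hg : ∀ x, HasDerivAt g (h x) x) (hκ : |κ| ≤ κ0) (hh : ∀ x, -K ≤ h x - κ * g x)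
    {s t r : ℝ} (hst : s ≤ t) (hs : |s - r| ≤ 1) (ht : |t - r| ≤ 1) (hts : t - s ≤ 1) :
    -(K * Real.exp κ0) ≤ Real.exp (-κ * (t - r)) * g t - Real.exp (-κ * (s - r)) * g s := by
  set C := K * Real.exp κ0 with hC
  have hC0 : 0 ≤ C := by positivity
  set E : ℝ → ℝ := fun x => Real.exp (-κ * (x - r)) * g x + C * x with hE
  have hder : ∀ x, HasDerivAt E (Real.exp (-κ * (x - r)) * (h x - κ * g x) + C) x := by
    intro x
    have h1 : HasDerivAt (fun x => -κ * (x - r)) (-κ) x := by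
      simpa using ((hasDerivAt_id x).sub_const r).const_mul (-κ)
    have h2 := (h1.exp.mul (hg x)).add ((hasDerivAt_id x).const_mul C)
    refine h2.congr_deriv ?_
    ring
  have hcont : Continuous E := continuous_iff_continuousAt.2 fun x => (hder x).continuousAt
  have hmono : MonotoneOn E (Set.Icc s t) := by
    refine monotoneOn_of_deriv_nonneg (convex_Icc s t) hcont.continuousOn
      (fun x _ => (hder x).differentiableAt.differentiableWithinAt) fun x hx => ?_
    rw [(hder x).deriv]
    rw [interior_Icc] at hx
    have hxr : |x - r| ≤ 1 := by
      rw [abs_le] at hs ht ⊢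
      constructor <;> linarith [hx.1, hx.2]
    have he : Real.exp (-κ * (x - r)) ≤ Real.exp κ0 := by
      rw [Real.exp_le_exp]
      refine (le_abs_self _).trans ?_
      rw [abs_mul, abs_neg]
      calc _ ≤ κ0 * 1 := by
            have := (abs_nonneg _).trans hκ
            gcongr
        _ = _ := mul_one _
    have h0 := Real.exp_pos (-κ * (x - r))
    have := mul_le_mul_of_nonneg_left (hh x) h0.le
    have := mul_le_mul_of_nonneg_left he hK
    nlinarith
  have := hmono (Set.left_mem_Icc.2 hst) (Set.right_mem_Icc.2 hst) hst
  simp only [hE] at this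
  nlinarith

lemma oned {f g h : ℝ → ℝ} {κ κ0 K : ℝ} (hK : 0 ≤ K) (hf : ∀ x, HasDerivAt f (g x) x)
    (hg : ∀ x, HasDerivAt g (h x) x) (hper : ∀ x, f (x + 1) = f x) (hgper : ∀ x, g (x + 1) = g x)
    (hκ : |κ| ≤ κ0) (hh : ∀ x, -K ≤ h x - κ * g x) (x : ℝ) : |g x| ≤ K * Real.exp κ0 := by
  have hcont : Continuous f := continuous_iff_continuousAt.2 fun x => (hf x).continuousAt
  obtain ⟨x0, hx0, h0⟩ := exists_hasDerivAt_eq_zero (f := f) (f' := g) (by linarith : x - 1 < x)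
    hcont.continuousOn (by rw [← hper (x - 1)]; simp) (fun y _ => hf y)
  obtain ⟨h1, h2⟩ := hx0
  have a1 := oned_half hK hg hκ hh (s := x0) (t := x) (r := x) h2.le
    (by rw [abs_le]; constructor <;> linarith) (by simp) (by linarith)
  have a2 := oned_half hK hg hκ hh (s := x) (t := x0 + 1) (r := x) (by linarith) (by simp)
    (by rw [abs_le]; constructor <;> linarith) (by linarith)
  rw [hgper, h0] at a2
  rw [h0] at a1
  simp at a1 a2
  rw [abs_le]; constructor <;> linarith

/-- Gradient constant. -/
noncomputable def gradC (Λ : ℝ) : ℝ :=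
  (Λ + Λ * (Λ * Real.exp Λ)) * Real.exp Λ + Λ * Real.exp Λ

lemma grad_bound {q : Cf} {G p : ℝ × ℝ → ℝ} {Λ : ℝ} (hΛ : 0 ≤ Λ) (hq : CfB q Λ) (hs : Sol q G p)
    (h1 : q.m11 * q.l22 = 0) : (∀ z, |pdx p z| ≤ gradC Λ) ∧ (∀ z, |pdy p z| ≤ gradC Λ) := by
  have hp := hs.cd
  have hd : Differentiable ℝ p := hp.differentiable two_ne_zero
  have hdx : Differentiable ℝ (pdx p) := (cpx hp).differentiable one_ne_zero
  have hdy : Differentiable ℝ (pdy p) := (cpy hp).differentiable one_ne_zero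
  have X : ∀ K, 0 ≤ K → (∀ z, -K ≤ pdx (pdx p) z - q.l11 * pdx p z) →
      ∀ z, |pdx p z| ≤ K * Real.exp Λ := by
    intro K hK h z
    exact oned (f := fun s => p (s, z.2)) (g := fun s => pdx p (s, z.2))
      (h := fun s => pdx (pdx p) (s, z.2)) hK (fun x => hasDerivAt_x hd x z.2)
      (fun x => hasDerivAt_x hdx x z.2) (fun x => (hs.per x z.2).1)
      (fun x => (per_pdx hs.per x z.2).1) hq.l11 (fun x => h _) z.1
  have Y : ∀ K, 0 ≤ K → (∀ z, -K ≤ pdy (pdy p) z - q.m22 * pdy p z) →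
      ∀ z, |pdy p z| ≤ K * Real.exp Λ := by
    intro K hK h z
    exact oned (f := fun s => p (z.1, s)) (g := fun s => pdy p (z.1, s))
      (h := fun s => pdy (pdy p) (z.1, s)) hK (fun y => hasDerivAt_y hd z.1 y)
      (fun y => hasDerivAt_y hdy z.1 y) (fun y => (hs.per z.1 y).2)
      (fun y => (per_pdy hs.per z.1 y).2) hq.m22 (fun y => h _) z.2
  have e0 := Real.exp_pos Λ
  have ha := abs_le.1 hq.a
  have hb := abs_le.1 hq.b
  have hc1 : Λ * Real.exp Λ ≤ gradC Λ := by
    unfold gradC; have : 0 ≤ (Λ + Λ * (Λ * Real.exp Λ)) * Real.exp Λ := by positivity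
    linarith
  have hc2 : (Λ + Λ * (Λ * Real.exp Λ)) * Real.exp Λ ≤ gradC Λ := by
    unfold gradC; have : 0 ≤ Λ * Real.exp Λ := by positivity
    linarith
  rcases mul_eq_zero.1 h1 with h | h
  · have k1 : ∀ z, |pdx p z| ≤ Λ * Real.exp Λ := X Λ hΛ fun z => by
      have := hs.pos1 z
      unfold u11 at this
      rw [h] at this
      linarith
    have k2 := Y (Λ + Λ * (Λ * Real.exp Λ)) (by positivity) fun z => by
      have := hs.pos2 z
      unfold u22 at this
      have h3 : |q.l22 * pdx p z| ≤ Λ * (Λ * Real.exp Λ) := by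
        rw [abs_mul]; exact mul_le_mul hq.l22 (k1 z) (abs_nonneg _) hΛ
      have := abs_le.1 h3
      linarith
    exact ⟨fun z => (k1 z).trans hc1, fun z => (k2 z).trans hc2⟩
  · have k1 : ∀ z, |pdy p z| ≤ Λ * Real.exp Λ := Y Λ hΛ fun z => by
      have := hs.pos2 z
      unfold u22 at this
      rw [h] at this
      linarith
    have k2 := X (Λ + Λ * (Λ * Real.exp Λ)) (by positivity) fun z => by
      have := hs.pos1 z
      unfold u11 at this
      have h3 : |q.m11 * pdy p z| ≤ Λ * (Λ * Real.exp Λ) := by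
        rw [abs_mul]; exact mul_le_mul hq.m11 (k1 z) (abs_nonneg _) hΛ
      have := abs_le.1 h3
      linarith
    exact ⟨fun z => (k2 z).trans hc2, fun z => (k1 z).trans hc1⟩

lemma exists_mod {f : ℝ × ℝ → ℝ} (hf : Continuous f) (hp : Biperiodic f) {ε : ℝ} (hε : 0 < ε) :
    ∃ δ, 0 < δ ∧ ∀ z v : ℝ × ℝ, ‖v‖ ≤ δ → |f (z + v) - f z| ≤ ε := by
  have hK : IsCompact (Set.Icc (-1:ℝ) 2 ×ˢ Set.Icc (-1:ℝ) 2) := isCompact_Icc.prod isCompact_Icc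
  have hu := hK.uniformContinuousOn_of_continuous hf.continuousOn
  rw [Metric.uniformContinuousOn_iff] at hu
  obtain ⟨δ, hδ, h⟩ := hu ε hε
  refine ⟨min (δ / 2) 1, by positivity, fun z v hv => ?_⟩
  obtain ⟨w, hw, he⟩ := per_reduce (dl_per (w := v) hp) z
  change |dl v f z| ≤ ε
  rw [he]
  have v1 : |v.1| ≤ 1 := (norm_fst_le v).trans (hv.trans (min_le_right _ _))
  have v2 : |v.2| ≤ 1 := (norm_snd_le v).trans (hv.trans (min_le_right _ _))
  rw [abs_le] at v1 v2
  obtain ⟨⟨a1, a2⟩, b1, b2⟩ := hw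
  have := h (w + v) ⟨⟨by simp; linarith, by simp; linarith⟩, by simp; linarith, by simp; linarith⟩ w
    ⟨⟨by linarith, by linarith⟩, by linarith, by linarith⟩ (by
      rw [dist_eq_norm, add_sub_cancel_left]
      have := hv.trans (min_le_left _ _); linarith)
  rw [Real.dist_eq] at this
  exact this.le

lemma exists_HB {q : Cf} {G p : ℝ × ℝ → ℝ} (hs : Sol q G p) :
    ∃ M σ, 0 ≤ M ∧ (∀ ε, 0 < ε → 0 < σ ε) ∧ HB q p M σ := by
  have hp := hs.cd
  obtain ⟨M1, n1, b1⟩ := per_bdd (ctx hp) (per_pdx hs.per)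
  obtain ⟨M2, n2, b2⟩ := per_bdd (cty hp) (per_pdy hs.per)
  obtain ⟨M3, n3, b3⟩ := per_bdd (ctxx hp) (per_pdx (per_pdx hs.per))
  obtain ⟨M4, n4, b4⟩ := per_bdd (ctxy hp) (per_pdy (per_pdx hs.per))
  obtain ⟨M5, n5, b5⟩ := per_bdd (ctyy hp) (per_pdy (per_pdy hs.per))
  obtain ⟨M6, n6, b6⟩ := per_bdd (cu11 q hp) (pu11 q hs.per)
  obtain ⟨M7, n7, b7⟩ := per_bdd (cu12 q hp) (pu12 q hs.per)
  obtain ⟨M8, n8, b8⟩ := per_bdd (cu22 q hp) (pu22 q hs.per)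
  have hσ : ∀ ε : ℝ, ∃ δ : ℝ, 0 < ε → (0 < δ ∧ ∀ z v : ℝ × ℝ, ‖v‖ ≤ δ →
      |u11 q p (z + v) - u11 q p z| ≤ ε ∧ |u12 q p (z + v) - u12 q p z| ≤ ε ∧
      |u22 q p (z + v) - u22 q p z| ≤ ε) := by
    intro ε
    by_cases hε : 0 < ε
    · obtain ⟨d1, p1, h1⟩ := exists_mod (cu11 q hp) (pu11 q hs.per) hε
      obtain ⟨d2, p2, h2⟩ := exists_mod (cu12 q hp) (pu12 q hs.per) hε
      obtain ⟨d3, p3, h3⟩ := exists_mod (cu22 q hp) (pu22 q hs.per) hε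
      refine ⟨min d1 (min d2 d3), fun _ => ⟨by positivity, fun z v hv => ?_⟩⟩
      simp only [le_min_iff] at hv
      exact ⟨h1 z v hv.1, h2 z v hv.2.1, h3 z v hv.2.2⟩
    · exact ⟨0, fun h => absurd h hε⟩
  choose σ hσ using hσ
  refine ⟨M1 + M2 + M3 + M4 + M5 + M6 + M7 + M8, σ, by positivity, fun ε hε => (hσ ε hε).1, ?_⟩
  refine ⟨fun z => (b1 z).trans (by linarith), fun z => (b2 z).trans (by linarith),
    fun z => (b3 z).trans (by linarith), fun z => (b4 z).trans (by linarith),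
    fun z => (b5 z).trans (by linarith), fun z => (b6 z).trans (by linarith),
    fun z => (b7 z).trans (by linarith), fun z => (b8 z).trans (by linarith),
    fun ε hε z v hv => ((hσ ε hε).2 z v hv).1, fun ε hε z v hv => ((hσ ε hε).2 z v hv).2.1,
    fun ε hε z v hv => ((hσ ε hε).2 z v hv).2.2⟩

/-- Quantitative regularity, given bounds for the Hessian and its modulus of continuity. -/
lemma reg_of_HB {M Λ g0 : ℝ} (hM : 0 ≤ M) (hΛ : 0 ≤ Λ) (hg0 : 0 < g0)
    {σ : ℝ → ℝ} (hσ : ∀ ε, 0 < ε → 0 < σ ε) (Γ : ℕ → ℝ) :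
    ∃ C : ℕ → ℝ, ∀ q G p, CfB q Λ → GB G g0 Γ → Sol q G p → HB q p M σ →
      ContDiff ℝ (⊤ : ℕ∞) p ∧
      ∀ j z, ‖iteratedFDeriv ℝ j (fun w => p w - torusInt p) z‖ ≤ C j := by
  choose D hD0 hD using fun n => diff_est hM hΛ hg0 hσ Γ n
  refine ⟨fun j => ∑' ξ, maj D j ξ, fun q G p hq hG hs hb => ?_⟩
  exact fourier_reg hs.cd.continuous hs.per fun n w hw => hD n q G p hq hG hs hb w hw

lemma smooth_of_sol {Λ g0 : ℝ} (hΛ : 0 ≤ Λ) (hg0 : 0 < g0) {Γ : ℕ → ℝ} {q : Cf}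
    {G p : ℝ × ℝ → ℝ} (hq : CfB q Λ) (hG : GB G g0 Γ) (hs : Sol q G p) :
    ContDiff ℝ (⊤ : ℕ∞) p := by
  obtain ⟨M, σ, hM, hσ, hb⟩ := exists_HB hs
  obtain ⟨C, hC⟩ := reg_of_HB hM hΛ hg0 hσ Γ
  exact (hC q G p hq hG hs hb).1

end GMA

/-! ### Part J: second derivative bound -/

namespace GMA

/-- Smooth functions. -/
def Sm (f : ℝ × ℝ → ℝ) : Prop := ContDiff ℝ (⊤ : ℕ∞) f

section
variable {f g : ℝ × ℝ → ℝ}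
lemma Sm.cd (hf : Sm f) (n : ℕ) : ContDiff ℝ n f := by
  have h : ContDiff ℝ (⊤ : ℕ∞) f := hf
  exact h.of_le (by exact_mod_cast le_top)
lemma Sm.c2 (hf : Sm f) : ContDiff ℝ 2 f := hf.cd 2
lemma Sm.c1 (hf : Sm f) : ContDiff ℝ 1 f := hf.cd 1
lemma Sm.d (hf : Sm f) : Differentiable ℝ f := hf.c1.differentiable (by norm_num)
lemma Sm.c (hf : Sm f) : Continuous f := hf.c1.continuous
lemma Sm.px (hf : Sm f) : Sm (pdx f) := cd_pdx (n := (⊤ : ℕ∞)) hf (by exact_mod_cast le_top)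
lemma Sm.py (hf : Sm f) : Sm (pdy f) := cd_pdy (n := (⊤ : ℕ∞)) hf (by exact_mod_cast le_top)
lemma Sm.add (hf : Sm f) (hg : Sm g) : Sm (fun z => f z + g z) := ContDiff.add hf hg
lemma Sm.sub (hf : Sm f) (hg : Sm g) : Sm (fun z => f z - g z) := ContDiff.sub hf hg
lemma Sm.mul (hf : Sm f) (hg : Sm g) : Sm (fun z => f z * g z) := ContDiff.mul hf hg
lemma Sm.cst (c : ℝ) : Sm (fun _ => c) := contDiff_const
lemma Sm.cm (c : ℝ) (hf : Sm f) : Sm (fun z => c * f z) := (Sm.cst c).mul hf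
end

/-- An abstract partial derivative. -/
structure Dv (D : (ℝ × ℝ → ℝ) → ℝ × ℝ → ℝ) : Prop where
  sm : ∀ {f}, Sm f → Sm (D f)
  add : ∀ {f g}, Sm f → Sm g → D (fun z => f z + g z) = fun z => D f z + D g z
  sub : ∀ {f g}, Sm f → Sm g → D (fun z => f z - g z) = fun z => D f z - D g z
  mul : ∀ {f g}, Sm f → Sm g → D (fun z => f z * g z) = fun z => f z * D g z + g z * D f z
  cm : ∀ {f} (c : ℝ), Sm f → D (fun z => c * f z) = fun z => c * D f z
  cst : ∀ c : ℝ, D (fun _ => c) = fun _ => 0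
  cx : ∀ {f}, Sm f → D (pdx f) = pdx (D f)
  cy : ∀ {f}, Sm f → D (pdy f) = pdy (D f)

lemma dvx : Dv pdx where
  sm h := h.px
  add h h' := pdx_add h.d h'.d
  sub h h' := pdx_sub h.d h'.d
  mul h h' := pdx_mul h.d h'.d
  cm c h := pdx_cmul c h.d
  cst c := pdx_const c
  cx _ := rfl
  cy h := pd_comm h.c2

lemma dvy : Dv pdy where
  sm h := h.py
  add h h' := pdy_add h.d h'.d
  sub h h' := pdy_sub h.d h'.d
  mul h h' := pdy_mul h.d h'.d
  cm c h := pdy_cmul c h.d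
  cst c := pdy_const c
  cx h := (pd_comm h.c2).symm
  cy _ := rfl

/-- Linear part of `u11`. -/
noncomputable def e11 (q : Cf) (v : ℝ × ℝ → ℝ) (z : ℝ × ℝ) : ℝ :=
  pdx (pdx v) z - q.l11 * pdx v z - q.m11 * pdy v z
/-- Linear part of `u12`. -/
noncomputable def e12 (q : Cf) (v : ℝ × ℝ → ℝ) (z : ℝ × ℝ) : ℝ :=
  pdy (pdx v) z - q.l12 * pdx v z - q.m12 * pdy v z
/-- Linear part of `u22`. -/
noncomputable def e22 (q : Cf) (v : ℝ × ℝ → ℝ) (z : ℝ × ℝ) : ℝ :=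
  pdy (pdy v) z - q.l22 * pdx v z - q.m22 * pdy v z
/-- Linearised operator. -/
noncomputable def Le (q : Cf) (p v : ℝ × ℝ → ℝ) (z : ℝ × ℝ) : ℝ :=
  u22 q p z * e11 q v z + u11 q p z * e22 q v z - 2 * (u12 q p z * e12 q v z)

section
variable {q : Cf} {p v w G : ℝ × ℝ → ℝ} {D D' : (ℝ × ℝ → ℝ) → ℝ × ℝ → ℝ}

lemma sm_e11 (hv : Sm v) : Sm (e11 q v) := (hv.px.px.sub (hv.px.cm _)).sub (hv.py.cm _)
lemma sm_e12 (hv : Sm v) : Sm (e12 q v) := (hv.px.py.sub (hv.px.cm _)).sub (hv.py.cm _)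
lemma sm_e22 (hv : Sm v) : Sm (e22 q v) := (hv.py.py.sub (hv.px.cm _)).sub (hv.py.cm _)
lemma u11_eq : u11 q p = fun z => q.a + e11 q p z := by ext z; simp only [u11, e11]; ring
lemma u12_eq : u12 q p = fun z => q.c + e12 q p z := by ext z; simp only [u12, e12]; ring
lemma u22_eq : u22 q p = fun z => q.b + e22 q p z := by ext z; simp only [u22, e22]; ring
lemma sm_u11 (hv : Sm p) : Sm (u11 q p) := by rw [u11_eq]; exact (Sm.cst _).add (sm_e11 hv)
lemma sm_u12 (hv : Sm p) : Sm (u12 q p) := by rw [u12_eq]; exact (Sm.cst _).add (sm_e12 hv)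
lemma sm_u22 (hv : Sm p) : Sm (u22 q p) := by rw [u22_eq]; exact (Sm.cst _).add (sm_e22 hv)

lemma D_lin3 (hD : Dv D) {f g h : ℝ × ℝ → ℝ} (hf : Sm f) (hg : Sm g) (hh : Sm h) (l m : ℝ) :
    D (fun z => f z - l * g z - m * h z) = fun z => D f z - l * D g z - m * D h z := by
  rw [hD.sub (hf.sub (hg.cm l)) (hh.cm m), hD.sub hf (hg.cm l), hD.cm l hg, hD.cm m hh]

lemma D_e11 (hD : Dv D) (hv : Sm v) : D (e11 q v) = e11 q (D v) := by
  have := D_lin3 hD hv.px.px hv.px hv.py q.l11 q.m11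
  rw [hD.cx hv.px, hD.cx hv, hD.cy hv] at this
  exact this
lemma D_e12 (hD : Dv D) (hv : Sm v) : D (e12 q v) = e12 q (D v) := by
  have := D_lin3 hD hv.px.py hv.px hv.py q.l12 q.m12
  rw [hD.cy hv.px, hD.cx hv, hD.cy hv] at this
  exact this
lemma D_e22 (hD : Dv D) (hv : Sm v) : D (e22 q v) = e22 q (D v) := by
  have := D_lin3 hD hv.py.py hv.px hv.py q.l22 q.m22
  rw [hD.cy hv.py, hD.cx hv, hD.cy hv] at this
  exact this
lemma D_u11 (hD : Dv D) (hv : Sm p) : D (u11 q p) = e11 q (D p) := by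
  rw [u11_eq, hD.add (Sm.cst _) (sm_e11 hv), hD.cst, D_e11 hD hv]; simp
lemma D_u12 (hD : Dv D) (hv : Sm p) : D (u12 q p) = e12 q (D p) := by
  rw [u12_eq, hD.add (Sm.cst _) (sm_e12 hv), hD.cst, D_e12 hD hv]; simp
lemma D_u22 (hD : Dv D) (hv : Sm p) : D (u22 q p) = e22 q (D p) := by
  rw [u22_eq, hD.add (Sm.cst _) (sm_e22 hv), hD.cst, D_e22 hD hv]; simp

lemma Le_D (hD : Dv D) (hs : Sol q G p) (hp : Sm p) : Le q p (D p) = D G := by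
  have hG : G = fun z => u11 q p z * u22 q p z - u12 q p z * u12 q p z := by
    ext z; rw [← hs.eq z]; ring
  rw [hG, hD.sub ((sm_u11 hp).mul (sm_u22 hp)) ((sm_u12 hp).mul (sm_u12 hp)),
    hD.mul (sm_u11 hp) (sm_u22 hp), hD.mul (sm_u12 hp) (sm_u12 hp), D_u11 hD hp, D_u12 hD hp,
    D_u22 hD hp]
  ext z; simp only [Le]; ring

lemma Le_DD (hD : Dv D) (hD' : Dv D') (hs : Sol q G p) (hp : Sm p) (z : ℝ × ℝ) :
    Le q p (D' (D p)) z + (e22 q (D' p) z * e11 q (D p) z + e11 q (D' p) z * e22 q (D p) z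
      - 2 * (e12 q (D' p) z * e12 q (D p) z)) = D' (D G) z := by
  have hp1 := hD.sm hp
  have h := Le_D hD hs hp
  rw [← h]
  have h11 := (sm_u22 (q := q) hp).mul (sm_e11 (q := q) hp1)
  have h22 := (sm_u11 (q := q) hp).mul (sm_e22 (q := q) hp1)
  have h12 := (sm_u12 (q := q) hp).mul (sm_e12 (q := q) hp1)
  have : D' (Le q p (D p)) = D' (fun z => u22 q p z * e11 q (D p) z + u11 q p z * e22 q (D p) z
    - 2 * (u12 q p z * e12 q (D p) z)) := rfl
  rw [this, hD'.sub (h11.add h22) (h12.cm 2), hD'.add h11 h22, hD'.cm 2 h12,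
    hD'.mul (sm_u22 hp) (sm_e11 hp1), hD'.mul (sm_u11 hp) (sm_e22 hp1),
    hD'.mul (sm_u12 hp) (sm_e12 hp1), D_u11 hD' hp, D_u12 hD' hp, D_u22 hD' hp,
    D_e11 hD' hp1, D_e12 hD' hp1, D_e22 hD' hp1]
  simp only [Le]; ring

lemma Le_add (hv : Sm v) (hw : Sm w) (z : ℝ × ℝ) :
    Le q p (fun z => v z + w z) z = Le q p v z + Le q p w z := by
  simp only [Le, e11, e12, e22, pdx_add hv.d hw.d, pdy_add hv.d hw.d, pdx_add hv.px.d hw.px.d,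
    pdy_add hv.px.d hw.px.d, pdy_add hv.py.d hw.py.d]
  ring

lemma Le_sq (hv : Sm v) (z : ℝ × ℝ) :
    Le q p (fun z => v z * v z) z = 2 * v z * Le q p v z + 2 * (u22 q p z * pdx v z ^ 2
      + u11 q p z * pdy v z ^ 2 - 2 * u12 q p z * (pdx v z * pdy v z)) := by
  have hx := hv.mul hv.px
  have hy := hv.mul hv.py
  have h1 : pdx (fun z => v z * v z) = fun z => v z * pdx v z + v z * pdx v z := pdx_mul hv.d hv.d
  have h2 : pdy (fun z => v z * v z) = fun z => v z * pdy v z + v z * pdy v z := pdy_mul hv.d hv.d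
  simp only [Le, e11, e12, e22, h1, h2, pdx_add hx.d hx.d, pdy_add hx.d hx.d, pdy_add hy.d hy.d,
    pdx_mul hv.d hv.px.d, pdy_mul hv.d hv.px.d, pdy_mul hv.d hv.py.d]
  ring

lemma Le_cm (hv : Sm v) (c : ℝ) (z : ℝ × ℝ) :
    Le q p (fun z => c * v z) z = c * Le q p v z := by
  simp only [Le, e11, e12, e22, pdx_cmul c hv.d, pdy_cmul c hv.d, pdx_cmul c hv.px.d,
    pdy_cmul c hv.px.d, pdy_cmul c hv.py.d]
  ring

lemma det_le {u11 u12 u22 x11 x12 x22 G B : ℝ} (h1 : 0 < u11) (hG : 0 < G)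
    (hd : u11 * u22 - u12 ^ 2 = G) (hB : u22 * x11 + u11 * x22 - 2 * (u12 * x12) = B) :
    2 * (x11 * x22 - x12 ^ 2) ≤ B ^ 2 / (2 * G) := by
  have hQ : u11 * B = G * x11 + (u12 ^ 2 * x11 + u11 ^ 2 * x22 - 2 * u11 * u12 * x12) := by
    rw [← hB, ← hd]; ring
  set Q := u12 ^ 2 * x11 + u11 ^ 2 * x22 - 2 * u11 * u12 * x12 with hQd
  have h3 : u11 ^ 2 * (x11 * x22 - x12 ^ 2) = x11 * Q - (u11 * x12 - u12 * x11) ^ 2 := by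
    rw [hQd]; ring
  have h4 : u11 ^ 2 * (4 * G * (x11 * x22 - x12 ^ 2)) ≤ u11 ^ 2 * B ^ 2 := by
    have : u11 ^ 2 * B ^ 2 = (u11 * B) ^ 2 := by ring
    rw [this, hQ]
    have : u11 ^ 2 * (4 * G * (x11 * x22 - x12 ^ 2)) = 4 * G * (u11 ^ 2 * (x11 * x22 - x12 ^ 2)) := by
      ring
    rw [this, h3]
    nlinarith [sq_nonneg (G * x11 - Q), mul_nonneg hG.le (sq_nonneg (u11 * x12 - u12 * x11))]
  have h5 := le_of_mul_le_mul_left h4 (by positivity)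
  rw [le_div_iff₀ (by positivity)]
  linarith

lemma Le_DD_ge (hD : Dv D) (hs : Sol q G p) (hp : Sm p) (hG : ∀ z, 0 < G z) (z : ℝ × ℝ) :
    D (D G) z - (D G z) ^ 2 / (2 * G z) ≤ Le q p (D (D p)) z := by
  have h1 := Le_DD hD hD hs hp z
  have h2 := congrFun (Le_D hD hs hp) z
  have h3 := det_le (hs.pos1 z) (hG z) (hs.eq z) h2
  nlinarith

end

lemma max_hess {f : ℝ × ℝ → ℝ} (hf : Sm f) {w : ℝ × ℝ} (hm : IsLocalMax f w) :
    pdx f w = 0 ∧ pdy f w = 0 ∧ ∀ v1 v2 : ℝ, v1 ^ 2 * pdx (pdx f) w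
      + 2 * (v1 * v2) * pdy (pdx f) w + v2 ^ 2 * pdy (pdy f) w ≤ 0 := by
  have h0 := hm.fderiv_eq_zero
  have hx : pdx f w = 0 := by simp [pdx, h0]
  have hy : pdy f w = 0 := by simp [pdy, h0]
  refine ⟨hx, hy, fun v1 v2 => ?_⟩
  by_contra hcon
  push Not at hcon
  set g : ℝ → ℝ := fun s => f (w + s • (v1, v2)) with hg
  have hd : deriv g = fun s => v1 * pdx f (w + s • (v1, v2)) + v2 * pdy f (w + s • (v1, v2)) := by
    ext s; exact (hasDerivAt_line hf.d w (v1, v2) s).deriv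
  have hdd : deriv (deriv g) 0 = v1 ^ 2 * pdx (pdx f) w
      + 2 * (v1 * v2) * pdy (pdx f) w + v2 ^ 2 * pdy (pdy f) w := by
    rw [hd]
    have h1 := ((hasDerivAt_line hf.px.d w (v1, v2) 0).const_mul v1).add
      ((hasDerivAt_line hf.py.d w (v1, v2) 0).const_mul v2)
    have h2 := h1.deriv
    simp only [zero_smul, add_zero, pd_comm hf.c2] at h2
    refine Eq.trans h2 ?_
    ring
  have hd0 : deriv g 0 = 0 := by rw [hd]; simp [hx, hy]
  have hc : ContinuousAt g 0 := by
    have := hf.c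
    exact Continuous.continuousAt (by rw [hg]; fun_prop)
  have hl : Filter.Tendsto (fun s : ℝ => w + s • (v1, v2)) (nhds 0) (nhds w) := by
    have : Continuous (fun s : ℝ => w + s • (v1, v2)) := by fun_prop
    have := this.tendsto 0
    simpa only [zero_smul, add_zero] using this
  have hmin := isLocalMin_of_deriv_deriv_pos (by rw [hdd]; exact hcon) hd0 hc
  have heq : g =ᶠ[nhds 0] fun _ => g 0 := by
    filter_upwards [hmin, hl.eventually hm] with s hs this
    refine le_antisymm ?_ hs
    simp only [hg, zero_smul, add_zero]
    exact this
  have h2 := heq.deriv.deriv_eq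
  rw [hdd] at h2
  simp at h2
  linarith

lemma Le_max {q : Cf} {G p f : ℝ × ℝ → ℝ} (hs : Sol q G p) (hG : ∀ z, 0 < G z) (hf : Sm f)
    {w : ℝ × ℝ} (hw : IsLocalMax f w) : Le q p f w ≤ 0 := by
  obtain ⟨hx, hy, h⟩ := max_hess hf hw
  have h1 := h 1 0
  have h2 := h (-u12 q p w) (u11 q p w)
  have h3 := hs.eq w
  have h4 := hs.pos1 w
  have h5 := hG w
  have : u11 q p w * Le q p f w ≤ 0 := by
    have : u11 q p w * Le q p f w = G w * (1 ^ 2 * pdx (pdx f) w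
      + 2 * (1 * 0) * pdy (pdx f) w + 0 ^ 2 * pdy (pdy f) w) + ((-u12 q p w) ^ 2 * pdx (pdx f) w
      + 2 * (-u12 q p w * u11 q p w) * pdy (pdx f) w + u11 q p w ^ 2 * pdy (pdy f) w) := by
      rw [← h3]; simp only [Le, e11, e12, e22, hx, hy]; ring
    rw [this]
    nlinarith [mul_nonneg h5.le (neg_nonneg.2 h1)]
  by_contra hc
  push Not at hc
  nlinarith [mul_pos h4 hc]

lemma trace_alg {u11 u12 u22 b11 b12 b22 G : ℝ} (h1 : 0 < u11) (hG : 0 < G)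
    (hd : u11 * u22 - u12 ^ 2 = G) :
    G * (u11 + u22) - 2 * G * (b11 + b22) ≤
      (u22 * (u11 - b11) ^ 2 + u11 * (u12 - b12) ^ 2 - 2 * u12 * ((u11 - b11) * (u12 - b12)))
      + (u22 * (u12 - b12) ^ 2 + u11 * (u22 - b22) ^ 2 - 2 * u12 * ((u12 - b12) * (u22 - b22))) := by
  have hq : ∀ x y : ℝ, 0 ≤ u22 * x ^ 2 + u11 * y ^ 2 - 2 * u12 * (x * y) := by
    intro x y
    have : u11 * (u22 * x ^ 2 + u11 * y ^ 2 - 2 * u12 * (x * y)) = G * x ^ 2 + (u12 * x - u11 * y) ^ 2 := by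
      rw [← hd]; ring
    have h2 : 0 ≤ u11 * (u22 * x ^ 2 + u11 * y ^ 2 - 2 * u12 * (x * y)) := by rw [this]; positivity
    exact nonneg_of_mul_nonneg_right h2 h1
  have := hq b11 b12
  have := hq b12 b22
  have e : (u22 * (u11 - b11) ^ 2 + u11 * (u12 - b12) ^ 2 - 2 * u12 * ((u11 - b11) * (u12 - b12)))
      + (u22 * (u12 - b12) ^ 2 + u11 * (u22 - b22) ^ 2 - 2 * u12 * ((u12 - b12) * (u22 - b22)))
      = G * (u11 + u22) - 2 * G * (b11 + b22) + (u22 * b11 ^ 2 + u11 * b12 ^ 2 - 2 * u12 * (b11 * b12))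
      + (u22 * b12 ^ 2 + u11 * b22 ^ 2 - 2 * u12 * (b12 * b22)) := by
    rw [← hd]; ring
  linarith

/-- Derivative bounds for the right-hand side. -/
structure GC (G : ℝ × ℝ → ℝ) (γ : ℝ) : Prop where
  x : ∀ z, |pdx G z| ≤ γ
  y : ∀ z, |pdy G z| ≤ γ
  xx : ∀ z, |pdx (pdx G) z| ≤ γ
  xy : ∀ z, |pdy (pdx G) z| ≤ γ
  yy : ∀ z, |pdy (pdy G) z| ≤ γ

/-- Bounds for the Hessian, without modulus. -/
structure HM (q : Cf) (p : ℝ × ℝ → ℝ) (M : ℝ) : Prop where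
  px : ∀ z, |pdx p z| ≤ M
  py : ∀ z, |pdy p z| ≤ M
  pxx : ∀ z, |pdx (pdx p) z| ≤ M
  pxy : ∀ z, |pdy (pdx p) z| ≤ M
  pyy : ∀ z, |pdy (pdy p) z| ≤ M
  b11 : ∀ z, |u11 q p z| ≤ M
  b12 : ∀ z, |u12 q p z| ≤ M
  b22 : ∀ z, |u22 q p z| ≤ M

lemma abs3 {a b c Λ P l m x y : ℝ} (hP : 0 ≤ P) (hΛ : 0 ≤ Λ) (ha : |a| ≤ Λ) (hl : |l| ≤ Λ) (hm : |m| ≤ Λ)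
    (hx : |x| ≤ P) (hy : |y| ≤ P) : |a - l * x - m * y| ≤ Λ + 2 * (Λ * P) := by
  have h1 : |l * x| ≤ Λ * P := by rw [abs_mul]; gcongr
  have h2 : |m * y| ≤ Λ * P := by rw [abs_mul]; gcongr
  rw [abs_le] at *
  constructor <;> linarith [h1.1, h1.2, h2.1, h2.2, ha.1, ha.2]

set_option maxHeartbeats 1000000 in
theorem c2_bound {Λ g0 γ : ℝ} (hΛ : 0 ≤ Λ) (hg0 : 0 < g0) (hγ : 0 ≤ γ) :
    ∃ M, 0 < M ∧ ∀ q G p, CfB q Λ → Sm G → (∀ z, g0 ≤ G z) → GC G γ → q.m11 * q.l22 = 0 →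
      Sol q G p → Sm p → HM q p M := by
  set P := |gradC Λ| with hP
  have hP0 : 0 ≤ P := abs_nonneg _
  set β := Λ + 2 * (Λ * P) with hβ
  have hβ0 : 0 ≤ β := by positivity
  set K := 2 * γ + γ ^ 2 / g0 + 2 * (P * γ) with hK
  have hK0 : 0 ≤ K := by positivity
  set T := 4 * β + K / g0 with hT
  have hT0 : 0 ≤ T := by positivity
  -- bound of the trace everywhere
  set T' := T + 4 * β + P ^ 2 with hT'
  refine ⟨T' + β + P + 1, by positivity, fun q G p hq hGs hG hGC hml hs hp => ?_⟩
  obtain ⟨gx, gy⟩ := grad_bound hΛ hq hs hml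
  have gx : ∀ z, |pdx p z| ≤ P := fun z => (gx z).trans (le_abs_self _)
  have gy : ∀ z, |pdy p z| ≤ P := fun z => (gy z).trans (le_abs_self _)
  have hGp : ∀ z, 0 < G z := fun z => hg0.trans_le (hG z)
  set B11 : ℝ × ℝ → ℝ := fun z => q.a - q.l11 * pdx p z - q.m11 * pdy p z with hB11
  set B12 : ℝ × ℝ → ℝ := fun z => q.c - q.l12 * pdx p z - q.m12 * pdy p z with hB12
  set B22 : ℝ × ℝ → ℝ := fun z => q.b - q.l22 * pdx p z - q.m22 * pdy p z with hB22
  have b11 : ∀ z, |B11 z| ≤ β := fun z => abs3 (b := 0) (c := 0) hP0 hΛ hq.a hq.l11 hq.m11 (gx z) (gy z)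
  have b12 : ∀ z, |B12 z| ≤ β := fun z => abs3 (b := 0) (c := 0) hP0 hΛ hq.c hq.l12 hq.m12 (gx z) (gy z)
  have b22 : ∀ z, |B22 z| ≤ β := fun z => abs3 (b := 0) (c := 0) hP0 hΛ hq.b hq.l22 hq.m22 (gx z) (gy z)
  have e11' : ∀ z, pdx (pdx p) z = u11 q p z - B11 z := fun z => by simp only [u11, hB11]; ring
  have e12' : ∀ z, pdy (pdx p) z = u12 q p z - B12 z := fun z => by simp only [u12, hB12]; ring
  have e22' : ∀ z, pdy (pdy p) z = u22 q p z - B22 z := fun z => by simp only [u22, hB22]; ring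
  set f : ℝ × ℝ → ℝ := fun z => (pdx (pdx p) z + pdy (pdy p) z)
    + 1 / 2 * (pdx p z * pdx p z + pdy p z * pdy p z) with hf
  have s1 := hp.px.px.add hp.py.py
  have s2 := hp.px.mul hp.px
  have s3 := hp.py.mul hp.py
  have hfs : Sm f := s1.add ((s2.add s3).cm _)
  have hfp : Biperiodic f := by
    have h1 := per_pdx hs.per
    have h2 := per_pdy hs.per
    exact per_add (per_add (per_pdx h1) (per_pdy h2))
      (per_cmul _ (per_add (per_mul h1 h1) (per_mul h2 h2)))
  obtain ⟨w, hw⟩ := per_exists_max hfs.c hfp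
  have hL := Le_max hs hGp hfs (Filter.Eventually.of_forall hw)
  rw [hf, Le_add s1 ((s2.add s3).cm _), Le_add hp.px.px hp.py.py, Le_cm (s2.add s3), Le_add s2 s3,
    Le_sq hp.px, Le_sq hp.py, congrFun (Le_D dvx hs hp) w, congrFun (Le_D dvy hs hp) w,
    pd_comm hp.c2] at hL
  have hx2 := Le_DD_ge dvx hs hp hGp w
  have hy2 := Le_DD_ge dvy hs hp hGp w
  have htr := trace_alg (b11 := B11 w) (b12 := B12 w) (b22 := B22 w) (hs.pos1 w) (hGp w) (hs.eq w)
  rw [e11', e12', e22'] at hL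
  have q1 : ∀ g, |g| ≤ γ → g ^ 2 / (2 * G w) ≤ γ ^ 2 / (2 * g0) := by
    intro g hg
    have : g ^ 2 ≤ γ ^ 2 := sq_le_sq' (abs_le.1 hg).1 (abs_le.1 hg).2
    have := hG w
    gcongr
  have q2 := q1 _ (hGC.x w)
  have q3 := q1 _ (hGC.y w)
  have q4 : |pdx p w * pdx G w| ≤ P * γ := by
    rw [abs_mul]; gcongr; exacts [gx w, hGC.x w]
  have q5 : |pdy p w * pdy G w| ≤ P * γ := by
    rw [abs_mul]; gcongr; exacts [gy w, hGC.y w]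
  have q6 := hGC.xx w
  have q7 := hGC.yy w
  have hKK : G w * (u11 q p w + u22 q p w) ≤ 2 * G w * (B11 w + B22 w) + K := by
    have : γ ^ 2 / g0 = 2 * (γ ^ 2 / (2 * g0)) := by field_simp
    rw [hK, this]
    rw [abs_le] at q4 q5 q6 q7
    linarith [q4.1, q5.1, q6.1, q7.1]
  have hTw : u11 q p w + u22 q p w ≤ T := by
    have h1 : u11 q p w + u22 q p w ≤ 2 * (B11 w + B22 w) + K / G w := by
      have hg := hGp w
      have : K = G w * (K / G w) := by field_simp
      rw [this] at hKK
      refine le_of_mul_le_mul_left (a := G w) ?_ hg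
      linarith
    have h2 : K / G w ≤ K / g0 := by have := hG w; gcongr
    have := (abs_le.1 (b11 w)).2
    have := (abs_le.1 (b22 w)).2
    linarith
  have hfw : f w ≤ T + 2 * β + P ^ 2 := by
    have h1 : pdx p w * pdx p w ≤ P ^ 2 := by
      rw [← pow_two]; exact sq_le_sq' (abs_le.1 (gx w)).1 (abs_le.1 (gx w)).2
    have h2 : pdy p w * pdy p w ≤ P ^ 2 := by
      rw [← pow_two]; exact sq_le_sq' (abs_le.1 (gy w)).1 (abs_le.1 (gy w)).2
    have := (abs_le.1 (b11 w)).1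
    have := (abs_le.1 (b22 w)).1
    simp only [hf, e11', e22']
    linarith
  have hTz : ∀ z, u11 q p z + u22 q p z ≤ T' := by
    intro z
    have h := (hw z).trans hfw
    have := (abs_le.1 (b11 z)).2
    have := (abs_le.1 (b22 z)).2
    simp only [hf, e11', e22'] at h
    linarith [mul_self_nonneg (pdx p z), mul_self_nonneg (pdy p z)]
  have c11 : ∀ z, |u11 q p z| ≤ T' := fun z => by
    rw [abs_of_pos (hs.pos1 z)]; linarith [hTz z, hs.pos2 z]
  have c22 : ∀ z, |u22 q p z| ≤ T' := fun z => by
    rw [abs_of_pos (hs.pos2 z)]; linarith [hTz z, hs.pos1 z]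
  have hT'0 : 0 ≤ T' := by positivity
  have c12 : ∀ z, |u12 q p z| ≤ T' := fun z => by
    have h1 := hs.pos1 z
    have h2 := hs.pos2 z
    have h3 := hTz z
    have h4 := hs.eq z
    have h5 := hGp z
    refine abs_le_of_sq_le_sq (b := T') ?_ hT'0
    have : (u11 q p z + u22 q p z) ^ 2 ≤ T' ^ 2 := by gcongr
    nlinarith [mul_pos h1 h2]
  have cc : ∀ {u b : ℝ}, |u| ≤ T' → |b| ≤ β → |u - b| ≤ T' + β + P + 1 := by
    intro u b h1 h2
    exact (abs_sub _ _).trans (by linarith)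
  exact
  { px := fun z => (gx z).trans (by linarith)
    py := fun z => (gy z).trans (by linarith)
    pxx := fun z => by rw [e11']; exact cc (c11 z) (b11 z)
    pxy := fun z => by rw [e12']; exact cc (c12 z) (b12 z)
    pyy := fun z => by rw [e22']; exact cc (c22 z) (b22 z)
    b11 := fun z => (c11 z).trans (by linarith)
    b12 := fun z => (c12 z).trans (by linarith)
    b22 := fun z => (c22 z).trans (by linarith) }

end GMA

/-! ### Part K: energy bound and choice of a good scale -/

namespace GMA

/-- Squared third derivatives (as gradients of the second derivatives). -/
noncomputable def Sq (p : ℝ × ℝ → ℝ) (z : ℝ × ℝ) : ℝ :=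
  (pdx (pdx (pdx p)) z ^ 2 + 2 * pdy (pdx (pdx p)) z ^ 2 + pdy (pdy (pdx p)) z ^ 2)
  + (pdx (pdx (pdy p)) z ^ 2 + 2 * pdy (pdx (pdy p)) z ^ 2 + pdy (pdy (pdy p)) z ^ 2)

lemma Sq_cont {p : ℝ × ℝ → ℝ} (hp : Sm p) : Continuous (Sq p) := by
  have h1 := hp.px.px.px.c
  have h2 := hp.px.px.py.c
  have h3 := hp.px.py.py.c
  have h4 := hp.py.px.px.c
  have h5 := hp.py.px.py.c
  have h6 := hp.py.py.py.c
  unfold Sq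
  fun_prop

lemma Sq_per {p : ℝ × ℝ → ℝ} (hp : Biperiodic p) : Biperiodic (Sq p) := by
  have h1 := per_pdx (per_pdx (per_pdx hp))
  have h2 := per_pdy (per_pdx (per_pdx hp))
  have h3 := per_pdy (per_pdy (per_pdx hp))
  have h4 := per_pdx (per_pdx (per_pdy hp))
  have h5 := per_pdy (per_pdx (per_pdy hp))
  have h6 := per_pdy (per_pdy (per_pdy hp))
  exact per_add (per_add (per_add (per_comp h1 (fun x => x ^ 2)) (per_comp h2 (fun x => 2 * x ^ 2)))
      (per_comp h3 (fun x => x ^ 2)))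
    (per_add (per_add (per_comp h4 (fun x => x ^ 2)) (per_comp h5 (fun x => 2 * x ^ 2)))
      (per_comp h6 (fun x => x ^ 2)))

lemma Sq_nonneg (p : ℝ × ℝ → ℝ) (z : ℝ × ℝ) : 0 ≤ Sq p z := by unfold Sq; positivity

lemma Sq_le {p : ℝ × ℝ → ℝ} (hp : Sm p) (z : ℝ × ℝ) :
    (pdx (pdx (pdx p)) z ^ 2 ≤ Sq p z ∧ pdy (pdx (pdx p)) z ^ 2 ≤ Sq p z) ∧
    (pdx (pdy (pdx p)) z ^ 2 ≤ Sq p z ∧ pdy (pdy (pdx p)) z ^ 2 ≤ Sq p z) ∧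
    (pdx (pdy (pdy p)) z ^ 2 ≤ Sq p z ∧ pdy (pdy (pdy p)) z ^ 2 ≤ Sq p z) := by
  have e1 : pdx (pdy (pdx p)) = pdy (pdx (pdx p)) := pd_comm hp.px.c2
  have e2 : pdx (pdy (pdy p)) = pdy (pdx (pdy p)) := pd_comm hp.py.c2
  rw [e1, e2]
  have h1 := sq_nonneg (pdx (pdx (pdx p)) z)
  have h2 := sq_nonneg (pdy (pdx (pdx p)) z)
  have h3 := sq_nonneg (pdy (pdy (pdx p)) z)
  have h4 := sq_nonneg (pdx (pdx (pdy p)) z)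
  have h5 := sq_nonneg (pdy (pdx (pdy p)) z)
  have h6 := sq_nonneg (pdy (pdy (pdy p)) z)
  unfold Sq
  refine ⟨⟨?_, ?_⟩, ⟨?_, ?_⟩, ⟨?_, ?_⟩⟩ <;> linarith

lemma main_bdd {u11 u12 u22 M Λ γ x y g X11 X12 X22 l11 l12 l22 m11 m12 m22 : ℝ} (hM : 0 ≤ M)
    (hΛ : 0 ≤ Λ)
    (h11 : |u11| ≤ M) (h12 : |u12| ≤ M) (h22 : |u22| ≤ M) (hx : |x| ≤ M) (hy : |y| ≤ M)
    (a1 : |l11| ≤ Λ) (a2 : |l12| ≤ Λ) (a3 : |l22| ≤ Λ) (a4 : |m11| ≤ Λ) (a5 : |m12| ≤ Λ)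
    (a6 : |m22| ≤ Λ) (hg : |g| ≤ γ)
    (h : u22 * (X11 - l11 * x - m11 * y) + u11 * (X22 - l22 * x - m22 * y)
      - 2 * (u12 * (X12 - l12 * x - m12 * y)) = g) :
    (X11 * u22 + X22 * u11 - 2 * X12 * u12) ^ 2 ≤ (γ + 8 * (Λ * M * M)) ^ 2 := by
  have k : ∀ {u l v : ℝ}, |u| ≤ M → |l| ≤ Λ → |v| ≤ M → |u * l * v| ≤ Λ * M * M := by
    intro u l v h1 h2 h3
    rw [abs_mul, abs_mul, mul_comm |u|]
    gcongr
  have k1 := abs_le.1 (k h22 a1 hx)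
  have k2 := abs_le.1 (k h22 a4 hy)
  have k3 := abs_le.1 (k h11 a3 hx)
  have k4 := abs_le.1 (k h11 a6 hy)
  have k5 := abs_le.1 (k h12 a2 hx)
  have k6 := abs_le.1 (k h12 a5 hy)
  have hg := abs_le.1 hg
  apply sq_le_sq'
  · linarith [k1.1, k2.1, k3.1, k4.1, k5.2, k6.2, hg.1]
  · linarith [k1.2, k2.2, k3.2, k4.2, k5.1, k6.1, hg.2]

lemma energy_one {Λ g0 γ M : ℝ} (hΛ : 0 ≤ Λ) (hg0 : 0 < g0) (hM : 0 < M) {q : Cf}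
    {G p : ℝ × ℝ → ℝ} (hq : CfB q Λ) (hG : ∀ z, g0 ≤ G z) (hs : Sol q G p) (hp : Sm p)
    (hb : HM q p M) {D : (ℝ × ℝ → ℝ) → ℝ × ℝ → ℝ} (hD : Dv D) (hDp : Biperiodic (D p))
    (hDG : ∀ z, |D G z| ≤ γ) (hx : ∀ z, |pdx (D p) z| ≤ M) (hy : ∀ z, |pdy (D p) z| ≤ M) :
    TI (fun z => pdx (pdx (D p)) z ^ 2 + 2 * pdy (pdx (D p)) z ^ 2 + pdy (pdy (D p)) z ^ 2)
      ≤ 8 * M ^ 2 / g0 * (1 / g0 * (γ + 8 * (Λ * M * M)) ^ 2) := by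
  set v := D p with hv
  have hvs : Sm v := hD.sm hp
  have hdet := TI_det hvs.c2 hDp
  set K0 := 1 / g0 * (γ + 8 * (Λ * M * M)) ^ 2 with hK0
  have c1 := hvs.px.px.c
  have c2 := hvs.px.py.c
  have c3 := hvs.py.py.c
  have hpt : ∀ z, g0 / (8 * M ^ 2) * (pdx (pdx v) z ^ 2 + 2 * pdy (pdx v) z ^ 2 + pdy (pdy v) z ^ 2)
      ≤ K0 - (pdx (pdx v) z * pdy (pdy v) z - pdy (pdx v) z ^ 2) := by
    intro z
    have h1 := hb.b11 z
    have h2 := hb.b22 z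
    have hT : (u11 q p z + u22 q p z) ^ 2 ≤ 4 * M ^ 2 := by
      have : (u11 q p z + u22 q p z) ^ 2 ≤ (M + M) ^ 2 := by
        have := hs.pos1 z
        have := hs.pos2 z
        have := le_abs_self (u11 q p z)
        have := le_abs_self (u22 q p z)
        gcongr <;> linarith
      nlinarith
    have h3 := alg_energy (x11 := pdx (pdx v) z) (x12 := pdy (pdx v) z) (x22 := pdy (pdy v) z) hg0 hM
      (by rw [hs.eq z]; exact hG z) hT
    have h4 := main_bdd hM.le hΛ h1 (hb.b12 z) h2 (hx z) (hy z) hq.l11 hq.l12 hq.l22 hq.m11 hq.m12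
      hq.m22 (hDG z) (congrFun (Le_D hD hs hp) z)
    have h5 : 1 / g0 * (pdx (pdx v) z * u22 q p z + pdy (pdy v) z * u11 q p z
        - 2 * pdy (pdx v) z * u12 q p z) ^ 2 ≤ K0 := by
      rw [hK0]; gcongr
    linarith
  have h := TI_mono (by fun_prop) (by fun_prop) hpt
  rw [TI_mul, TI_sub (by fun_prop) (by fun_prop), hdet, TI_const, sub_zero] at h
  have e : g0 / (8 * M ^ 2) * (8 * M ^ 2 / g0 * K0) = K0 := by field_simp
  rw [← e] at h
  exact le_of_mul_le_mul_left h (by positivity)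

lemma energy {Λ g0 γ M : ℝ} (hΛ : 0 ≤ Λ) (hg0 : 0 < g0) (hM : 0 < M) :
    ∃ K, 0 < K ∧ ∀ q G p, CfB q Λ → (∀ z, g0 ≤ G z) → GC G γ → Sol q G p → Sm p → HM q p M →
      TI (Sq p) ≤ K := by
  refine ⟨2 * (8 * M ^ 2 / g0 * (1 / g0 * (γ + 8 * (Λ * M * M)) ^ 2)) + 1, by positivity, ?_⟩
  intro q G p hq hG hGC hs hp hb
  have e : ∀ z, |pdx (pdy p) z| ≤ M := by rw [pd_comm hp.c2]; exact hb.pxy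
  have h1 := energy_one hΛ hg0 hM hq hG hs hp hb dvx (per_pdx hs.per) hGC.x hb.pxx hb.pxy
  have h2 := energy_one hΛ hg0 hM hq hG hs hp hb dvy (per_pdy hs.per) hGC.y e hb.pyy
  have a1 := hp.px.px.px.c
  have a2 := hp.px.px.py.c
  have a3 := hp.px.py.py.c
  have a4 := hp.py.px.px.c
  have a5 := hp.py.px.py.c
  have a6 := hp.py.py.py.c
  have : TI (Sq p) = _ := TI_add (f := fun z => pdx (pdx (pdx p)) z ^ 2 + 2 * pdy (pdx (pdx p)) z ^ 2
    + pdy (pdy (pdx p)) z ^ 2) (g := fun z => pdx (pdx (pdy p)) z ^ 2 + 2 * pdy (pdx (pdy p)) z ^ 2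
    + pdy (pdy (pdy p)) z ^ 2) (by fun_prop) (by fun_prop)
  linarith

/-! #### Squares and strips -/

/-- Half-open box. -/
def bx (a b c d : ℝ) : Set (ℝ × ℝ) := Set.Ioc a b ×ˢ Set.Ioc c d

lemma bx_meas (a b c d : ℝ) : MeasurableSet (bx a b c d) := measurableSet_Ioc.prod measurableSet_Ioc

lemma bx_int {S : ℝ × ℝ → ℝ} (hS : Continuous S) (a b c d : ℝ) : IntegrableOn S (bx a b c d) := by
  have h : IntegrableOn S (Set.Icc a b ×ˢ Set.Icc c d) :=
    hS.continuousOn.integrableOn_compact (isCompact_Icc.prod isCompact_Icc)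
  exact h.mono_set (Set.prod_mono Set.Ioc_subset_Icc_self Set.Ioc_subset_Icc_self)

lemma bx_eq {S : ℝ × ℝ → ℝ} (hS : Continuous S) {a b c d : ℝ} (hab : a ≤ b) (hcd : c ≤ d) :
    ∫ z in bx a b c d, S z = ∫ x in a..b, ∫ y in c..d, S (x, y) := by
  have h := bx_int hS a b c d
  have := setIntegral_prod S h
  rw [intervalIntegral.integral_of_le hab]
  simp_rw [intervalIntegral.integral_of_le hcd]
  exact this

lemma bx_full {S : ℝ × ℝ → ℝ} (hS : Continuous S) (hp : Biperiodic S) (x0 y0 : ℝ) :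
    ∫ z in bx (x0 - 1/2) (x0 + 1/2) (y0 - 1/2) (y0 + 1/2), S z = TI S := by
  rw [bx_eq hS (by linarith) (by linarith), ← TI_shift hS hp (x0 - 1/2, y0 - 1/2), TI_eq (by fun_prop)]
  have e : ∀ x y : ℝ, ((x, y) + (x0 - 1/2, y0 - 1/2) : ℝ × ℝ) = (x + (x0 - 1/2), y + (y0 - 1/2)) :=
    fun x y => rfl
  simp only [e]
  have h1 : ∀ x : ℝ, ∫ y in (0:ℝ)..1, S (x + (x0 - 1/2), y + (y0 - 1/2))
      = ∫ y in (y0 - 1/2)..(y0 + 1/2), S (x + (x0 - 1/2), y) := by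
    intro x
    rw [intervalIntegral.integral_comp_add_right (fun y => S (x + (x0 - 1/2), y))]
    congr 1 <;> ring
  simp only [h1]
  rw [intervalIntegral.integral_comp_add_right
    (fun x => ∫ y in (y0 - 1/2)..(y0 + 1/2), S (x, y))]
  congr 1 <;> ring

lemma bx_sub_le {S : ℝ × ℝ → ℝ} (hS : Continuous S) (hS0 : ∀ z, 0 ≤ S z) {a b c d a' b' c' d' A B C D : ℝ}
    (hd : Disjoint (bx a b c d) (bx a' b' c' d')) (h1 : bx a b c d ⊆ bx A B C D)
    (h2 : bx a' b' c' d' ⊆ bx A B C D) :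
    (∫ z in bx a b c d, S z) ≤ (∫ z in bx A B C D, S z) - ∫ z in bx a' b' c' d', S z := by
  have h := setIntegral_union hd (bx_meas a' b' c' d') (bx_int hS a b c d) (bx_int hS a' b' c' d')
  have h3 : ∫ z in bx a b c d ∪ bx a' b' c' d', S z ≤ ∫ z in bx A B C D, S z :=
    setIntegral_mono_set (bx_int hS A B C D) (Filter.Eventually.of_forall hS0)
      (Set.union_subset h1 h2).eventuallyLE
  linarith

lemma good_line {S : ℝ × ℝ → ℝ} (hS : Continuous S) {a b c d ε : ℝ} (hab : a < b) (hcd : c ≤ d)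
    (h : ∫ z in bx a b c d, S z ≤ ε) : ∃ x ∈ Set.Icc a b, ∫ y in c..d, S (x, y) ≤ ε / (b - a) := by
  rw [bx_eq hS hab.le hcd] at h
  by_contra hc
  push Not at hc
  have hcont : Continuous (fun x => ∫ y in c..d, S (x, y)) :=
    intervalIntegral.continuous_parametric_intervalIntegral_of_continuous' (by fun_prop) _ _
  have hpos := intervalIntegral.intervalIntegral_pos_of_pos_on
    (f := fun x => (∫ y in c..d, S (x, y)) - ε / (b - a)) (a := a) (b := b)
    ((hcont.sub continuous_const).intervalIntegrable _ _)
    (fun x hx => sub_pos.2 (hc x ⟨hx.1.le, hx.2.le⟩)) hab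
  rw [intervalIntegral.integral_sub (hcont.intervalIntegrable _ _) (by simp)] at hpos
  simp only [intervalIntegral.integral_const, smul_eq_mul] at hpos
  have : (b - a) * (ε / (b - a)) = ε := by field_simp [(sub_pos.2 hab).ne']
  linarith

lemma bx_swap {S : ℝ × ℝ → ℝ} (hS : Continuous S) {a b c d : ℝ} (hab : a ≤ b) (hcd : c ≤ d) :
    ∫ z in bx a b c d, S z = ∫ z in bx c d a b, S z.swap := by
  rw [bx_eq hS hab hcd, bx_eq (by fun_prop) hcd hab]
  simp only [Prod.swap_prod_mk]
  apply intervalIntegral_intervalIntegral_swap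
  have h := bx_int hS a b c d
  rw [Set.uIoc_of_le hab, Set.uIoc_of_le hcd]
  exact h

lemma good_line' {S : ℝ × ℝ → ℝ} (hS : Continuous S) {a b c d ε : ℝ} (hab : a ≤ b) (hcd : c < d)
    (h : ∫ z in bx a b c d, S z ≤ ε) : ∃ y ∈ Set.Icc c d, ∫ x in a..b, S (x, y) ≤ ε / (d - c) := by
  rw [bx_swap hS hab hcd.le] at h
  exact good_line (S := fun z => S z.swap) (by fun_prop) hcd hab h

lemma line_osc {g g' s : ℝ → ℝ} (hg : ∀ t, HasDerivAt g (g' t) t) (hg' : Continuous g')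
    (hs : Continuous s) (h : ∀ t, g' t ^ 2 ≤ s t) {c d lam I : ℝ} (hl : 0 < lam)
    (hI : ∫ t in c..d, s t ≤ I) {t t' : ℝ} (ht : t ∈ Set.Icc c d) (ht' : t' ∈ Set.Icc c d) :
    |g t' - g t| ≤ lam * (d - c) / 2 + I / (2 * lam) := by
  wlog htt : t ≤ t' generalizing t t'
  · rw [abs_sub_comm]; exact this ht' ht (by linarith)
  have h1 : ∫ x in t..t', g' x = g t' - g t :=
    intervalIntegral.integral_eq_sub_of_hasDerivAt (fun x _ => hg x) (hg'.intervalIntegrable _ _)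
  rw [← h1]
  have hpt : ∀ x, |g' x| ≤ lam / 2 + s x / (2 * lam) := by
    intro x
    have e : lam / 2 + s x / (2 * lam) = (lam ^ 2 + s x) / (2 * lam) := by field_simp
    rw [e, le_div_iff₀ (by positivity)]
    nlinarith [h x, sq_nonneg (lam - |g' x|), sq_abs (g' x)]
  have hcd : c ≤ d := ht.1.trans ht.2
  calc |∫ x in t..t', g' x| ≤ ∫ x in t..t', |g' x| := intervalIntegral.abs_integral_le_integral_abs htt
    _ ≤ ∫ x in t..t', (lam / 2 + s x / (2 * lam)) := by
        apply intervalIntegral.integral_mono_on htt (hg'.abs.intervalIntegrable _ _)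
        · exact Continuous.intervalIntegrable (by fun_prop) _ _
        · intro x _; exact hpt x
    _ ≤ ∫ x in c..d, (lam / 2 + s x / (2 * lam)) := by
        apply intervalIntegral.integral_mono_interval ht.1 htt ht'.2
        · exact Filter.Eventually.of_forall fun x => (abs_nonneg _).trans (hpt x)
        · exact Continuous.intervalIntegrable (by fun_prop) _ _
    _ = lam * (d - c) / 2 + (∫ x in c..d, s x) / (2 * lam) := by
        rw [intervalIntegral.integral_add (by simp) (Continuous.intervalIntegrable (by fun_prop) _ _),
          intervalIntegral.integral_div]
        simp; ring
    _ ≤ _ := by gcongr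

lemma good_scale {S : ℝ × ℝ → ℝ} (hS : Continuous S) (hS0 : ∀ z, 0 ≤ S z) (hp : Biperiodic S) {K : ℝ}
    (hK : TI S ≤ K) (x0 y0 : ℝ) {N k0 : ℕ} (hN : 0 < N) (hk0 : 1 ≤ k0) :
    ∃ k, k0 ≤ k ∧ k < k0 + N ∧ ∀ r : ℝ, r = (1 / 2) ^ k →
      (∫ z in bx (x0 - r) (x0 + r) (y0 - r) (y0 + r), S z)
        - (∫ z in bx (x0 - r / 2) (x0 + r / 2) (y0 - r / 2) (y0 + r / 2), S z) ≤ K / N := by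
  set E : ℕ → ℝ := fun k => ∫ z in bx (x0 - (1/2) ^ k) (x0 + (1/2) ^ k) (y0 - (1/2) ^ k)
    (y0 + (1/2) ^ k), S z with hE
  have hr : (1 / 2 : ℝ) ^ k0 ≤ 1 / 2 := by
    calc (1 / 2 : ℝ) ^ k0 ≤ (1 / 2) ^ 1 := pow_le_pow_of_le_one (by norm_num) (by norm_num) hk0
      _ = 1 / 2 := by norm_num
  have h1 : E k0 ≤ K := by
    refine le_trans ?_ hK
    rw [← bx_full hS hp x0 y0]
    refine setIntegral_mono_set (bx_int hS _ _ _ _) (Filter.Eventually.of_forall hS0) ?_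
    refine (Set.prod_mono ?_ ?_).eventuallyLE <;> apply Set.Ioc_subset_Ioc <;> linarith
  have h2 : 0 ≤ E (k0 + N) := setIntegral_nonneg (bx_meas _ _ _ _) fun z _ => hS0 z
  have h3 : ∑ j ∈ Finset.range N, (E (k0 + j) - E (k0 + (j + 1))) = E (k0 + 0) - E (k0 + N) :=
    Finset.sum_range_sub' (fun j => E (k0 + j)) N
  have hNe : (N : ℝ) ≠ 0 := by positivity
  have h4 : ∃ j ∈ Finset.range N, E (k0 + j) - E (k0 + (j + 1)) ≤ K / N := by
    apply Finset.exists_le_of_sum_le (by simpa using hN.ne')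
    rw [h3, Finset.sum_const, Finset.card_range, nsmul_eq_mul]
    have : (N : ℝ) * (K / N) = K := by field_simp
    simp only [add_zero]
    linarith
  obtain ⟨j, hj, hle⟩ := h4
  refine ⟨k0 + j, by omega, by simpa using hj, fun r hr => ?_⟩
  have e : r / 2 = (1 / 2) ^ (k0 + (j + 1)) := by
    rw [hr, ← add_assoc, pow_succ]; ring
  rw [e, hr]
  exact hle

/-- Good rectangle. -/
theorem good_rect {S : ℝ × ℝ → ℝ} (hS : Continuous S) (hS0 : ∀ z, 0 ≤ S z) (hp : Biperiodic S) {K : ℝ}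
    (hK0 : 0 < K) (hK : TI S ≤ K) (x0 y0 : ℝ) {N k0 : ℕ} (hN : 0 < N) (hk0 : 1 ≤ k0) :
    ∃ r x1 x2 y1 y2 : ℝ, (1 / 2) ^ (k0 + N) ≤ r ∧ r ≤ (1 / 2) ^ k0 ∧
      x0 - r ≤ x1 ∧ x1 ≤ x0 - r / 2 ∧ x0 + r / 2 ≤ x2 ∧ x2 ≤ x0 + r ∧
      y0 - r ≤ y1 ∧ y1 ≤ y0 - r / 2 ∧ y0 + r / 2 ≤ y2 ∧ y2 ≤ y0 + r ∧
      ∀ f : ℝ × ℝ → ℝ, ContDiff ℝ 1 f → (∀ z, pdx f z ^ 2 ≤ S z ∧ pdy f z ^ 2 ≤ S z) →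
        ∀ x ∈ Set.Icc x1 x2, ∀ y ∈ Set.Icc y1 y2, (x = x1 ∨ x = x2 ∨ y = y1 ∨ y = y2) →
          |f (x, y) - f (x1, y1)| ≤ 4 * √(K / N) := by
  obtain ⟨k, hk1, hk2, hk⟩ := good_scale hS hS0 hp hK x0 y0 hN hk0
  set r : ℝ := (1 / 2) ^ k with hr
  have hr0 : 0 < r := by positivity
  have hkr := hk r rfl
  set ε := K / N with hε
  have hNp : (0:ℝ) < N := by exact_mod_cast hN
  have hε0 : 0 < ε := by positivity
  have dis1 : ∀ {a b c d a' b' c' d' : ℝ}, b ≤ a' ∨ b' ≤ a ∨ d ≤ c' ∨ d' ≤ c →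
      Disjoint (bx a b c d) (bx a' b' c' d') := by
    intro a b c d a' b' c' d' h
    rw [Set.disjoint_left]
    rintro z ⟨h1, h2⟩ ⟨h3, h4⟩
    obtain ⟨h1, h1'⟩ := h1
    obtain ⟨h2, h2'⟩ := h2
    obtain ⟨h3, h3'⟩ := h3
    obtain ⟨h4, h4'⟩ := h4
    rcases h with h | h | h | h <;> linarith
  have sub1 : ∀ {a b c d A B C D : ℝ}, A ≤ a → b ≤ B → C ≤ c → d ≤ D → bx a b c d ⊆ bx A B C D :=
    fun h1 h2 h3 h4 => Set.prod_mono (Set.Ioc_subset_Ioc h1 h2) (Set.Ioc_subset_Ioc h3 h4)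
  have sx1 := bx_sub_le hS hS0 (a := x0 - r) (b := x0 - r / 2) (c := y0 - r) (d := y0 + r)
    (dis1 (Or.inl le_rfl)) (sub1 le_rfl (by linarith) le_rfl le_rfl)
    (sub1 (a := x0 - r / 2) (b := x0 + r / 2) (c := y0 - r / 2) (d := y0 + r / 2) (B := x0 + r)
      (by linarith) (by linarith) (by linarith) (by linarith))
  have sx2 := bx_sub_le hS hS0 (a := x0 + r / 2) (b := x0 + r) (c := y0 - r) (d := y0 + r)
    (dis1 (Or.inr (Or.inl le_rfl))) (sub1 (by linarith) le_rfl le_rfl le_rfl)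
    (sub1 (a := x0 - r / 2) (b := x0 + r / 2) (c := y0 - r / 2) (d := y0 + r / 2) (A := x0 - r)
      (by linarith) (by linarith) (by linarith) (by linarith))
  have sy1 := bx_sub_le hS hS0 (a := x0 - r) (b := x0 + r) (c := y0 - r) (d := y0 - r / 2)
    (dis1 (Or.inr (Or.inr (Or.inl le_rfl)))) (sub1 le_rfl le_rfl le_rfl (by linarith))
    (sub1 (a := x0 - r / 2) (b := x0 + r / 2) (c := y0 - r / 2) (d := y0 + r / 2) (D := y0 + r)
      (by linarith) (by linarith) (by linarith) (by linarith))
  have sy2 := bx_sub_le hS hS0 (a := x0 - r) (b := x0 + r) (c := y0 + r / 2) (d := y0 + r)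
    (dis1 (Or.inr (Or.inr (Or.inr le_rfl)))) (sub1 le_rfl le_rfl (by linarith) le_rfl)
    (sub1 (a := x0 - r / 2) (b := x0 + r / 2) (c := y0 - r / 2) (d := y0 + r / 2) (C := y0 - r)
      (by linarith) (by linarith) (by linarith) (by linarith))
  obtain ⟨x1, ⟨hx1, hx1'⟩, ix1⟩ := good_line hS (by linarith) (by linarith) (sx1.trans hkr)
  obtain ⟨x2, ⟨hx2, hx2'⟩, ix2⟩ := good_line hS (by linarith) (by linarith) (sx2.trans hkr)
  obtain ⟨y1, ⟨hy1, hy1'⟩, iy1⟩ := good_line' hS (by linarith) (by linarith) (sy1.trans hkr)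
  obtain ⟨y2, ⟨hy2, hy2'⟩, iy2⟩ := good_line' hS (by linarith) (by linarith) (sy2.trans hkr)
  refine ⟨r, x1, x2, y1, y2, pow_le_pow_of_le_one (by norm_num) (by norm_num) hk2.le,
    pow_le_pow_of_le_one (by norm_num) (by norm_num) hk1, hx1, hx1', hx2, hx2', hy1, hy1', hy2, hy2', ?_⟩
  intro f hf hfS x hx y hy hb
  have hfd : Differentiable ℝ f := hf.differentiable (by norm_num)
  have cx := cont_pdx hf
  have cy := cont_pdy hf
  have hsq : √ε * √ε = ε := Real.mul_self_sqrt hε0.le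
  have hs0 : 0 < √ε := Real.sqrt_pos.2 hε0
  have hval : ∀ {c d s : ℝ}, d - c = 2 * r → s = r / 2 →
      √ε / r * (d - c) / 2 + ε / s / (2 * (√ε / r)) = 2 * √ε := by
    intro c d s h1 h2
    rw [h1, h2]
    have : ε / (r / 2) / (2 * (√ε / r)) = √ε := by
      nth_rewrite 1 [← hsq]
      field_simp
    rw [this]
    field_simp
    ring
  have Lx : ∀ {X ε' : ℝ}, (∫ y in (y0 - r)..(y0 + r), S (X, y) ≤ ε / ε') → ε' = r / 2 →
      ∀ t t', y1 ≤ t → t ≤ y2 → y1 ≤ t' → t' ≤ y2 → |f (X, t') - f (X, t)| ≤ 2 * √ε := by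
    intro X ε' hI he t t' h1 h2 h3 h4
    have := line_osc (g := fun y => f (X, y)) (fun t => hasDerivAt_y hfd X t) (by fun_prop)
      (s := fun y => S (X, y)) (by fun_prop) (fun t => (hfS _).2) (lam := √ε / r) (by positivity) hI
      (t := t) (t' := t') ⟨by linarith, by linarith⟩ ⟨by linarith, by linarith⟩
    rwa [hval (by ring) he] at this
  have Ly : ∀ {Y ε' : ℝ}, (∫ x in (x0 - r)..(x0 + r), S (x, Y) ≤ ε / ε') → ε' = r / 2 →
      ∀ t t', x1 ≤ t → t ≤ x2 → x1 ≤ t' → t' ≤ x2 → |f (t', Y) - f (t, Y)| ≤ 2 * √ε := by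
    intro Y ε' hI he t t' h1 h2 h3 h4
    have := line_osc (g := fun x => f (x, Y)) (fun t => hasDerivAt_x hfd t Y) (by fun_prop)
      (s := fun x => S (x, Y)) (by fun_prop) (fun t => (hfS _).1) (lam := √ε / r) (by positivity) hI
      (t := t) (t' := t') ⟨by linarith, by linarith⟩ ⟨by linarith, by linarith⟩
    rwa [hval (by ring) he] at this
  obtain ⟨hxa, hxb⟩ := hx
  obtain ⟨hya, hyb⟩ := hy
  have two : ∀ {A B C : ℝ}, |A - B| ≤ 2 * √ε → |B - C| ≤ 2 * √ε → |A - C| ≤ 4 * √ε := by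
    intro A B C h1 h2
    have := abs_sub_le A B C
    linarith
  rcases hb with rfl | rfl | rfl | rfl
  · have := Lx ix1 (by ring) y1 y le_rfl (by linarith) hya hyb
    linarith
  · exact two (Lx ix2 (by ring) y1 y le_rfl (by linarith) hya hyb)
      (Ly iy1 (by ring) x1 x le_rfl (by linarith) hxa hxb)
  · have := Ly iy1 (by ring) x1 x le_rfl (by linarith) hxa hxb
    linarith
  · exact two (Ly iy2 (by ring) x1 x le_rfl (by linarith) hxa hxb)
      (Lx ix1 (by ring) y1 y le_rfl (by linarith) hya hyb)

end GMA

/-! ### Part L: uniform modulus of continuity of the Hessian -/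

namespace GMA

lemma pdx_fst (c : ℝ) : pdx (fun z => z.1 - c) = fun _ => 1 := by
  ext z
  have h : HasFDerivAt (fun z : ℝ × ℝ => z.1 - c) (ContinuousLinearMap.fst ℝ ℝ ℝ) z :=
    hasFDerivAt_fst.sub_const c
  simp [pdx, h.fderiv]
lemma pdy_fst (c : ℝ) : pdy (fun z => z.1 - c) = fun _ => 0 := by
  ext z
  have h : HasFDerivAt (fun z : ℝ × ℝ => z.1 - c) (ContinuousLinearMap.fst ℝ ℝ ℝ) z :=
    hasFDerivAt_fst.sub_const c
  simp [pdy, h.fderiv]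
lemma pdx_snd (c : ℝ) : pdx (fun z => z.2 - c) = fun _ => 0 := by
  ext z
  have h : HasFDerivAt (fun z : ℝ × ℝ => z.2 - c) (ContinuousLinearMap.snd ℝ ℝ ℝ) z :=
    hasFDerivAt_snd.sub_const c
  simp [pdx, h.fderiv]
lemma pdy_snd (c : ℝ) : pdy (fun z => z.2 - c) = fun _ => 1 := by
  ext z
  have h : HasFDerivAt (fun z : ℝ × ℝ => z.2 - c) (ContinuousLinearMap.snd ℝ ℝ ℝ) z :=
    hasFDerivAt_snd.sub_const c
  simp [pdy, h.fderiv]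

lemma sm_fst (c : ℝ) : Sm (fun z => z.1 - c) := ContDiff.sub contDiff_fst contDiff_const
lemma sm_snd (c : ℝ) : Sm (fun z => z.2 - c) := ContDiff.sub contDiff_snd contDiff_const

/-- Squared distance. -/
def sd (x0 y0 : ℝ) (z : ℝ × ℝ) : ℝ := (z.1 - x0) * (z.1 - x0) + (z.2 - y0) * (z.2 - y0)

lemma sm_sd (x0 y0 : ℝ) : Sm (sd x0 y0) :=
  ((sm_fst x0).mul (sm_fst x0)).add ((sm_snd y0).mul (sm_snd y0))

lemma Le_sd {q : Cf} {p : ℝ × ℝ → ℝ} (x0 y0 : ℝ) (z : ℝ × ℝ) :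
    Le q p (sd x0 y0) z = 2 * (u22 q p z * (1 - q.l11 * (z.1 - x0) - q.m11 * (z.2 - y0))
      + u11 q p z * (1 - q.l22 * (z.1 - x0) - q.m22 * (z.2 - y0))
      - 2 * (u12 q p z * (- q.l12 * (z.1 - x0) - q.m12 * (z.2 - y0)))) := by
  have hx := sm_fst x0
  have hy := sm_snd y0
  have : sd x0 y0 = fun z => (fun z : ℝ × ℝ => (z.1 - x0) * (z.1 - x0)) z
    + (fun z : ℝ × ℝ => (z.2 - y0) * (z.2 - y0)) z := rfl
  rw [this, Le_add (hx.mul hx) (hy.mul hy), Le_sq hx, Le_sq hy]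
  simp only [Le, e11, e12, e22, pdx_fst, pdy_fst, pdx_snd, pdy_snd, pdx_const, pdy_const]
  ring

lemma trU_ge {g0 u11 u12 u22 : ℝ} (h1 : 0 < u11) (h2 : 0 < u22) (hd : g0 ≤ u11 * u22 - u12 ^ 2) :
    √g0 ≤ u11 + u22 := by
  apply Real.sqrt_le_iff.2
  constructor
  · linarith
  · nlinarith [sq_nonneg u12, mul_pos h1 h2]

lemma Le_sd_ge {Λ g0 : ℝ} {q : Cf} {G p : ℝ × ℝ → ℝ} (hΛ : 0 ≤ Λ) (hg0 : 0 < g0) (hq : CfB q Λ)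
    (hG : ∀ z, g0 ≤ G z) (hs : Sol q G p) {x0 y0 r : ℝ} {z : ℝ × ℝ} (hr0 : 0 ≤ r) (hr : 8 * Λ * r ≤ 1)
    (h1 : |z.1 - x0| ≤ r) (h2 : |z.2 - y0| ≤ r) : √g0 ≤ Le q p (sd x0 y0) z := by
  have p1 := hs.pos1 z
  have p2 := hs.pos2 z
  have he := hs.eq z
  have hg := hG z
  refine (trU_ge p1 p2 (he ▸ hg)).trans ?_
  rw [Le_sd]
  have k : ∀ {l v : ℝ}, |l| ≤ Λ → |v| ≤ r → |l * v| ≤ 1 / 8 := by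
    intro l v h1 h2
    rw [abs_mul]
    have : |l| * |v| ≤ Λ * r := by gcongr
    linarith
  have k1 := abs_le.1 (k hq.l11 h1)
  have k2 := abs_le.1 (k hq.m11 h2)
  have k3 := abs_le.1 (k hq.l22 h1)
  have k4 := abs_le.1 (k hq.m22 h2)
  have k5 := abs_le.1 (k hq.l12 h1)
  have k6 := abs_le.1 (k hq.m12 h2)
  have a1 : 3 / 4 ≤ 1 - q.l11 * (z.1 - x0) - q.m11 * (z.2 - y0) := by linarith [k1.2, k2.2]
  have a2 : 3 / 4 ≤ 1 - q.l22 * (z.1 - x0) - q.m22 * (z.2 - y0) := by linarith [k3.2, k4.2]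
  have a3 : |(- q.l12 * (z.1 - x0) - q.m12 * (z.2 - y0))| ≤ 1 / 4 := by
    rw [abs_le]; constructor <;> linarith [k5.1, k5.2, k6.1, k6.2]
  have a4 : 2 * |u12 q p z| ≤ u11 q p z + u22 q p z := by
    have : |2 * u12 q p z| ≤ u11 q p z + u22 q p z := by
      refine abs_le_of_sq_le_sq ?_ (by linarith)
      nlinarith [sq_nonneg (u11 q p z - u22 q p z)]
    rwa [abs_mul, abs_two] at this
  have a5 : 2 * (u12 q p z * (- q.l12 * (z.1 - x0) - q.m12 * (z.2 - y0))) ≤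
      (u11 q p z + u22 q p z) / 4 := by
    have h := le_abs_self (u12 q p z * (- q.l12 * (z.1 - x0) - q.m12 * (z.2 - y0)))
    rw [abs_mul] at h
    nlinarith [mul_le_mul_of_nonneg_left a3 (abs_nonneg (u12 q p z))]
  have a6 := mul_le_mul_of_nonneg_left a1 p2.le
  have a7 := mul_le_mul_of_nonneg_left a2 p1.le
  linarith

/-- Maximum principle on a rectangle. -/
lemma max_rect {Λ g0 C H : ℝ} {q : Cf} {G p h : ℝ × ℝ → ℝ} (hΛ : 0 ≤ Λ) (hg0 : 0 < g0) (hq : CfB q Λ)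
    (hG : ∀ z, g0 ≤ G z) (hs : Sol q G p) (hh : Sm h) (hC : 0 < C) (hL : ∀ z, -C ≤ Le q p h z)
    {x0 y0 r x1 x2 y1 y2 : ℝ} (hr0 : 0 ≤ r) (hr : 8 * Λ * r ≤ 1)
    (a1 : x0 - r ≤ x1) (a2 : x2 ≤ x0 + r) (a3 : y0 - r ≤ y1) (a4 : y2 ≤ y0 + r)
    (hb : ∀ x ∈ Set.Icc x1 x2, ∀ y ∈ Set.Icc y1 y2, (x = x1 ∨ x = x2 ∨ y = y1 ∨ y = y2) →
      h (x, y) ≤ H) :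
    ∀ x ∈ Set.Icc x1 x2, ∀ y ∈ Set.Icc y1 y2, h (x, y) ≤ H + 4 * C / √g0 * r ^ 2 := by
  intro x hx y hy
  have hsg : 0 < √g0 := Real.sqrt_pos.2 hg0
  set A := 2 * C / √g0 with hA
  have hA0 : 0 < A := by positivity
  set f : ℝ × ℝ → ℝ := fun z => h z + A * sd x0 y0 z with hf
  have hfs : Sm f := hh.add ((sm_sd x0 y0).cm A)
  have hcomp : IsCompact (Set.Icc x1 x2 ×ˢ Set.Icc y1 y2) := isCompact_Icc.prod isCompact_Icc
  obtain ⟨w, ⟨hw1, hw2⟩, hmax⟩ := hcomp.exists_isMaxOn ⟨(x, y), hx, hy⟩ hfs.c.continuousOn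
  have hsd : ∀ z : ℝ × ℝ, z.1 ∈ Set.Icc x1 x2 → z.2 ∈ Set.Icc y1 y2 → sd x0 y0 z ≤ 2 * r ^ 2 := by
    intro z hz1 hz2
    have b1 : |z.1 - x0| ≤ r := abs_le.2 ⟨by linarith [hz1.1], by linarith [hz1.2]⟩
    have b2 : |z.2 - y0| ≤ r := abs_le.2 ⟨by linarith [hz2.1], by linarith [hz2.2]⟩
    have := sq_le_sq' (abs_le.1 b1).1 (abs_le.1 b1).2
    have := sq_le_sq' (abs_le.1 b2).1 (abs_le.1 b2).2
    unfold sd; linarith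
  have hG0 : ∀ z, 0 < G z := fun z => hg0.trans_le (hG z)
  have hfx : f (x, y) ≤ f w := hmax ⟨hx, hy⟩
  have hs0 : 0 ≤ sd x0 y0 (x, y) := by
    unfold sd
    nlinarith [sq_nonneg ((x, y).1 - x0), sq_nonneg ((x, y).2 - y0)]
  have hbd : h w ≤ H := by
    by_cases hcase : w.1 = x1 ∨ w.1 = x2 ∨ w.2 = y1 ∨ w.2 = y2
    · exact hb w.1 hw1 w.2 hw2 hcase
    · exfalso
      push Not at hcase
      obtain ⟨n1, n2, n3, n4⟩ := hcase
      have hnhds : Set.Icc x1 x2 ×ˢ Set.Icc y1 y2 ∈ nhds w := by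
        have : w = (w.1, w.2) := rfl
        rw [this]
        exact prod_mem_nhds (Icc_mem_nhds (lt_of_le_of_ne hw1.1 (Ne.symm n1)) (lt_of_le_of_ne hw1.2 n2))
          (Icc_mem_nhds (lt_of_le_of_ne hw2.1 (Ne.symm n3)) (lt_of_le_of_ne hw2.2 n4))
      have hloc : IsLocalMax f w := hmax.isLocalMax hnhds
      have h1 := Le_max hs hG0 hfs hloc
      rw [hf, Le_add hh ((sm_sd x0 y0).cm A), Le_cm (sm_sd x0 y0)] at h1
      have h2 := Le_sd_ge hΛ hg0 hq hG hs (x0 := x0) (y0 := y0) (z := w) hr0 hr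
        (abs_le.2 ⟨by linarith [hw1.1], by linarith [hw1.2]⟩)
        (abs_le.2 ⟨by linarith [hw2.1], by linarith [hw2.2]⟩)
      have h3 := hL w
      have h4 := mul_le_mul_of_nonneg_left h2 hA0.le
      have h5 : A * √g0 = 2 * C := by rw [hA]; field_simp
      linarith
  have h1 : A * sd x0 y0 w ≤ A * (2 * r ^ 2) := mul_le_mul_of_nonneg_left (hsd w hw1 hw2) hA0.le
  have h2 : 4 * C / √g0 * r ^ 2 = A * (2 * r ^ 2) := by rw [hA]; ring
  rw [h2]
  simp only [hf] at hfx
  have := mul_nonneg hA0.le hs0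
  linarith

/-- Directional derivative as an abstract derivation. -/
lemma dvab (α β : ℝ) : Dv (fun f z => α * pdx f z + β * pdy f z) where
  sm h := (h.px.cm α).add (h.py.cm β)
  add h h' := by ext z; simp only [pdx_add h.d h'.d, pdy_add h.d h'.d]; ring
  sub h h' := by ext z; simp only [pdx_sub h.d h'.d, pdy_sub h.d h'.d]; ring
  mul h h' := by ext z; simp only [pdx_mul h.d h'.d, pdy_mul h.d h'.d]; ring
  cm c h := by ext z; simp only [pdx_cmul c h.d, pdy_cmul c h.d]; ring
  cst c := by ext z; simp only [pdx_const, pdy_const]; ring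
  cx h := by
    rw [pdx_add (h.px.cm α).d (h.py.cm β).d, pdx_cmul α h.px.d, pdx_cmul β h.py.d, pd_comm h.c2]
  cy h := by
    rw [pdy_add (h.px.cm α).d (h.py.cm β).d, pdy_cmul α h.px.d, pdy_cmul β h.py.d, pd_comm h.c2]

lemma dd_eq {f : ℝ × ℝ → ℝ} (hf : Sm f) (α β : ℝ) :
    (fun z => α * pdx (fun z => α * pdx f z + β * pdy f z) z
      + β * pdy (fun z => α * pdx f z + β * pdy f z) z)
    = fun z => α ^ 2 * pdx (pdx f) z + 2 * (α * β) * pdy (pdx f) z + β ^ 2 * pdy (pdy f) z := by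
  ext z
  rw [pdx_add (hf.px.cm α).d (hf.py.cm β).d, pdx_cmul α hf.px.d, pdx_cmul β hf.py.d, pd_comm hf.c2,
    pdy_add (hf.px.cm α).d (hf.py.cm β).d, pdy_cmul α hf.px.d, pdy_cmul β hf.py.d]
  ring

lemma quad_bd {α β x y w t : ℝ} (hx : |x| ≤ t) (hy : |y| ≤ t) (hw : |w| ≤ t) :
    |α ^ 2 * x + 2 * (α * β) * y + β ^ 2 * w| ≤ 2 * (α ^ 2 + β ^ 2) * t := by
  have ht : 0 ≤ t := (abs_nonneg _).trans hx
  have h1 : |α ^ 2 * x| ≤ α ^ 2 * t := by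
    rw [abs_mul, abs_of_nonneg (sq_nonneg α)]; gcongr
  have h2 : |β ^ 2 * w| ≤ β ^ 2 * t := by
    rw [abs_mul, abs_of_nonneg (sq_nonneg β)]; gcongr
  have h3 : |2 * (α * β) * y| ≤ (α ^ 2 + β ^ 2) * t := by
    rw [abs_mul]
    have : |2 * (α * β)| ≤ α ^ 2 + β ^ 2 := by
      rw [abs_le]; constructor <;> nlinarith [sq_nonneg (α + β), sq_nonneg (α - β)]
    gcongr
  rw [abs_le] at *
  constructor <;> linarith [h1.1, h1.2, h2.1, h2.2, h3.1, h3.2]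

lemma Le_dd_ge {g0 γ : ℝ} {q : Cf} {G p : ℝ × ℝ → ℝ} (hg0 : 0 < g0) (hGs : Sm G)
    (hG : ∀ z, g0 ≤ G z) (hGC : GC G γ) (hs : Sol q G p) (hp : Sm p) (α β : ℝ) (z : ℝ × ℝ) :
    -((2 * γ + γ ^ 2 / g0) * (α ^ 2 + β ^ 2)) ≤ Le q p (fun z => α ^ 2 * pdx (pdx p) z
      + 2 * (α * β) * pdy (pdx p) z + β ^ 2 * pdy (pdy p) z) z := by
  have h := Le_DD_ge (dvab α β) hs hp (fun z => hg0.trans_le (hG z)) z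
  have hG2 := congrFun (dd_eq hGs α β) z
  rw [dd_eq hp, hG2] at h
  refine le_trans ?_ h
  have h1 := (abs_le.1 (quad_bd (α := α) (β := β) (hGC.xx z) (hGC.xy z) (hGC.yy z))).1
  have hx := abs_le.1 (hGC.x z)
  have hy := abs_le.1 (hGC.y z)
  have h2 : (α * pdx G z + β * pdy G z) ^ 2 / (2 * G z) ≤ (2 * γ ^ 2 * (α ^ 2 + β ^ 2)) / (2 * g0) := by
    have hx2 := sq_le_sq' hx.1 hx.2
    have hy2 := sq_le_sq' hy.1 hy.2
    have : (α * pdx G z + β * pdy G z) ^ 2 ≤ 2 * γ ^ 2 * (α ^ 2 + β ^ 2) := by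
      have e1 := mul_le_mul_of_nonneg_left hx2 (sq_nonneg α)
      have e2 := mul_le_mul_of_nonneg_left hy2 (sq_nonneg β)
      nlinarith [sq_nonneg (α * pdx G z - β * pdy G z)]
    have := hG z
    gcongr
  have h3 : (2 * γ ^ 2 * (α ^ 2 + β ^ 2)) / (2 * g0) = γ ^ 2 / g0 * (α ^ 2 + β ^ 2) := by
    field_simp
  rw [h3] at h2
  linarith

/-- Linear algebra: one-sided control of a perturbation gives two-sided control. -/
lemma mat_ctrl {g0 M δ a11 a12 a22 b11 b12 b22 : ℝ} (hg0 : 0 < g0) (hδ : 0 ≤ δ)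
    (a1 : 0 < a11) (a2 : 0 < a22) (b1 : 0 < b11) (b2 : 0 < b22)
    (a1' : a11 ≤ M) (a2' : a22 ≤ M) (b1' : b11 ≤ M) (b2' : b22 ≤ M)
    (ha : g0 ≤ a11 * a22 - a12 ^ 2) (hb : g0 ≤ b11 * b22 - b12 ^ 2)
    (hab : |(b11 * b22 - b12 ^ 2) - (a11 * a22 - a12 ^ 2)| ≤ δ)
    (hV : ∀ α β : ℝ, α ^ 2 * (b11 - a11) + 2 * (α * β) * (b12 - a12) + β ^ 2 * (b22 - a22)
      ≤ δ * (α ^ 2 + β ^ 2)) :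
    |b11 - a11| ≤ (1 + 2 / g0 * (M * (2 * M + 1))) * δ ∧
    |b12 - a12| ≤ (1 + 2 / g0 * (M * (2 * M + 1))) * δ ∧
    |b22 - a22| ≤ (1 + 2 / g0 * (M * (2 * M + 1))) * δ := by
  have hd := det_avg a1 a2 b1 b2 hg0 ha hb
  set c11 := (a11 + b11) / 2 with h11
  set c12 := (a12 + b12) / 2 with h12
  set c22 := (a22 + b22) / 2 with h22
  set w11 := δ - (b11 - a11) with hw11
  set w12 := - (b12 - a12) with hw12
  set w22 := δ - (b22 - a22) with hw22
  have hW : ∀ α β : ℝ, 0 ≤ α ^ 2 * w11 + 2 * (α * β) * w12 + β ^ 2 * w22 := by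
    intro α β
    have := hV α β
    rw [hw11, hw12, hw22]; linarith
  have hc11 : 0 < c11 := by rw [h11]; linarith
  have hc22 : 0 < c22 := by rw [h22]; linarith
  have hc11' : c11 ≤ M := by rw [h11]; linarith
  have hc22' : c22 ≤ M := by rw [h22]; linarith
  have hM : 0 ≤ M := by linarith
  set T := c22 * w11 + c11 * w22 - 2 * c12 * w12 with hT
  have hTe : T = δ * (c11 + c22) - ((b11 * b22 - b12 ^ 2) - (a11 * a22 - a12 ^ 2)) := by
    rw [hT, hw11, hw12, hw22, h11, h12, h22]; ring
  have hTle : T ≤ (2 * M + 1) * δ := by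
    rw [hTe]
    have := (abs_le.1 hab).1
    nlinarith [mul_le_mul_of_nonneg_left hc11' hδ, mul_le_mul_of_nonneg_left hc22' hδ]
  have w1 : 0 ≤ w11 := by have := hW 1 0; linarith
  have w2 : 0 ≤ w22 := by have := hW 0 1; linarith
  have hMT1 : c11 * T ≤ M * ((2 * M + 1) * δ) := by
    have : c11 * T ≤ c11 * ((2 * M + 1) * δ) := mul_le_mul_of_nonneg_left hTle hc11.le
    have : c11 * ((2 * M + 1) * δ) ≤ M * ((2 * M + 1) * δ) := by gcongr
    linarith
  have hMT2 : c22 * T ≤ M * ((2 * M + 1) * δ) := by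
    have : c22 * T ≤ c22 * ((2 * M + 1) * δ) := mul_le_mul_of_nonneg_left hTle hc22.le
    have : c22 * ((2 * M + 1) * δ) ≤ M * ((2 * M + 1) * δ) := by gcongr
    linarith
  have e1 : c11 * T = (c11 * c22 - c12 ^ 2) * w11
      + ((-c12) ^ 2 * w11 + 2 * (-c12 * c11) * w12 + c11 ^ 2 * w22) := by rw [hT]; ring
  have e2 : c22 * T = (c11 * c22 - c12 ^ 2) * w22
      + (c22 ^ 2 * w11 + 2 * (c22 * (-c12)) * w12 + (-c12) ^ 2 * w22) := by rw [hT]; ring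
  set L := 2 / g0 * (M * (2 * M + 1)) with hL
  have hLg : g0 / 2 * (L * δ) = M * ((2 * M + 1) * δ) := by rw [hL]; field_simp
  have f1 : w11 ≤ L * δ := by
    have := hW (-c12) c11
    have := mul_le_mul_of_nonneg_right hd w1
    refine le_of_mul_le_mul_left (a := g0 / 2) ?_ (by positivity)
    linarith
  have f2 : w22 ≤ L * δ := by
    have := hW c22 (-c12)
    have := mul_le_mul_of_nonneg_right hd w2
    refine le_of_mul_le_mul_left (a := g0 / 2) ?_ (by positivity)
    linarith
  have g1 := hW 1 1
  have g2 := hW 1 (-1)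
  refine ⟨?_, ?_, ?_⟩ <;> rw [abs_le] <;> constructor <;> linarith

end GMA

/-! ### Part N: the uniform modulus of continuity -/

namespace GMA

lemma low_err {Λ M r l m x y : ℝ} (hΛ : 0 ≤ Λ) (hl : |l| ≤ Λ) (hm : |m| ≤ Λ)
    (hx : |x| ≤ 4 * M * r) (hy : |y| ≤ 4 * M * r) : |-(l * x) - m * y| ≤ 8 * Λ * M * r := by
  have h1 : |l * x| ≤ Λ * (4 * M * r) := by
    rw [abs_mul]; exact mul_le_mul hl hx (abs_nonneg _) hΛ
  have h2 : |m * y| ≤ Λ * (4 * M * r) := by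
    rw [abs_mul]; exact mul_le_mul hm hy (abs_nonneg _) hΛ
  rw [abs_le] at *
  constructor <;> linarith [h1.1, h1.2, h2.1, h2.2]

lemma rect_osc {Λ g0 γ M τ : ℝ} {q : Cf} {G p : ℝ × ℝ → ℝ} (hΛ : 0 ≤ Λ) (hg0 : 0 < g0)
    (hγ : 0 ≤ γ) (hM : 0 < M) (hq : CfB q Λ) (hGs : Sm G)
    (hG : ∀ z, g0 ≤ G z) (hGC : GC G γ) (hs : Sol q G p) (hp : Sm p) (hb : HM q p M)
    {x0 y0 r x1 x2 y1 y2 : ℝ} (hr0 : 0 ≤ r) (hr1 : r ≤ 1) (hr : 8 * Λ * r ≤ 1) (hτ : 0 ≤ τ)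
    (a1 : x0 - r ≤ x1) (a2 : x2 ≤ x0 + r) (a3 : y0 - r ≤ y1) (a4 : y2 ≤ y0 + r)
    (hbd : ∀ x ∈ Set.Icc x1 x2, ∀ y ∈ Set.Icc y1 y2, (x = x1 ∨ x = x2 ∨ y = y1 ∨ y = y2) →
      |pdx (pdx p) (x, y) - pdx (pdx p) (x1, y1)| ≤ τ ∧
      |pdy (pdx p) (x, y) - pdy (pdx p) (x1, y1)| ≤ τ ∧
      |pdy (pdy p) (x, y) - pdy (pdy p) (x1, y1)| ≤ τ)
    {x y : ℝ} (hx : x ∈ Set.Icc x1 x2) (hy : y ∈ Set.Icc y1 y2) :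
    |u11 q p (x, y) - u11 q p (x1, y1)| ≤ (1 + 2 / g0 * (M * (2 * M + 1))) *
      (2 * τ + (4 * (2 * γ + γ ^ 2 / g0 + 1) / √g0 + 16 * Λ * M + 4 * γ) * r) ∧
    |u12 q p (x, y) - u12 q p (x1, y1)| ≤ (1 + 2 / g0 * (M * (2 * M + 1))) *
      (2 * τ + (4 * (2 * γ + γ ^ 2 / g0 + 1) / √g0 + 16 * Λ * M + 4 * γ) * r) ∧
    |u22 q p (x, y) - u22 q p (x1, y1)| ≤ (1 + 2 / g0 * (M * (2 * M + 1))) *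
      (2 * τ + (4 * (2 * γ + γ ^ 2 / g0 + 1) / √g0 + 16 * Λ * M + 4 * γ) * r) := by
  set Cm := 2 * γ + γ ^ 2 / g0 + 1 with hCm
  have hCm0 : 0 < Cm := by positivity
  have hsg : 0 < √g0 := Real.sqrt_pos.2 hg0
  set δ := 2 * τ + (4 * Cm / √g0 + 16 * Λ * M + 4 * γ) * r with hδ
  have hδ0 : 0 ≤ δ := by positivity
  -- displacement
  have hn : ‖((x, y) : ℝ × ℝ) - (x1, y1)‖ ≤ 2 * r := by
    rw [Prod.norm_def]
    refine max_le ?_ ?_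
    · simp only [Prod.fst_sub, Real.norm_eq_abs]
      exact abs_le.2 ⟨by linarith [hx.1], by linarith [hx.2]⟩
    · simp only [Prod.snd_sub, Real.norm_eq_abs]
      exact abs_le.2 ⟨by linarith [hy.1], by linarith [hy.2]⟩
  have lip : ∀ (g : ℝ × ℝ → ℝ) (K : ℝ), 0 ≤ K → Differentiable ℝ g → (∀ z, |pdx g z| ≤ K) →
      (∀ z, |pdy g z| ≤ K) → |g (x, y) - g (x1, y1)| ≤ 4 * K * r := by
    intro g K hK hg k1 k2
    have h := lip_of_bdd hg k1 k2 (x1, y1) ((x, y) - (x1, y1))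
    rw [add_sub_cancel] at h
    have := mul_le_mul_of_nonneg_left hn (by linarith : 0 ≤ K + K)
    linarith
  have lx := lip (pdx p) M hM.le hp.px.d hb.pxx hb.pxy
  have ly := lip (pdy p) M hM.le hp.py.d (by rw [pd_comm hp.c2]; exact hb.pxy) hb.pyy
  have lG := lip G γ hγ hGs.d hGC.x hGC.y
  have E11 := low_err hΛ hq.l11 hq.m11 lx ly
  have E12 := low_err hΛ hq.l12 hq.m12 lx ly
  have E22 := low_err hΛ hq.l22 hq.m22 lx ly
  -- quadratic form estimate
  have key : ∀ α β : ℝ, α ^ 2 * (u11 q p (x, y) - u11 q p (x1, y1))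
      + 2 * (α * β) * (u12 q p (x, y) - u12 q p (x1, y1))
      + β ^ 2 * (u22 q p (x, y) - u22 q p (x1, y1)) ≤ δ * (α ^ 2 + β ^ 2) := by
    intro α β
    rcases (add_nonneg (sq_nonneg α) (sq_nonneg β)).eq_or_lt with h0 | h0
    · have hα : α = 0 := by nlinarith [sq_nonneg α, sq_nonneg β]
      have hβ : β = 0 := by nlinarith [sq_nonneg α, sq_nonneg β]
      rw [hα, hβ]; simp
    set s := α ^ 2 + β ^ 2 with hsdef
    set h : ℝ × ℝ → ℝ := fun z => α ^ 2 * pdx (pdx p) z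
      + 2 * (α * β) * pdy (pdx p) z + β ^ 2 * pdy (pdy p) z with hh
    have hhs : Sm h := ((hp.px.px.cm (α ^ 2)).add (hp.px.py.cm (2 * (α * β)))).add
      (hp.py.py.cm (β ^ 2))
    have hL : ∀ z, -(Cm * s) ≤ Le q p h z := by
      intro z
      have := Le_dd_ge hg0 hGs hG hGC hs hp α β z
      refine le_trans ?_ this
      rw [hCm]; nlinarith
    have hm := max_rect hΛ hg0 hq hG hs hhs (by positivity : 0 < Cm * s) hL
      (H := h (x1, y1) + 2 * s * τ) hr0 hr a1 a2 a3 a4 (by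
        intro x hx y hy hxy
        obtain ⟨t1, t2, t3⟩ := hbd x hx y hy hxy
        have := (abs_le.1 (quad_bd (α := α) (β := β) t1 t2 t3)).2
        simp only [hh]
        linarith) x hx y hy
    have hE := (abs_le.1 (quad_bd (α := α) (β := β) E11 E12 E22)).2
    have hr2 : 4 * (Cm * s) / √g0 * r ^ 2 ≤ (4 * Cm / √g0 * r) * s := by
      have : 4 * (Cm * s) / √g0 * r ^ 2 = (4 * Cm / √g0 * r) * s * r := by ring
      rw [this]
      exact mul_le_of_le_one_right (by positivity) hr1
    have hγr : 0 ≤ 4 * γ * r * s := by positivity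
    have e : α ^ 2 * (u11 q p (x, y) - u11 q p (x1, y1))
      + 2 * (α * β) * (u12 q p (x, y) - u12 q p (x1, y1))
      + β ^ 2 * (u22 q p (x, y) - u22 q p (x1, y1)) = (h (x, y) - h (x1, y1)) +
        (α ^ 2 * (-(q.l11 * (pdx p (x, y) - pdx p (x1, y1))) - q.m11 * (pdy p (x, y) - pdy p (x1, y1)))
        + 2 * (α * β) * (-(q.l12 * (pdx p (x, y) - pdx p (x1, y1))) - q.m12 * (pdy p (x, y) - pdy p (x1, y1)))
        + β ^ 2 * (-(q.l22 * (pdx p (x, y) - pdx p (x1, y1))) - q.m22 * (pdy p (x, y) - pdy p (x1, y1)))) := by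
      simp only [hh, u11, u12, u22]; ring
    have e2 : δ * s = 2 * s * τ + (4 * Cm / √g0 * r) * s + 2 * s * (8 * Λ * M * r) + 4 * γ * r * s := by
      rw [hδ]; ring
    rw [e, e2]
    linarith
  refine mat_ctrl hg0 hδ0 (hs.pos1 _) (hs.pos2 _) (hs.pos1 _) (hs.pos2 _)
    ((le_abs_self _).trans (hb.b11 _)) ((le_abs_self _).trans (hb.b22 _))
    ((le_abs_self _).trans (hb.b11 _)) ((le_abs_self _).trans (hb.b22 _))
    (by rw [hs.eq]; exact hG _) (by rw [hs.eq]; exact hG _) ?_ key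
  rw [hs.eq, hs.eq]
  refine lG.trans ?_
  have : 0 ≤ 2 * τ + (4 * Cm / √g0 + 16 * Λ * M) * r := by positivity
  rw [hδ]; linarith

theorem unif_mod {Λ g0 γ M : ℝ} (hΛ : 0 ≤ Λ) (hg0 : 0 < g0) (hγ : 0 ≤ γ) (hM : 0 < M)
    {η : ℝ} (hη : 0 < η) :
    ∃ ρ, 0 < ρ ∧ ∀ q G p, CfB q Λ → Sm G → (∀ z, g0 ≤ G z) → GC G γ → Sol q G p → Sm p →
      HM q p M → ∀ z v : ℝ × ℝ, ‖v‖ ≤ ρ → |u11 q p (z + v) - u11 q p z| ≤ η ∧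
        |u12 q p (z + v) - u12 q p z| ≤ η ∧ |u22 q p (z + v) - u22 q p z| ≤ η := by
  obtain ⟨K, hK0, hK⟩ := energy (γ := γ) hΛ hg0 hM
  have hsg : 0 < √g0 := Real.sqrt_pos.2 hg0
  set C' := 1 + 2 / g0 * (M * (2 * M + 1)) with hC'
  have hC'0 : 0 < C' := by positivity
  set A := 4 * (2 * γ + γ ^ 2 / g0 + 1) / √g0 + 16 * Λ * M + 4 * γ with hA
  have hA0 : 0 ≤ A := by positivity
  set δ0 := η / (2 * C') with hδ0
  have hδ0p : 0 < δ0 := by positivity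
  -- choice of the number of scales
  obtain ⟨N, hN0, hN⟩ : ∃ N : ℕ, 0 < N ∧ 2 * (4 * √(K / N)) ≤ δ0 / 2 := by
    obtain ⟨N, hN⟩ := exists_nat_gt (K / (δ0 / 16) ^ 2)
    have hNp : (0:ℝ) < N := lt_trans (by positivity) hN
    refine ⟨N, by exact_mod_cast hNp, ?_⟩
    have : √(K / N) ≤ δ0 / 16 := by
      rw [Real.sqrt_le_left (by positivity)]
      rw [div_lt_iff₀ (by positivity)] at hN
      rw [div_le_iff₀ hNp]; linarith
    linarith
  obtain ⟨k0, hk0⟩ : ∃ k0 : ℕ, (1 / 2 : ℝ) ^ k0 < min (1 / (8 * Λ + 1)) (δ0 / 2 / (A + 1)) :=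
    exists_pow_lt_of_lt_one (lt_min (by positivity) (by positivity)) (by norm_num)
  have hkk : (1 / 2 : ℝ) ^ (k0 + 1) ≤ (1 / 2 : ℝ) ^ k0 :=
    pow_le_pow_of_le_one (by norm_num) (by norm_num) (Nat.le_succ _)
  refine ⟨(1 / 2) ^ (k0 + 1 + N) / 2, by positivity, ?_⟩
  intro q G p hq hGs hG hGC hs hp hb z v hv
  have hI := hK q G p hq hG hGC hs hp hb
  obtain ⟨r, x1, x2, y1, y2, hr1, hr2, a1, a1', a2', a2, a3, a3', a4', a4, hbd⟩ :=
    good_rect (Sq_cont hp) (Sq_nonneg p) (Sq_per hs.per) hK0 hI z.1 z.2 hN0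
      (Nat.le_add_left 1 k0)
  have hr0 : 0 < r := lt_of_lt_of_le (by positivity) hr1
  have hrk := (hr2.trans hkk).trans hk0.le
  have rΛ : 8 * Λ * r ≤ 1 := by
    have := hrk.trans (min_le_left _ _)
    rw [le_div_iff₀ (by positivity)] at this
    linarith
  have rA : A * r ≤ δ0 / 2 := by
    have := hrk.trans (min_le_right _ _)
    rw [le_div_iff₀ (by positivity)] at this
    linarith
  have r1 : r ≤ 1 := hr2.trans (pow_le_one₀ (by norm_num) (by norm_num))
  have S := Sq_le hp
  have osc := fun (x : ℝ) (hx : x ∈ Set.Icc x1 x2) (y : ℝ) (hy : y ∈ Set.Icc y1 y2) =>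
    rect_osc hΛ hg0 hγ hM hq hGs hG hGC hs hp hb hr0.le r1 rΛ
      (by positivity : 0 ≤ 4 * √(K / N)) a1 a2 a3 a4
      (fun x hx y hy hxy => ⟨hbd _ hp.px.px.c1 (fun z => (S z).1) x hx y hy hxy,
        hbd _ hp.px.py.c1 (fun z => (S z).2.1) x hx y hy hxy,
        hbd _ hp.py.py.c1 (fun z => (S z).2.2) x hx y hy hxy⟩) hx hy
  have hδ : C' * (2 * (4 * √(K / N)) + A * r) ≤ η / 2 := by
    have h1 : C' * (2 * (4 * √(K / N)) + A * r) ≤ C' * δ0 := by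
      apply mul_le_mul_of_nonneg_left _ hC'0.le; linarith
    have h2 : C' * δ0 = η / 2 := by rw [hδ0]; field_simp
    linarith
  have hvr : ‖v‖ ≤ r / 2 := hv.trans (by linarith)
  have v1 := abs_le.1 ((norm_fst_le v).trans hvr)
  have v2 := abs_le.1 ((norm_snd_le v).trans hvr)
  obtain ⟨o1, o2, o3⟩ := osc z.1 ⟨by linarith, by linarith⟩ z.2 ⟨by linarith, by linarith⟩
  obtain ⟨o1', o2', o3'⟩ := osc (z.1 + v.1) ⟨by linarith [v1.1], by linarith [v1.2]⟩ (z.2 + v.2)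
    ⟨by linarith [v2.1], by linarith [v2.2]⟩
  have ez : z + v = (z.1 + v.1, z.2 + v.2) := rfl
  have ez' : ((z.1, z.2) : ℝ × ℝ) = z := rfl
  rw [← ez] at o1' o2' o3'
  rw [ez'] at o1 o2 o3
  have comb : ∀ s t w : ℝ, |s - w| ≤ η / 2 → |t - w| ≤ η / 2 → |t - s| ≤ η := by
    intro s t w k1 k2
    rw [abs_le] at *
    constructor <;> linarith [k1.1, k1.2, k2.1, k2.2]
  exact ⟨comb _ _ _ (o1.trans hδ) (o1'.trans hδ), comb _ _ _ (o2.trans hδ) (o2'.trans hδ),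
    comb _ _ _ (o3.trans hδ) (o3'.trans hδ)⟩

/-- The Hessian bound upgrades to a uniform modulus of continuity. -/
theorem exists_unif_HB {Λ g0 γ M : ℝ} (hΛ : 0 ≤ Λ) (hg0 : 0 < g0) (hγ : 0 ≤ γ) (hM : 0 < M) :
    ∃ σ : ℝ → ℝ, (∀ ε, 0 < ε → 0 < σ ε) ∧ ∀ q G p, CfB q Λ → Sm G → (∀ z, g0 ≤ G z) → GC G γ →
      Sol q G p → Sm p → HM q p M → HB q p M σ := by
  have key : ∀ ε : ℝ, ∃ ρ : ℝ, 0 < ε → (0 < ρ ∧ ∀ q G p, CfB q Λ → Sm G → (∀ z, g0 ≤ G z) →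
      GC G γ → Sol q G p → Sm p →
      HM q p M → ∀ z v : ℝ × ℝ, ‖v‖ ≤ ρ → |u11 q p (z + v) - u11 q p z| ≤ ε ∧
        |u12 q p (z + v) - u12 q p z| ≤ ε ∧ |u22 q p (z + v) - u22 q p z| ≤ ε) := by
    intro ε
    by_cases hε : 0 < ε
    · obtain ⟨ρ, h⟩ := unif_mod hΛ hg0 hγ hM hε
      exact ⟨ρ, fun _ => h⟩
    · exact ⟨0, fun h => absurd h hε⟩
  choose σ hσ using key
  refine ⟨σ, fun ε hε => (hσ ε hε).1, fun q G p hq hGs hG hGC hs hp hb => ?_⟩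
  have h := fun ε hε => (hσ ε hε).2 q G p hq hGs hG hGC hs hp hb
  exact ⟨hb.px, hb.py, hb.pxx, hb.pxy, hb.pyy, hb.b11, hb.b12, hb.b22,
    fun ε hε z v hv => (h ε hε z v hv).1, fun ε hε z v hv => (h ε hε z v hv).2.1,
    fun ε hε z v hv => (h ε hε z v hv).2.2⟩

end GMA

/-! ### Part M: assembly -/

namespace GMA

lemma gc_of {E : ℝ × ℝ → ℝ} (hE : Sm E) (hEp : Biperiodic E) :
    ∃ γ, 0 ≤ γ ∧ GC E γ := by
  obtain ⟨c1, p1, h1⟩ := per_bdd hE.px.c (per_pdx hEp)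
  obtain ⟨c2, p2, h2⟩ := per_bdd hE.py.c (per_pdy hEp)
  obtain ⟨c3, p3, h3⟩ := per_bdd hE.px.px.c (per_pdx (per_pdx hEp))
  obtain ⟨c4, p4, h4⟩ := per_bdd hE.px.py.c (per_pdy (per_pdx hEp))
  obtain ⟨c5, p5, h5⟩ := per_bdd hE.py.py.c (per_pdy (per_pdy hEp))
  exact ⟨c1 + c2 + c3 + c4 + c5, by positivity,
    fun z => (h1 z).trans (by linarith), fun z => (h2 z).trans (by linarith),
    fun z => (h3 z).trans (by linarith), fun z => (h4 z).trans (by linarith),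
    fun z => (h5 z).trans (by linarith)⟩

lemma gc_aff {E : ℝ × ℝ → ℝ} (hE : Sm E) {γ t d : ℝ} (h : GC E γ) (ht0 : 0 ≤ t) (ht1 : t ≤ 1) :
    GC (fun z => t * E z + d) γ := by
  have hc : Sm (fun _ : ℝ × ℝ => d) := contDiff_const
  have ex : pdx (fun z => t * E z + d) = fun z => t * pdx E z := by
    ext z
    rw [pdx_add (hE.cm t).d hc.d, pdx_cmul t hE.d, pdx_const]; simp
  have ey : pdy (fun z => t * E z + d) = fun z => t * pdy E z := by
    ext z
    rw [pdy_add (hE.cm t).d hc.d, pdy_cmul t hE.d, pdy_const]; simp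
  have tb : ∀ s : ℝ, |s| ≤ γ → |t * s| ≤ γ := by
    intro s hs
    rw [abs_mul, abs_of_nonneg ht0]
    exact (mul_le_of_le_one_left (abs_nonneg _) ht1).trans hs
  refine ⟨?_, ?_, ?_, ?_, ?_⟩
  · rw [ex]; exact fun z => tb _ (h.x z)
  · rw [ey]; exact fun z => tb _ (h.y z)
  · rw [ex, pdx_cmul t hE.px.d]; exact fun z => tb _ (h.xx z)
  · rw [ex, pdy_cmul t hE.px.d]; exact fun z => tb _ (h.xy z)
  · rw [ey, pdy_cmul t hE.py.d]; exact fun z => tb _ (h.yy z)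

lemma gb_aff {E : ℝ × ℝ → ℝ} (hE : Sm E) (hEp : Biperiodic E) (d0 : ℝ) (hd0 : 0 ≤ d0) :
    ∃ Γ : ℕ → ℝ, ∀ t d g0 : ℝ, 0 ≤ t → t ≤ 1 → |d| ≤ d0 → (∀ z, g0 ≤ t * E z + d) →
      GB (fun z => t * E z + d) g0 Γ := by
  choose C hC0 hC using fun n => dn_bound n E hE hEp
  refine ⟨fun n => C n + d0, fun t d g0 ht0 ht1 hd hg => ⟨?_, ?_, hg, ?_⟩⟩
  · exact (hE.cm t).add (contDiff_const : Sm (fun _ : ℝ × ℝ => d))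
  · intro x y
    exact ⟨by simp only [(hEp x y).1], by simp only [(hEp x y).2]⟩
  · intro n w z
    have e : dn w n (fun z => t * E z + d) z = t * dn w n E z + dn w n (fun _ => d) z := by
      rw [dn_add w (fun z => t * E z) (fun _ => d) n, dn_cmul]
    have h1 : |dn w n (fun _ => d) z| ≤ d0 * ‖w‖ ^ n := by
      rcases Nat.eq_zero_or_pos n with rfl | hn
      · simpa [dn] using hd
      · rw [dn_const w d n hn]; simp only [abs_zero]; positivity
    have h2 : |t * dn w n E z| ≤ C n * ‖w‖ ^ n := by
      rw [abs_mul, abs_of_nonneg ht0]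
      exact (mul_le_of_le_one_left (abs_nonneg _) ht1).trans (hC n w z)
    rw [e]
    calc _ ≤ _ := abs_add_le _ _
      _ ≤ C n * ‖w‖ ^ n + d0 * ‖w‖ ^ n := add_le_add h2 h1
      _ = _ := by ring

lemma posdef_two {a b c : ℝ} (h : (!![a, c; c, b]).PosDef) : 0 < a ∧ 0 < b ∧ 0 < a * b - c ^ 2 := by
  refine ⟨?_, ?_, ?_⟩
  · simpa using h.diag_pos (i := 0)
  · simpa using h.diag_pos (i := 1)
  · have := h.det_pos
    rw [Matrix.det_fin_two_of] at this
    nlinarith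

end GMA

open GMA

/-- Smoothness and a priori `C^k` estimates, uniform in `t ∈ [0,1]`, for solutions of the
deformed generalized Monge–Ampère equations on the 2-torus. -/
theorem gma_Ck_estimate (a b c l11 l12 l22 m11 m12 m22 : ℝ)
    (hpd : (!![a, c; c, b]).PosDef)
    (h1 : m11 * l22 = 0)
    (h2 : l11 * l22 - l12 ^ 2 = 0)
    (h3 : m11 * m22 - m12 ^ 2 = 0)
    (h4 : l11 * m22 + l22 * m11 - 2 * l12 * m12 = 0)
    (F : ℝ × ℝ → ℝ) (hF : ContDiff ℝ (⊤ : ℕ∞) F) (hFper : Biperiodic F)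
    (k : ℕ) (hk : 0 < k) :
    ∃ C : ℝ, 0 < C ∧ ∀ t : ℝ, t ∈ Set.Icc (0:ℝ) 1 →
      ∀ p : ℝ × ℝ → ℝ, ContDiff ℝ 2 p → Biperiodic p →
      (∀ z : ℝ × ℝ,
        (a + pdx (pdx p) z - t * l11 * pdx p z - t * m11 * pdy p z) *
            (b + pdy (pdy p) z - t * l22 * pdx p z - t * m22 * pdy p z) -
          (c + pdy (pdx p) z - t * l12 * pdx p z - t * m12 * pdy p z) ^ 2
            = t * Real.exp (F z) + (1 - t) * (a * b - c ^ 2)) →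
      (∀ z : ℝ × ℝ,
        (!![a + pdx (pdx p) z - t * l11 * pdx p z - t * m11 * pdy p z,
            c + pdy (pdx p) z - t * l12 * pdx p z - t * m12 * pdy p z;
            c + pdy (pdx p) z - t * l12 * pdx p z - t * m12 * pdy p z,
            b + pdy (pdy p) z - t * l22 * pdx p z - t * m22 * pdy p z]).PosDef) →
      ContDiff ℝ (⊤ : ℕ∞) p ∧
        ∀ j : ℕ, j ≤ k → ∀ z : ℝ × ℝ,
          ‖iteratedFDeriv ℝ j (fun w => p w - torusInt p) z‖ ≤ C := by
  obtain ⟨ha, hb, hdet⟩ := posdef_two hpd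
  set Δ := a * b - c ^ 2 with hΔ
  set E : ℝ × ℝ → ℝ := fun z => Real.exp (F z) with hEdef
  have hE : Sm E := Real.contDiff_exp.comp hF
  have hEp : Biperiodic E := fun x y => ⟨by simp only [hEdef, (hFper x y).1],
    by simp only [hEdef, (hFper x y).2]⟩
  obtain ⟨γ, hγ, hGC⟩ := gc_of hE hEp
  obtain ⟨Γ, hΓ⟩ := gb_aff hE hEp Δ hdet.le
  obtain ⟨KF, -, hKF⟩ := per_bdd hF.continuous hFper
  set g0 := min (Real.exp (-KF)) Δ with hg0def
  have hg0 : 0 < g0 := lt_min (Real.exp_pos _) hdet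
  set Λ := |a| + |b| + |c| + |l11| + |l12| + |l22| + |m11| + |m12| + |m22| with hΛdef
  have hΛ : 0 ≤ Λ := by positivity
  obtain ⟨M, hM, hc2⟩ := c2_bound hΛ hg0 hγ
  obtain ⟨σ, hσ, hmod⟩ := exists_unif_HB hΛ hg0 hγ hM
  obtain ⟨C, hC⟩ := reg_of_HB hM.le hΛ hg0 hσ Γ
  refine ⟨1 + ∑ j ∈ Finset.range (k + 1), |C j|, by positivity, ?_⟩
  intro t ht p hp2 hper heq hell
  obtain ⟨ht0, ht1⟩ := ht
  set q : Cf := ⟨a, b, c, t * l11, t * l12, t * l22, t * m11, t * m12, t * m22⟩ with hqdef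
  set G : ℝ × ℝ → ℝ := fun z => t * E z + (1 - t) * Δ with hGdef
  have tb : ∀ s : ℝ, |t * s| ≤ |s| := by
    intro s
    rw [abs_mul, abs_of_nonneg ht0]
    exact mul_le_of_le_one_left (abs_nonneg _) ht1
  have n1 := abs_nonneg a
  have n2 := abs_nonneg b
  have n3 := abs_nonneg c
  have n4 := abs_nonneg l11
  have n5 := abs_nonneg l12
  have n6 := abs_nonneg l22
  have n7 := abs_nonneg m11
  have n8 := abs_nonneg m12
  have n9 := abs_nonneg m22
  have hq : CfB q Λ := by
    refine ⟨?_, ?_, ?_, (tb l11).trans ?_, (tb l12).trans ?_, (tb l22).trans ?_,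
      (tb m11).trans ?_, (tb m12).trans ?_, (tb m22).trans ?_⟩ <;>
    (simp only [hqdef, hΛdef]; linarith)
  have hml : q.m11 * q.l22 = 0 := by
    have : q.m11 * q.l22 = t ^ 2 * (m11 * l22) := by simp only [hqdef]; ring
    rw [this, h1, mul_zero]
  have hGpos : ∀ z, g0 ≤ G z := by
    intro z
    have e1 : g0 ≤ E z := (min_le_left _ _).trans
      (Real.exp_le_exp.2 (abs_le.1 (hKF z)).1)
    have e2 : g0 ≤ Δ := min_le_right _ _
    have f1 := mul_le_mul_of_nonneg_left e1 ht0
    have f2 := mul_le_mul_of_nonneg_left e2 (sub_nonneg.2 ht1)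
    simp only [hGdef]; linarith
  have hd : |(1 - t) * Δ| ≤ Δ := by
    rw [abs_of_nonneg (mul_nonneg (sub_nonneg.2 ht1) hdet.le)]
    exact mul_le_of_le_one_left hdet.le (by linarith)
  have hGB : GB G g0 Γ := hΓ t _ g0 ht0 ht1 hd hGpos
  have hGC' : GC G γ := gc_aff hE hGC ht0 ht1
  have hs : Sol q G p := by
    refine ⟨hp2, hper, heq, fun z => ?_, fun z => ?_⟩
    · exact (posdef_two (hell z)).1
    · exact (posdef_two (hell z)).2.1
  have hsm : Sm p := smooth_of_sol hΛ hg0 hq hGB hs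
  have hHM := hc2 q G p hq hGB.cd hGpos hGC' hml hs hsm
  have hHB := hmod q G p hq hGB.cd hGpos hGC' hs hsm hHM
  obtain ⟨r1, r2⟩ := hC q G p hq hGB hs hHB
  refine ⟨r1, fun j hj z => (r2 j z).trans ?_⟩
  have hj' : j ∈ Finset.range (k + 1) := Finset.mem_range.2 (by omega)
  have := Finset.single_le_sum (f := fun j => |C j|) (fun i _ => abs_nonneg (C i)) hj'
  linarith [le_abs_self (C j)]
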